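/- arXiv:math/0201091 — 2 statements merged into one kernel-verified Lean document; each statement's English description precedes it below -/
import Mathlib

section
/- (Poincaré presentation) Every cocompact Fuchsian group Γ is isomorphic to a presented group Γ(g; ν₁,…,ν_r) for some integers g ≥ 0, r ≥ 0 and ν₁,…,ν_r ≥ 2. -/
open UpperHalfPlane Matrix
open scoped commutatorElement

/-- `SL(2,ℝ)`: 2×2 real matrices of determinant 1. -/
abbrev SL2R := Matrix.SpecialLinearGroup (Fin 2) ℝ

/-- The subspace topology on `SL(2,ℝ)` inherited from 2×2 real matrices. -/
instance : TopologicalSpace SL2R :=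
  TopologicalSpace.induced (fun g => (g : Matrix (Fin 2) (Fin 2) ℝ)) inferInstance

/-- `PSL(2,ℝ)`: the quotient of `SL(2,ℝ)` by its center `{±I}`,
with the quotient topology. -/
abbrev PSL2R := SL2R ⧸ Subgroup.center SL2R

/-- Generators for the presentation `Γ(g; ν₁,…,ν_r)`:
`Sum.inl (Sum.inl i) = aᵢ`, `Sum.inl (Sum.inr i) = bᵢ`, `Sum.inr j = cⱼ`. -/
abbrev FuchsianGen (g r : ℕ) := (Fin g ⊕ Fin g) ⊕ Fin r

/-- The relations `[a₁,b₁]⋯[a_g,b_g] (c₁⋯c_r)⁻¹` and `cⱼ^{νⱼ}` for `1 ≤ j ≤ r`. -/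
def fuchsianRels (g r : ℕ) (ν : Fin r → ℕ) : Set (FreeGroup (FuchsianGen g r)) :=
  insert
    ((List.ofFn fun i : Fin g =>
        ⁅(FreeGroup.of (Sum.inl (Sum.inl i)) : FreeGroup (FuchsianGen g r)),
          FreeGroup.of (Sum.inl (Sum.inr i))⁆).prod *
      ((List.ofFn fun j : Fin r =>
        (FreeGroup.of (Sum.inr j) : FreeGroup (FuchsianGen g r))).prod)⁻¹)
    (Set.range fun j : Fin r =>
      (FreeGroup.of (Sum.inr j) : FreeGroup (FuchsianGen g r)) ^ (ν j))

/-- The presented group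
`Γ(g; ν₁,…,ν_r) = ⟨a₁,b₁,…,a_g,b_g,c₁,…,c_r | [a₁,b₁]⋯[a_g,b_g] = c₁⋯c_r, cⱼ^{νⱼ} = 1⟩`. -/
abbrev FuchsianGroup (g r : ℕ) (ν : Fin r → ℕ) := PresentedGroup (fuchsianRels g r ν)

/-- The image of the generator `cⱼ` in `Γ(g; ν₁,…,ν_r)`. -/
def fuchsianC (g r : ℕ) (ν : Fin r → ℕ) (j : Fin r) : FuchsianGroup g r ν :=
  PresentedGroup.of (Sum.inr j)

set_option linter.unusedSectionVars false
set_option linter.unusedVariables false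

set_option linter.unusedSectionVars false
set_option linter.unusedVariables false

/-! ### Algebra: representing groups by solution functors -/

def GRep (Γ : Type) [Group Γ] (T : Type) (R : ∀ (H : Type) [Group H], (T → H) → Prop) : Prop :=
  ∃ f : T → Γ, R Γ f ∧
    (∀ (H : Type) [Group H] (v : T → H), R H v → ∃ F : Γ →* H, ∀ t, F (f t) = v t) ∧
    (∀ (H : Type) [Group H] (F F' : Γ →* H), (∀ t, F (f t) = F' (f t)) → F = F')

theorem GRep.transfer {Γ : Type} [Group Γ] {T T' : Type}
    {R : ∀ (H : Type) [Group H], (T → H) → Prop} {R' : ∀ (H : Type) [Group H], (T' → H) → Prop}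
    (h : GRep Γ T R)
    (e : ∀ (H : Type) [Group H], (T → H) → (T' → H))
    (d : ∀ (H : Type) [Group H], (T' → H) → (T → H))
    (en : ∀ (H K : Type) [Group H] [Group K] (F : H →* K) (v : T → H) (t : T'),
      e K (fun t => F (v t)) t = F (e H v t))
    (dn : ∀ (H K : Type) [Group H] [Group K] (F : H →* K) (v : T' → H) (t : T),
      d K (fun t => F (v t)) t = F (d H v t))
    (eR : ∀ (H : Type) [Group H] (v : T → H), R H v → R' H (e H v))
    (dR : ∀ (H : Type) [Group H] (v : T' → H), R' H v → R H (d H v))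
    (de : ∀ (H : Type) [Group H] (v : T → H), R H v → d H (e H v) = v)
    (ed : ∀ (H : Type) [Group H] (v : T' → H), R' H v → e H (d H v) = v) : GRep Γ T' R' := by
  obtain ⟨f, hf, hex, hun⟩ := h
  refine ⟨e Γ f, eR Γ f hf, ?_, ?_⟩
  · intro H _ v hv
    obtain ⟨F, hF⟩ := hex H (d H v) (dR H v hv)
    refine ⟨F, fun t => ?_⟩
    rw [← en, funext hF, ed H v hv]
  · intro H _ F F' hFF
    apply hun H F F'
    intro t
    rw [← de Γ f hf, ← dn, ← dn, funext hFF]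

theorem GRep.iff {Γ : Type} [Group Γ] {T : Type}
    {R R' : ∀ (H : Type) [Group H], (T → H) → Prop} (h : GRep Γ T R)
    (hR : ∀ (H : Type) [Group H] (v : T → H), R H v ↔ R' H v) : GRep Γ T R' :=
  h.transfer (fun _ _ v => v) (fun _ _ v => v) (by intros; rfl) (by intros; rfl)
    (fun H _ v => (hR H v).1) (fun H _ v => (hR H v).2) (by intros; rfl) (by intros; rfl)

theorem GRep.equiv {Γ Γ' : Type} [Group Γ] [Group Γ'] {T : Type}
    {R : ∀ (H : Type) [Group H], (T → H) → Prop} (h : GRep Γ T R) (h' : GRep Γ' T R) :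
    Nonempty (Γ ≃* Γ') := by
  obtain ⟨f, hf, hex, hun⟩ := h
  obtain ⟨f', hf', hex', hun'⟩ := h'
  obtain ⟨F, hF⟩ := hex Γ' f' hf'
  obtain ⟨F', hF'⟩ := hex' Γ f hf
  exact ⟨MonoidHom.toMulEquiv F F' (hun _ _ _ (by simp [hF, hF'])) (hun' _ _ _ (by simp [hF, hF']))⟩

theorem rep_presented {T : Type} (rels : Set (FreeGroup T)) :
    GRep (PresentedGroup rels) T (fun _ _ v => ∀ r ∈ rels, FreeGroup.lift v r = 1) := by
  refine ⟨PresentedGroup.of, ?_, ?_, ?_⟩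
  · intro r hr
    have : FreeGroup.lift (PresentedGroup.of (rels := rels)) = PresentedGroup.mk rels := by
      ext t; simp [PresentedGroup.of]
    rw [this]
    exact PresentedGroup.one_of_mem hr
  · intro H _ v hv
    exact ⟨PresentedGroup.toGroup hv, fun t => PresentedGroup.toGroup.of hv⟩
  · intro H _ F F' h
    exact PresentedGroup.ext h

section words
variable {T : Type} [DecidableEq T]

def Nx (w : List T) (a b : T) : Prop := ∃ l, w ~r (a :: l) ∧ (l ++ [a]).head? = some b

def Conn (ι : T → T) (words : List (List T)) : Prop :=
  ∀ P : T → Prop, (∀ t b, P t → (∃ w ∈ words, Nx w (ι t) b) → P b) →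
    ∀ t t', t ∈ words.flatten → t' ∈ words.flatten → P t → P t'

def upd {H : Type} [Group H] (ι : T → T) (x : T) (a : H) (v : T → H) (t : T) : H :=
  if t = x then a else if t = ι x then a⁻¹ else v t

theorem upd_self {H : Type} [Group H] (ι : T → T) (x : T) (a : H) (v : T → H) :
    upd ι x a v x = a := by simp [upd]

theorem upd_inv {H : Type} [Group H] (ι : T → T) (x : T) (a : H) (v : T → H) (h : ι x ≠ x) :
    upd ι x a v (ι x) = a⁻¹ := by simp [upd, h]

theorem upd_of_ne {H : Type} [Group H] (ι : T → T) (x : T) (a : H) (v : T → H) (t : T)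
    (h : t ≠ x) (h' : t ≠ ι x) : upd ι x a v t = v t := by simp [upd, h, h']

theorem upd_map {H : Type} [Group H] (ι : T → T) (x : T) (a : H) (v : T → H) (l : List T)
    (h : x ∉ l) (h' : ι x ∉ l) : l.map (upd ι x a v) = l.map v := by
  apply List.map_congr_left
  intro t ht
  exact upd_of_ne _ _ _ _ _ (by rintro rfl; exact h ht) (by rintro rfl; exact h' ht)

theorem upd_nat {H K : Type} [Group H] [Group K] (ι : T → T) (x : T) (a : H) (v : T → H)
    (F : H →* K) (t : T) : upd ι x (F a) (fun t => F (v t)) t = F (upd ι x a v t) := by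
  unfold upd; split_ifs <;> simp

theorem upd_upd {H : Type} [Group H] (ι : T → T) (x : T) (a b : H) (v : T → H) :
    upd ι x a (upd ι x b v) = upd ι x a v := by
  funext t; unfold upd; split_ifs <;> rfl

/-- the pairing and power relations -/
def Pw (ι : T → T) (ν : T → ℕ) (H : Type) [Group H] (v : T → H) : Prop :=
  (∀ t, ι t ≠ t → v (ι t) = (v t)⁻¹) ∧ (∀ t, ι t = t → v t ^ ν t = 1)

theorem Pw.upd {H : Type} [Group H] {ι : T → T} (hι : ∀ t, ι (ι t) = t) {ν : T → ℕ} {v : T → H}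
    (h : Pw ι ν H v) {x : T} (hx : ι x ≠ x) (a : H) : Pw ι ν H (upd ι x a v) := by
  constructor
  · intro t ht
    by_cases h1 : t = x
    · subst h1; rw [upd_inv _ _ _ _ hx, upd_self]
    · by_cases h2 : t = ι x
      · subst h2; rw [hι, upd_inv _ _ _ _ hx, upd_self, inv_inv]
      · rw [upd_of_ne _ _ _ _ _ h1 h2, upd_of_ne, h.1 t ht]
        · rintro h3; exact h2 (by rw [← h3, hι])
        · intro h3; exact h1 (by rw [← hι t, h3, hι])
  · intro t ht
    rw [upd_of_ne, h.2 t ht]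
    · rintro rfl; exact hx ht
    · rintro rfl; exact hx (by rw [hι] at ht; exact ht.symm)

theorem Pw.upd_eq {H : Type} [Group H] {ι : T → T} {ν : T → ℕ} {v : T → H}
    (h : Pw ι ν H v) {x : T} (hx : ι x ≠ x) : _root_.upd ι x (v x) v = v := by
  funext t; unfold _root_.upd; split_ifs with h1 h2
  · rw [h1]
  · rw [h2, h.1 x hx]
  · rfl

/-! ### Merging words -/

def SolM (ι : T → T) (ν : T → ℕ) (words : List (List T)) (H : Type) [Group H] (v : T → H) : Prop :=
  Pw ι ν H v ∧ (∀ w ∈ words, (w.map v).prod = 1) ∧ ∀ t, t ∉ words.flatten → v t = 1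

def Good (ι : T → T) (words : List (List T)) : Prop :=
  words.flatten.Nodup ∧ (∀ t ∈ words.flatten, ι t ∈ words.flatten) ∧ Conn ι words

theorem Nx.rot {w w' : List T} (h : w ~r w') {a b : T} (hn : Nx w a b) : Nx w' a b := by
  obtain ⟨l, h1, h2⟩ := hn
  exact ⟨l, h.symm.trans h1, h2⟩

theorem prod_rot {H : Type} [Group H] {w w' : List T} (h : w ~r w') (v : T → H)
    (hw : (w.map v).prod = 1) : (w'.map v).prod = 1 := by
  obtain ⟨n, hn⟩ := h.map v
  rw [← hn]; exact List.prod_rotate_eq_one_of_prod_eq_one hw n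

theorem rot_app (l l' : List T) : (l ++ l') ~r (l' ++ l) := List.isRotated_append

theorem rot_unique {l1 l2 l : List T} {a : T} (hn : (l1 ++ a :: l2).Nodup)
    (h : (l1 ++ a :: l2) ~r (a :: l)) : l = l2 ++ l1 := by
  have h1 : (a :: (l2 ++ l1)) ~r (a :: l) := (rot_app l1 (a :: l2)).symm.trans h
  have hn' : (a :: (l2 ++ l1)).Nodup := (rot_app l1 (a :: l2)).nodup_iff.1 hn
  obtain ⟨n, hn1, hn2⟩ := List.isRotated_iff_mod.1 h1
  rcases Nat.lt_or_ge n (a :: (l2 ++ l1)).length with h3 | h3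
  · have h4 : ((a :: (l2 ++ l1)).rotate n)[0]? = some a := by rw [hn2]; rfl
    rw [List.getElem?_rotate (by simp)] at h4
    simp only [zero_add, Nat.mod_eq_of_lt h3] at h4
    have h5 : n = 0 := by
      have := List.getElem?_eq_some_iff.1 h4
      obtain ⟨h6, h7⟩ := this
      exact (hn'.getElem_inj_iff (hi := h6) (hj := by simp)).1 (by rw [h7]; rfl)
    subst h5
    simpa using hn2.symm
  · have : n = (a :: (l2 ++ l1)).length := le_antisymm hn1 h3
    rw [this, List.rotate_length] at hn2
    simpa using hn2.symm

theorem Nx.head {l1 l2 : List T} {a b : T} (hn : (l1 ++ a :: l2).Nodup)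
    (h : Nx (l1 ++ a :: l2) a b) : (l2 ++ l1 ++ [a]).head? = some b := by
  obtain ⟨l, h1, h2⟩ := h
  rw [← rot_unique hn h1]; exact h2

theorem Nx.of_head {w l1 l2 : List T} {a b : T} (hw : w ~r (l1 ++ a :: l2))
    (h : (l2 ++ l1 ++ [a]).head? = some b) : Nx w a b :=
  ⟨l2 ++ l1, hw.trans (rot_app l1 (a :: l2)), h⟩

theorem Nx.mem {w : List T} {a b : T} (h : Nx w a b) : a ∈ w ∧ b ∈ w := by
  obtain ⟨l, h1, h2⟩ := h
  refine ⟨h1.mem_iff.2 (by simp), h1.mem_iff.2 ?_⟩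
  have := List.mem_of_mem_head? h2
  simp at this ⊢; tauto

def hP (P : T → Prop) (l : List T) : Prop := ∃ b, l.head? = some b ∧ P b

theorem seg {ι : T → T} (hι : ∀ t, ι (ι t) = t) {old new : List T} {x y : T} {A R N : List T}
    {P P' : T → Prop} (ho : old ~r (x :: (A ++ R))) (hod : (x :: (A ++ R)).Nodup)
    (hy : (R ++ [x]).head? = some y) (hnew : new ~r (A ++ N))
    (hdel : ∀ c ∈ A ++ N, (P c ↔ P' c)) 
    (hPy : P y ↔ hP P' (N ++ A)) (hPx : P (ι x) ↔ hP P' (A ++ N))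
    (hP' : ∀ t b, P' t → Nx new (ι t) b → P' b)
    {u b : T} (hu' : ι u ∈ A → (P u ↔ P' u)) (hu : ι u ∈ x :: A) (hPu : P u) (hb : Nx old (ι u) b) : P b := by
  have hb := hb.rot ho
  rcases List.mem_cons.1 hu with h | h
  · have hux : u = ι x := by rw [← h, hι]
    rw [h] at hb
    have hb := Nx.head (l1 := []) hod hb
    rw [hux, hPx] at hPu
    obtain ⟨c, hc1, hc2⟩ := hPu
    cases A with
    | nil =>
      simp only [List.nil_append, List.append_nil] at hb hc1 hPy
      have : b = y := by rw [hy] at hb; exact (Option.some.inj hb).symm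
      rw [this, hPy]; exact ⟨c, hc1, hc2⟩
    | cons a A =>
      simp at hb hc1
      subst hb; subst hc1
      exact (hdel _ (by simp)).2 hc2
  · have hPu' := (hu' h).1 hPu
    obtain ⟨l1, l2, hl⟩ := List.append_of_mem h
    have e1 : x :: (A ++ R) = (x :: l1) ++ ι u :: (l2 ++ R) := by rw [hl]; simp
    rw [e1] at hb hod
    have hb := Nx.head hod hb
    have key : ∀ c, (l2 ++ N ++ l1 ++ [ι u]).head? = some c → P' c := fun c hc =>
      hP' u c hPu' (Nx.of_head (l1 := l1) (l2 := l2 ++ N) (hnew.trans (by rw [hl]; simp; exact List.IsRotated.refl _)) hc)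
    cases l2 with
    | nil =>
      have : b = y := by
        have : (R ++ x :: (l1 ++ [ι u])).head? = some b := by simpa using hb
        cases R <;> simp_all
      rw [this, hPy]
      cases hN : (N ++ A).head? with
      | none => exfalso; simp [hl] at hN
      | some c => exact ⟨c, hN, key c (by rw [← hN, hl]; simp)⟩
    | cons a l2 =>
      simp at hb key
      subst hb
      exact (hdel _ (by simp [hl])).2 key


theorem conn_merge {ι : T → T} (hι : ∀ t, ι (ι t) = t) {t : T} {A B : List T} {ws : List (List T)}
    (hg : Good ι ((t :: A) :: (ι t :: B) :: ws)) (ht : ι t ≠ t) : Good ι ((A ++ B) :: ws) := by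
  obtain ⟨h1, h2, h3⟩ := hg
  simp only [List.flatten_cons, List.cons_append, List.nodup_cons, List.nodup_append,
    List.mem_append, List.mem_cons, not_or] at h1 h2
  have hi : ∀ c d, ι c = d → c = ι d := fun c d h => by rw [← h, hι]
  refine ⟨?_, ?_, ?_⟩
  · simp only [List.flatten_cons, List.nodup_append, List.mem_append]
    grind
  · simp only [List.flatten_cons, List.mem_append]
    intro c hc
    have := h2 c (by tauto)
    grind
  · intro P' hP' u u' hu hu' hPu
    classical
    let P : T → Prop := fun u => if u = t then hP P' (B ++ A) else if u = ι t then hP P' (A ++ B)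
      else P' u
    have hPt : P t ↔ hP P' (B ++ A) := by simp [P]
    have hPt' : P (ι t) ↔ hP P' (A ++ B) := by simp [P, ht]
    have hPc : ∀ c, c ≠ t → c ≠ ι t → (P c ↔ P' c) := by
      intro c h h'; simp [P, h, h']
    have hcl : ∀ t_1 b, P t_1 → (∃ w ∈ (t :: A) :: (ι t :: B) :: ws, Nx w (ι t_1) b) → P b := by
      rintro c b hc ⟨w, hw, hN⟩
      rcases List.mem_cons.1 hw with rfl | hw
      · have hcm := hN.mem.1
        refine seg (R := []) (y := t) (N := B) (P' := P') hι (new := A ++ B) (by simp; exact List.IsRotated.refl _) ?_ (by simp)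
          (List.IsRotated.refl _) ?_ hPt hPt' ?_ ?_ hcm hc hN
        · simp; grind
        · intro c hc; exact hPc c (by simp at hc; grind) (by simp at hc; grind)
        · intro t b h1 h2; exact hP' t b h1 ⟨_, by simp, h2⟩
        · intro hA; exact hPc _ (by grind) (by grind)
      rcases List.mem_cons.1 hw with rfl | hw
      · have hcm := hN.mem.1
        refine seg (R := []) (y := ι t) (N := A) (P' := P') hι (new := A ++ B) (by simp; exact List.IsRotated.refl _) ?_ (by simp)
          (rot_app _ _) ?_ hPt' (by rw [hι]; exact hPt) ?_ ?_ hcm hc hN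
        · simp; grind
        · intro c hc; exact hPc c (by simp at hc; grind) (by simp at hc; grind)
        · intro t b h1 h2; exact hP' t b h1 ⟨_, by simp, h2⟩
        · intro hA; exact hPc _ (by grind) (by grind)
      · have hm := hN.mem
        have e1 : ι c ∈ ws.flatten := List.mem_flatten.2 ⟨w, hw, hm.1⟩
        have e2 : b ∈ ws.flatten := List.mem_flatten.2 ⟨w, hw, hm.2⟩
        rw [hPc b (by grind) (by grind)]
        exact hP' c b ((hPc c (by grind) (by grind)).1 hc) ⟨w, by simp [hw], hN⟩
    simp only [List.flatten_cons, List.mem_append] at hu hu'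
    have hne : ∀ c, (c ∈ A ∨ c ∈ B) ∨ c ∈ ws.flatten → c ≠ t ∧ c ≠ ι t := by
      clear hcl hPt hPt' hPc hPu hP' h3; grind
    have := h3 P hcl u u' (by simp only [List.flatten_cons, List.mem_append, List.mem_cons]; tauto) (by simp only [List.flatten_cons, List.mem_append, List.mem_cons]; tauto) ((hPc u (hne u hu).1 (hne u hu).2).2 hPu)
    exact (hPc u' (hne u' hu').1 (hne u' hu').2).1 this

theorem rep_merge {Γ : Type} [Group Γ] {ι : T → T} (hι : ∀ t, ι (ι t) = t) {ν : T → ℕ} {t : T} {A B : List T} {ws : List (List T)}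
    (hg : Good ι ((t :: A) :: (ι t :: B) :: ws)) (ht : ι t ≠ t)
    (h : GRep Γ T (SolM ι ν ((t :: A) :: (ι t :: B) :: ws))) :
    GRep Γ T (SolM ι ν ((A ++ B) :: ws)) := by
  obtain ⟨h1, h2, h3⟩ := hg
  simp only [List.flatten_cons, List.cons_append, List.nodup_cons, List.nodup_append,
    List.mem_append, List.mem_cons, not_or] at h1
  have htA : t ∉ A := by grind
  have htB : t ∉ B := by grind
  have htA' : ι t ∉ A := by grind
  have htB' : ι t ∉ B := by grind
  have htw : ∀ w ∈ ws, t ∉ w ∧ ι t ∉ w := by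
    intro w hw
    have e1 : ∀ c ∈ w, c ∈ ws.flatten := fun c hc => List.mem_flatten.2 ⟨w, hw, hc⟩
    grind
  refine h.transfer (fun H _ v => upd ι t 1 v) (fun H _ v => upd ι t ((A.map v).prod)⁻¹ v) ?_ ?_ ?_ ?_ ?_ ?_
  · intro H K _ _ F v s
    rw [← upd_nat]; simp
  · intro H K _ _ F v s
    rw [← upd_nat]; simp only [map_inv, map_list_prod, List.map_map]; rfl
  · rintro H _ v ⟨hv1, hv2, hv3⟩
    refine ⟨hv1.upd hι ht _, ?_, ?_⟩
    · intro w hw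
      rcases List.mem_cons.1 hw with rfl | hw
      · have e1 := hv2 (t :: A) (by simp)
        have e2 := hv2 (ι t :: B) (by simp)
        simp only [List.map_cons, List.prod_cons] at e1 e2
        rw [hv1.1 t ht] at e2
        rw [upd_map _ _ _ _ _ (by simp [htA, htB]) (by simp [htA', htB'])]
        rw [List.map_append, List.prod_append]
        rw [eq_inv_of_mul_eq_one_right e1, eq_inv_of_mul_eq_one_right e2]; simp
      · rw [upd_map _ _ _ _ _ (htw w hw).1 (htw w hw).2]
        exact hv2 w (by simp [hw])
    · intro s hs
      by_cases e1 : s = t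
      · rw [e1, upd_self]
      by_cases e2 : s = ι t
      · rw [e2, upd_inv _ _ _ _ ht, inv_one]
      rw [upd_of_ne _ _ _ _ _ e1 e2]
      apply hv3; simp at hs ⊢; tauto
  · rintro H _ v ⟨hv1, hv2, hv3⟩
    have e1 := hv2 (A ++ B) (by simp)
    rw [List.map_append, List.prod_append] at e1
    refine ⟨hv1.upd hι ht _, ?_, ?_⟩
    · intro w hw
      rcases List.mem_cons.1 hw with rfl | hw
      · rw [List.map_cons, upd_map _ _ _ _ _ htA htA', List.prod_cons, upd_self]; simp
      rcases List.mem_cons.1 hw with rfl | hw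
      · rw [List.map_cons, upd_map _ _ _ _ _ htB htB', List.prod_cons, upd_inv _ _ _ _ ht]; simpa using e1
      · rw [upd_map _ _ _ _ _ (htw w hw).1 (htw w hw).2]
        exact hv2 w (by simp [hw])
    · intro s hs
      simp at hs
      rw [upd_of_ne _ _ _ _ _ hs.1 hs.2.2.1]
      apply hv3; simp; tauto
  · rintro H _ v ⟨hv1, hv2, hv3⟩
    have e1 := hv2 (t :: A) (by simp)
    simp only [List.map_cons, List.prod_cons] at e1
    beta_reduce
    rw [upd_upd, upd_map _ _ _ _ _ htA htA', ← eq_inv_of_mul_eq_one_left e1, hv1.upd_eq ht]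
  · rintro H _ v ⟨hv1, hv2, hv3⟩
    have e1 : v t = 1 := hv3 t (by simp; grind)
    beta_reduce
    rw [upd_upd, ← e1, hv1.upd_eq ht]

theorem good_inv {ι : T → T} {ws ws' : List (List T)} (hp : ws.flatten.Perm ws'.flatten)
    (h1 : ∀ w ∈ ws, ∃ w' ∈ ws', w ~r w') (h2 : ∀ w ∈ ws', ∃ w' ∈ ws, w ~r w') (hg : Good ι ws) :
    Good ι ws' := by
  obtain ⟨a, b, c⟩ := hg
  refine ⟨hp.nodup_iff.1 a, ?_, ?_⟩
  · intro t ht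
    exact hp.mem_iff.1 (b t (hp.mem_iff.2 ht))
  · intro P hP t t' ht ht' hPt
    refine c P ?_ t t' (hp.mem_iff.2 ht) (hp.mem_iff.2 ht') hPt
    rintro t b hPt ⟨w, hw, hN⟩
    obtain ⟨w', hw', hr⟩ := h1 w hw
    exact hP t b hPt ⟨w', hw', hN.rot hr⟩

theorem solm_inv {ι : T → T} {ν : T → ℕ} {ws ws' : List (List T)} (hp : ws.flatten.Perm ws'.flatten)
    (h2 : ∀ w ∈ ws', ∃ w' ∈ ws, w ~r w') {H : Type} [Group H] {v : T → H} (h : SolM ι ν ws H v) :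
    SolM ι ν ws' H v := by
  obtain ⟨a, b, c⟩ := h
  refine ⟨a, ?_, fun t ht => c t (fun h => ht (hp.mem_iff.1 h))⟩
  intro w hw
  obtain ⟨w', hw', hr⟩ := h2 w hw
  exact prod_rot hr.symm v (b w' hw')

theorem merge_ind {Γ : Type} [Group Γ] {ι : T → T} (hι : ∀ t, ι (ι t) = t) {ν : T → ℕ} (n : ℕ) :
    ∀ ws : List (List T), ws.length = n + 1 → Good ι ws → (∀ w ∈ ws, ∃ t ∈ w, ι t = t) →
    GRep Γ T (SolM ι ν ws) → ∃ w, Good ι [w] ∧ GRep Γ T (SolM ι ν [w]) := by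
  induction n with
  | zero =>
    intro ws hl hg hf hr
    obtain ⟨w, rfl⟩ := List.length_eq_one_iff.1 hl
    exact ⟨w, hg, hr⟩
  | succ n ih =>
    intro ws hl hg hf hr
    obtain ⟨w1, ws, rfl⟩ := List.exists_of_length_succ ws hl
    obtain ⟨w2, ws, rfl⟩ := List.exists_of_length_succ ws (Nat.succ_injective hl)
    have hex : ∃ t ∈ w1, ι t ∉ w1 := by
      by_contra hcon
      push Not at hcon
      obtain ⟨c1, hc1, -⟩ := hf w1 (by simp)
      obtain ⟨c2, hc2, -⟩ := hf w2 (by simp)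
      have hd : ∀ w ∈ w2 :: ws, ∀ c ∈ w1, c ∉ w := by
        intro w hw c hc hc'
        have := hg.1
        rw [List.flatten_cons, List.nodup_append] at this
        exact this.2.2 c hc c (List.mem_flatten.2 ⟨w, hw, hc'⟩) rfl
      have := hg.2.2 (fun c => c ∈ w1) ?_ c1 c2 (by simp [hc1]) (by simp [hc2]) hc1
      · exact hd w2 (by simp) c2 this hc2
      · rintro t b ht ⟨w, hw, hN⟩
        rcases List.mem_cons.1 hw with rfl | hw
        · exact hN.mem.2
        · exact absurd hN.mem.1 (hd w hw _ (hcon t ht))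
    obtain ⟨t, ht1, ht2⟩ := hex
    have htne : ι t ≠ t := fun h => ht2 (h.symm ▸ ht1)
    have h3 : ι t ∈ (w2 :: ws).flatten := by
      have := hg.2.1 t (by simp [ht1])
      rw [List.flatten_cons, List.mem_append] at this
      exact this.resolve_left ht2
    obtain ⟨w, hw, htw⟩ := List.mem_flatten.1 h3
    obtain ⟨us, us', hus⟩ := List.append_of_mem hw
    obtain ⟨a1, a2, rfl⟩ := List.append_of_mem ht1
    obtain ⟨b1, b2, rfl⟩ := List.append_of_mem htw
    rw [hus] at hg hf hr hl
    have hp : ((a1 ++ t :: a2) :: (us ++ (b1 ++ ι t :: b2) :: us')).flatten.Perm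
        ((t :: (a2 ++ a1)) :: (ι t :: (b2 ++ b1)) :: (us ++ us')).flatten := by
      rw [List.perm_iff_count]
      intro c
      simp [List.count_append, List.count_cons]; ring
    have hr1 : ∀ w ∈ ((a1 ++ t :: a2) :: (us ++ (b1 ++ ι t :: b2) :: us')), ∃ w' ∈ ((t :: (a2 ++ a1)) :: (ι t :: (b2 ++ b1)) :: (us ++ us')), w ~r w' := by
      intro w hw
      simp only [List.mem_cons, List.mem_append] at hw
      rcases hw with rfl | hw | rfl | hw
      · exact ⟨_, by simp, rot_app _ _⟩
      · exact ⟨w, by simp [hw], List.IsRotated.refl _⟩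
      · exact ⟨ι t :: (b2 ++ b1), by simp, rot_app _ _⟩
      · exact ⟨w, by simp [hw], List.IsRotated.refl _⟩
    have hr2 : ∀ w ∈ ((t :: (a2 ++ a1)) :: (ι t :: (b2 ++ b1)) :: (us ++ us')), ∃ w' ∈ ((a1 ++ t :: a2) :: (us ++ (b1 ++ ι t :: b2) :: us')), w ~r w' := by
      intro w hw
      simp only [List.mem_cons, List.mem_append] at hw
      rcases hw with rfl | rfl | hw | hw
      · exact ⟨a1 ++ t :: a2, by simp, rot_app (t :: a2) a1⟩
      · exact ⟨b1 ++ ι t :: b2, by simp, rot_app (ι t :: b2) b1⟩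
      · exact ⟨w, by simp [hw], List.IsRotated.refl _⟩
      · exact ⟨w, by simp [hw], List.IsRotated.refl _⟩
    have hg' := good_inv hp hr1 hr2 hg
    have hR' := hr.iff (R' := SolM ι ν ((t :: (a2 ++ a1)) :: (ι t :: (b2 ++ b1)) :: (us ++ us')))
      (fun H _ v => ⟨solm_inv hp hr2, solm_inv hp.symm hr1⟩)
    refine ih _ ?_ (conn_merge hι hg' htne) ?_ (rep_merge hι hg' htne hR')
    · simp at hl ⊢; omega
    · intro w hw
      simp only [List.mem_cons, List.mem_append] at hw
      rcases hw with rfl | hw | hw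
      · obtain ⟨c, hc, hc'⟩ := hf (a1 ++ t :: a2) (by simp)
        refine ⟨c, ?_, hc'⟩
        have : c ≠ t := by rintro rfl; exact htne hc'
        simp at hc ⊢; tauto
      · exact hf w (by simp [hw])
      · exact hf w (by simp [hw])

end words

section handles
variable {T : Type} [DecidableEq T]

def hsl (ι : T → T) (hs : List (T × T)) : List T := hs.flatMap (fun p => [p.1, ι p.1, p.2, ι p.2])

def SolH (ι : T → T) (ν : T → ℕ) (hs : List (T × T)) (rest : List T) (H : Type) [Group H]
    (v : T → H) : Prop :=
  Pw ι ν H v ∧ (hs.map (fun p => ⁅v p.1, v p.2⁆)).prod * (rest.map v).prod = 1 ∧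
    ∀ t, t ∉ hsl ι hs ++ rest → v t = 1

def GoodH (ι : T → T) (hs : List (T × T)) (rest : List T) : Prop :=
  (hsl ι hs ++ rest).Nodup ∧ (∀ t ∈ rest, ι t ∈ rest) ∧ Conn ι [rest]

set_option maxHeartbeats 1600000 in
theorem conn_handle {ι : T → T} (hι : ∀ t, ι (ι t) = t) {x y : T} {A B C D old new : List T}
    (ho : old ~r x :: (A ++ y :: (B ++ ι x :: (C ++ ι y :: D))))
    (hn : new ~r C ++ B ++ A ++ D) (hnd : old.Nodup) (hc : Conn ι [old]) : Conn ι [new] := by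
  have hnd' := ho.nodup_iff.1 hnd
  have hL : [x, ι x, y, ι y].Nodup ∧ ∀ c, c ∈ A ∨ c ∈ B ∨ c ∈ C ∨ c ∈ D →
      c ≠ x ∧ c ≠ ι x ∧ c ≠ y ∧ c ≠ ι y := by
    clear hc hn ho hι
    simp only [List.nodup_cons, List.nodup_append, List.mem_append, List.mem_cons, not_or] at hnd' ⊢
    grind
  obtain ⟨hL, hne⟩ := hL
  have hmm : ∀ t, t ∈ old ↔ t = x ∨ t ∈ A ∨ t = y ∨ t ∈ B ∨ t = ι x ∨ t ∈ C ∨ t = ι y ∨ t ∈ D := by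
    intro t; rw [ho.mem_iff]; simp only [List.mem_append, List.mem_cons]
  have hmm' : ∀ t, t ∈ new → t ∈ A ∨ t ∈ B ∨ t ∈ C ∨ t ∈ D := by
    intro t; rw [hn.mem_iff]; simp only [List.mem_append]; tauto
  intro P' hP' u u' hu hu' hPu
  classical
  let P : T → Prop := fun u => if u = x then hP P' (C ++ B ++ A ++ D) else
    if u = ι x then hP P' (A ++ D ++ C ++ B) else
    if u = y then hP P' (D ++ C ++ B ++ A) else
    if u = ι y then hP P' (B ++ A ++ D ++ C) else P' u
  simp only [List.nodup_cons, List.mem_cons, not_or, List.not_mem_nil, not_false_eq_true, and_true, List.nodup_nil] at hL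
  obtain ⟨⟨l1, l2, l3⟩, ⟨l4, l5⟩, l6⟩ := hL
  have hPx : P x ↔ hP P' (C ++ B ++ A ++ D) := by simp [P]
  have hPx' : P (ι x) ↔ hP P' (A ++ D ++ C ++ B) := by simp [P, Ne.symm l1]
  have hPy : P y ↔ hP P' (D ++ C ++ B ++ A) := by simp [P, Ne.symm l2, Ne.symm l4]
  have hPy' : P (ι y) ↔ hP P' (B ++ A ++ D ++ C) := by simp [P, Ne.symm l3, Ne.symm l5, Ne.symm l6]
  have hPc : ∀ c, c ∈ A ∨ c ∈ B ∨ c ∈ C ∨ c ∈ D → (P c ↔ P' c) := by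
    intro c h; obtain ⟨h1, h2, h3, h4⟩ := hne c h; simp [P, h1, h2, h3, h4]
  have hPi : ∀ c, ι c ∈ A ∨ ι c ∈ B ∨ ι c ∈ C ∨ ι c ∈ D → (P c ↔ P' c) := by
    intro c h; obtain ⟨h1, h2, h3, h4⟩ := hne _ h
    have h1' : c ≠ ι x := by rintro rfl; exact h1 (hι x)
    have h2' : c ≠ x := by rintro rfl; exact h2 rfl
    have h3' : c ≠ ι y := by rintro rfl; exact h3 (hι y)
    have h4' : c ≠ y := by rintro rfl; exact h4 rfl
    simp [P, h1', h2', h3', h4']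
  have hPn : ∀ t b, P' t → Nx new (ι t) b → P' b := fun t b h h' => hP' t b h ⟨_, by simp, h'⟩
  simp only [List.flatten_cons, List.flatten_nil, List.append_nil] at hu hu'
  have hold : ∀ s, s ∈ A ∨ s ∈ B ∨ s ∈ C ∨ s ∈ D → s ∈ [old].flatten := by
    intro s hs; simp only [List.flatten_cons, List.flatten_nil, List.append_nil, hmm]
    rcases hs with h | h | h | h <;> simp [h]
  refine (hPc u' (hmm' u' hu')).1 (hc P ?_ u u' (hold _ (hmm' u hu)) (hold _ (hmm' u' hu'))
    ((hPc u (hmm' u hu)).2 hPu))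
  rintro c b hcc ⟨w, hw, hN⟩
  rw [List.mem_singleton] at hw; subst hw
  have r1 : w ~r y :: (B ++ ι x :: (C ++ ι y :: (D ++ x :: A))) := by
    refine ho.trans ?_
    have := rot_app (x :: A) (y :: (B ++ ι x :: (C ++ ι y :: D)))
    simpa using this
  have r2 : w ~r ι x :: (C ++ ι y :: (D ++ x :: (A ++ y :: B))) := by
    refine r1.trans ?_
    have := rot_app (y :: B) (ι x :: (C ++ ι y :: (D ++ x :: A)))
    simpa using this
  have r3 : w ~r ι y :: (D ++ x :: (A ++ y :: (B ++ ι x :: C))) := by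
    refine r2.trans ?_
    have := rot_app (ι x :: C) (ι y :: (D ++ x :: (A ++ y :: B)))
    simpa using this
  have n3 : new ~r C ++ (B ++ A ++ D) := by simpa using hn
  have n2 : new ~r B ++ (A ++ D ++ C) := by
    refine n3.trans ?_
    simpa using rot_app C (B ++ A ++ D)
  have n1 : new ~r A ++ (D ++ C ++ B) := by
    refine n2.trans ?_
    simpa using rot_app B (A ++ D ++ C)
  have n4 : new ~r D ++ (C ++ B ++ A) := by
    refine n1.trans ?_
    simpa using rot_app A (D ++ C ++ B)
  rcases (show ι c ∈ x :: A ∨ ι c ∈ y :: B ∨ ι c ∈ ι x :: C ∨ ι c ∈ ι y :: D by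
    have := (hmm _).1 hN.mem.1
    rcases this with h | h | h | h | h | h | h | h <;> simp [h]) with h | h | h | h
  · refine seg (y := y) (N := D ++ C ++ B) hι ho hnd' (by simp) n1 ?_ (by simpa using hPy)
      (by simpa using hPx') hPn ?_ h hcc hN
    · intro s hs; apply hPc; simp only [List.mem_append] at hs
      rcases hs with h | (h | h) | h <;> simp [h]
    · intro h; apply hPi; simp [h]
  · refine seg (y := ι x) (N := A ++ D ++ C) hι r1 (r1.nodup_iff.1 hnd) (by simp) n2 ?_ (by simpa using hPx')
      (by simpa using hPy') hPn ?_ h hcc hN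
    · intro s hs; apply hPc; simp only [List.mem_append] at hs
      rcases hs with h | (h | h) | h <;> simp [h]
    · intro h; apply hPi; simp [h]
  · refine seg (y := ι y) (N := B ++ A ++ D) hι r2 (r2.nodup_iff.1 hnd) (by simp) n3 ?_ (by simpa using hPy')
      (by simpa [hι] using hPx) hPn ?_ h hcc hN
    · intro s hs; apply hPc; simp only [List.mem_append] at hs
      rcases hs with h | (h | h) | h <;> simp [h]
    · intro h; apply hPi; simp [h]
  · refine seg (y := x) (N := C ++ B ++ A) hι r3 (r3.nodup_iff.1 hnd) (by simp) n4 ?_ (by simpa using hPx)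
      (by simpa [hι] using hPy) hPn ?_ h hcc hN
    · intro s hs; apply hPc; simp only [List.mem_append] at hs
      rcases hs with h | (h | h) | h <;> simp [h]
    · intro h; apply hPi; simp [h]

theorem find_handle {ι : T → T} (hι : ∀ t, ι (ι t) = t) {rest : List T} (hnd : rest.Nodup)
    (hcl : ∀ t ∈ rest, ι t ∈ rest) (hc : Conn ι [rest]) (hex : ∃ t ∈ rest, ι t ≠ t) :
    ∃ (x y : T) (P A B C D : List T),
      rest = P ++ x :: (A ++ y :: (B ++ ι x :: (C ++ ι y :: D))) := by
  obtain ⟨Pf, x, tl, rfl, hPf, hx⟩ : ∃ P x tl, rest = P ++ x :: tl ∧ (∀ c ∈ P, ι c = c) ∧ ι x ≠ x := by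
    clear hnd hcl hc
    induction rest with
    | nil => simp at hex
    | cons a l ih =>
      by_cases ha : ι a = a
      · obtain ⟨t, ht, ht'⟩ := hex
        rcases List.mem_cons.1 ht with rfl | ht
        · exact absurd ha ht'
        obtain ⟨P, x, tl, h1, h2, h3⟩ := ih ⟨t, ht, ht'⟩
        exact ⟨a :: P, x, tl, by rw [h1]; rfl, by simpa [ha] using h2, h3⟩
      · exact ⟨[], a, l, rfl, by simp, ha⟩
  have hnP : ∀ c, ι c ≠ c → ι c ∉ Pf := fun c hc h => hc (by have := hPf _ h; rw [hι] at this; exact this.symm)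
  have h1 : ι x ∈ tl := by
    have := hcl x (by simp)
    simp only [List.mem_append, List.mem_cons] at this
    exact (this.resolve_left (hnP x hx)).resolve_left hx
  obtain ⟨M, D0, rfl⟩ := List.append_of_mem h1
  have hexy : ∃ y ∈ M, ι y ∉ M := by
    by_contra hcon
    push Not at hcon
    have := hc (fun c => c ∈ M ∨ c = ι x) ?_ (ι x) x (by simp) (by simp) (Or.inr rfl)
    · rcases this with h | h
      · simp only [List.nodup_cons, List.nodup_append, List.mem_append, List.mem_cons, not_or] at hnd
        tauto
      · exact hx h.symm
    · rintro t b ht ⟨w, hw, hN⟩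
      rw [List.mem_singleton] at hw; subst hw
      rcases ht with ht | rfl
      · obtain ⟨m1, m2, hm⟩ := List.append_of_mem (hcon t ht)
        have e1 : Pf ++ x :: (M ++ ι x :: D0) = (Pf ++ x :: m1) ++ ι t :: (m2 ++ ι x :: D0) := by rw [hm]; simp
        rw [e1] at hN hnd
        have := Nx.head hnd hN
        cases m2 with
        | nil => simp at this; exact Or.inr this.symm
        | cons a m => simp at this; left; rw [hm, ← this]; simp
      · rw [hι] at hN
        have := Nx.head hnd hN
        cases M with
        | nil => simp at this; exact Or.inr this.symm
        | cons a m => simp at this; left; rw [← this]; simp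
  obtain ⟨y, hy1, hy2⟩ := hexy
  have hyy : ι y ≠ y := fun h => hy2 (h.symm ▸ hy1)
  have hyD : ι y ∈ D0 := by
    have h := hcl y (by simp [hy1])
    simp only [List.nodup_cons, List.nodup_append, List.mem_append, List.mem_cons, not_or] at hnd h
    rcases h with h | h | h | h | h
    · exact absurd h (hnP y hyy)
    · rw [← h, hι] at hnd; tauto
    · exact absurd h hy2
    · exfalso; have : y = x := by rw [← hι y, h, hι]
      subst this; tauto
    · exact h
  obtain ⟨A, B, rfl⟩ := List.append_of_mem hy1
  obtain ⟨C, D, rfl⟩ := List.append_of_mem hyD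
  exact ⟨x, y, Pf, A, B, C, D, by simp⟩

def upd2 {H : Type} [Group H] (ι : T → T) (x y : T) (a b : H) (v : T → H) : T → H :=
  upd ι x a (upd ι y b v)

set_option maxHeartbeats 1600000 in
theorem rep_handle {Γ : Type} [Group Γ] {ι : T → T} (hι : ∀ t, ι (ι t) = t) {ν : T → ℕ} {x y : T}
    {P A B C D : List T} {hs : List (T × T)}
    (hg : GoodH ι hs (P ++ x :: (A ++ y :: (B ++ ι x :: (C ++ ι y :: D)))))
    (h : GRep Γ T (SolH ι ν hs (P ++ x :: (A ++ y :: (B ++ ι x :: (C ++ ι y :: D)))))) :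
    GoodH ι (hs ++ [(x, y)]) (P ++ C ++ B ++ A ++ D) ∧
    GRep Γ T (SolH ι ν (hs ++ [(x, y)]) (P ++ C ++ B ++ A ++ D)) := by
  obtain ⟨g1, g2, g3⟩ := hg
  have hp : (hsl ι hs ++ (P ++ x :: (A ++ y :: (B ++ ι x :: (C ++ ι y :: D))))).Perm
      (hsl ι (hs ++ [(x, y)]) ++ (P ++ C ++ B ++ A ++ D)) := by
    rw [List.perm_iff_count]; intro c
    simp [hsl, List.count_append, List.count_cons]; ring
  have hL : ((x ≠ ι x ∧ x ≠ y ∧ x ≠ ι y) ∧ (ι x ≠ y ∧ ι x ≠ ι y) ∧ y ≠ ι y) ∧ ∀ c, c ∈ hsl ι hs ∨ c ∈ P ∨ c ∈ A ∨ c ∈ B ∨ c ∈ C ∨ c ∈ D →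
      x ≠ c ∧ ι x ≠ c ∧ y ≠ c ∧ ι y ≠ c := by
    clear g2 g3 h hp hι
    simp only [List.nodup_cons, List.nodup_append, List.mem_append, List.mem_cons, not_or] at g1
    grind
  obtain ⟨⟨⟨l1, l2, l3⟩, ⟨l4, l5⟩, l6⟩, hne⟩ := hL
  constructor
  · refine ⟨hp.nodup_iff.1 g1, ?_, ?_⟩
    · intro t ht
      have h1 := g2 t (by simp only [List.mem_append, List.mem_cons] at ht ⊢; tauto)
      simp only [List.mem_append, List.mem_cons] at ht h1
      obtain ⟨h2, h3, h4, h5⟩ := hne t (by tauto)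
      have h2' : ι t ≠ ι x := fun h => h2 (by rw [← hι x, ← h, hι])
      have h3' : ι t ≠ x := fun h => h3 (by rw [← h, hι])
      have h4' : ι t ≠ ι y := fun h => h4 (by rw [← hι y, ← h, hι])
      have h5' : ι t ≠ y := fun h => h5 (by rw [← h, hι])
      simp only [List.mem_append]; tauto
    · refine conn_handle (A := A) (B := B) (C := C) (D := D ++ P) hι (x := x) (y := y) ?_ ?_ ?_ g3
      · have := rot_app P (x :: (A ++ y :: (B ++ ι x :: (C ++ ι y :: D))))
        simpa using this
      · have := rot_app P (C ++ B ++ A ++ D)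
        simpa using this
      · exact g1.of_append_right
  have hm : ∀ (l : List T), (∀ c ∈ l, c ∈ P ∨ c ∈ A ∨ c ∈ B ∨ c ∈ C ∨ c ∈ D) → ∀ (H : Type) [Group H] (a b : H) (v : T → H),
      l.map (upd2 ι x y a b v) = l.map v := by
    intro l hl H _ a b v
    unfold upd2
    rw [upd_map, upd_map]
    all_goals intro hh; have := hne _ (Or.inr (hl _ hh)); tauto
  have hmP := hm P (by tauto)
  have hmA := hm A (by tauto)
  have hmB := hm B (by tauto)
  have hmC := hm C (by tauto)
  have hmD := hm D (by tauto)
  have hmh : ∀ (H : Type) [Group H] (a b : H) (v : T → H),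
      hs.map (fun p => ⁅upd2 ι x y a b v p.1, upd2 ι x y a b v p.2⁆) = hs.map (fun p => ⁅v p.1, v p.2⁆) := by
    intro H _ a b v
    apply List.map_congr_left
    intro p hp
    have h1 := hne p.1 (Or.inl (List.mem_flatMap.2 ⟨p, hp, by simp⟩))
    have h2 := hne p.2 (Or.inl (List.mem_flatMap.2 ⟨p, hp, by simp⟩))
    unfold upd2
    rw [upd_of_ne, upd_of_ne, upd_of_ne, upd_of_ne] <;> tauto
  have hux : ∀ (H : Type) [Group H] (a b : H) (v : T → H), upd2 ι x y a b v x = a := by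
    intro H _ a b v; simp [upd2, upd]
  have hux' : ∀ (H : Type) [Group H] (a b : H) (v : T → H), upd2 ι x y a b v (ι x) = a⁻¹ := by
    intro H _ a b v; simp [upd2, upd, Ne.symm l1]
  have huy : ∀ (H : Type) [Group H] (a b : H) (v : T → H), upd2 ι x y a b v y = b := by
    intro H _ a b v; simp [upd2, upd, Ne.symm l2, Ne.symm l4]
  have huy' : ∀ (H : Type) [Group H] (a b : H) (v : T → H), upd2 ι x y a b v (ι y) = b⁻¹ := by
    intro H _ a b v; simp [upd2, upd, Ne.symm l3, Ne.symm l5, Ne.symm l6]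
  have huu : ∀ (H : Type) [Group H] (a b c d : H) (v : T → H), Pw ι ν H v → a = v x → b = v y →
      upd2 ι x y a b (upd2 ι x y c d v) = v := by
    intro H _ a b c d v hv ha hb
    have e1 := hv.1 x (Ne.symm l1)
    have e2 := hv.1 y (Ne.symm l6)
    funext t
    unfold upd2 upd
    split_ifs with h1 h2 h3 h4
    · rw [h1, ha]
    · rw [h2, ha, e1]
    · rw [h3, hb]
    · rw [h4, hb, e2]
    · rfl
  have hPw : ∀ (H : Type) [Group H] (a b : H) (v : T → H), Pw ι ν H v → Pw ι ν H (upd2 ι x y a b v) :=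
    fun H _ a b v hv => (hv.upd hι (Ne.symm l6) b).upd hι (Ne.symm l1) a
  have hoff : ∀ (H : Type) [Group H] (a b : H) (v : T → H) (t : T), t ∉ hsl ι hs ++ (P ++ x :: (A ++ y :: (B ++ ι x :: (C ++ ι y :: D)))) → upd2 ι x y a b v t = v t := by
    intro H _ a b v t ht
    simp only [List.mem_append, List.mem_cons, not_or] at ht
    unfold upd2; rw [upd_of_ne, upd_of_ne] <;> tauto
  let p : ∀ (H : Type) [Group H], List T → (T → H) → H := fun H _ l v => (l.map v).prod
  have hpn : ∀ (H K : Type) [Group H] [Group K] (F : H →* K) (v : T → H) (l : List T), p K l (fun t => F (v t)) = F (p H l v) := by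
    intro H K _ _ F v l; simp only [p, map_list_prod, List.map_map]; rfl
  refine h.transfer
    (fun H _ v => upd2 ι x y (p H P v * v x * (p H B v)⁻¹ * (p H C v)⁻¹ * (p H P v)⁻¹)
      (p H P v * p H C v * p H B v * p H A v * v y * (p H C v)⁻¹ * (p H P v)⁻¹) v)
    (fun H _ v => upd2 ι x y ((p H P v)⁻¹ * v x * p H P v * p H C v * p H B v)
      ((p H A v)⁻¹ * (p H B v)⁻¹ * (p H C v)⁻¹ * (p H P v)⁻¹ * v y * p H P v * p H C v) v) ?_ ?_ ?_ ?_ ?_ ?_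
  · intro H K _ _ F v t
    simp only [upd2, hpn, ← map_mul, ← map_inv]
    rw [← upd_nat]; congr 1; funext s; rw [← upd_nat]
  · intro H K _ _ F v t
    simp only [upd2, hpn, ← map_mul, ← map_inv]
    rw [← upd_nat]; congr 1; funext s; rw [← upd_nat]
  · rintro H _ v ⟨h1, h2, h3⟩
    refine ⟨hPw _ _ _ _ h1, ?_, ?_⟩
    · simp only [List.map_append, List.prod_append, List.map_cons, List.map_nil, List.prod_cons, List.prod_nil, hmP, hmA, hmB, hmC, hmD, hmh, hux, huy] at h2 ⊢
      rw [h1.1 x (Ne.symm l1), h1.1 y (Ne.symm l6)] at h2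
      refine Eq.trans ?_ h2
      simp only [p, commutatorElement_def]; group
    · intro t ht
      rw [← hp.mem_iff] at ht
      rw [hoff _ _ _ _ _ ht]; exact h3 t ht
  · rintro H _ v ⟨h1, h2, h3⟩
    refine ⟨hPw _ _ _ _ h1, ?_, ?_⟩
    · simp only [List.map_append, List.prod_append, List.map_cons, List.map_nil, List.prod_cons, List.prod_nil, hmP, hmA, hmB, hmC, hmD, hmh, hux, huy, hux', huy'] at h2 ⊢
      refine Eq.trans ?_ h2
      simp only [p, commutatorElement_def]; group
    · intro t ht
      rw [hoff _ _ _ _ _ ht]; exact h3 t (by rwa [← hp.mem_iff])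
  · rintro H _ v ⟨h1, h2, h3⟩
    apply huu _ _ _ _ _ _ h1
    · simp only [p, hmP, hmA, hmB, hmC, hmD, hux, huy]; group
    · simp only [p, hmP, hmA, hmB, hmC, hmD, hux, huy]; group
  · rintro H _ v ⟨h1, h2, h3⟩
    apply huu _ _ _ _ _ _ h1
    · simp only [p, hmP, hmA, hmB, hmC, hmD, hux, huy]; group
    · simp only [p, hmP, hmA, hmB, hmC, hmD, hux, huy]; group

theorem handle_ind {Γ : Type} [Group Γ] {ι : T → T} (hι : ∀ t, ι (ι t) = t) {ν : T → ℕ} (n : ℕ) :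
    ∀ (hs : List (T × T)) (rest : List T), rest.length ≤ n → GoodH ι hs rest →
    GRep Γ T (SolH ι ν hs rest) → ∃ hs rest, GoodH ι hs rest ∧ (∀ t ∈ rest, ι t = t) ∧
      GRep Γ T (SolH ι ν hs rest) := by
  induction n with
  | zero =>
    intro hs rest hl hg hr
    have : rest = [] := by simpa using hl
    subst this
    exact ⟨hs, [], hg, by simp, hr⟩
  | succ n ih =>
    intro hs rest hl hg hr
    by_cases hex : ∃ t ∈ rest, ι t ≠ t
    · obtain ⟨x, y, P, A, B, C, D, rfl⟩ := find_handle hι hg.1.of_append_right hg.2.1 hg.2.2 hex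
      obtain ⟨h1, h2⟩ := rep_handle hι hg hr
      refine ih _ _ ?_ h1 h2
      simp at hl ⊢; omega
    · push Not at hex
      exact ⟨hs, rest, hg, hex, hr⟩

end handles

section final
variable {T : Type} [DecidableEq T]

def sgn {H : Type} [Group H] {g r : ℕ} (k : FuchsianGen g r) (a : H) : H :=
  match k with
  | Sum.inl _ => a
  | Sum.inr _ => a⁻¹

theorem sgn_sgn {H : Type} [Group H] {g r : ℕ} (k : FuchsianGen g r) (a : H) :
    sgn k (sgn k a) = a := by
  rcases k with k | k <;> simp [sgn]

theorem sgn_nat {H K : Type} [Group H] [Group K] (F : H →* K) {g r : ℕ} (k : FuchsianGen g r) (a : H) :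
    sgn k (F a) = F (sgn k a) := by
  rcases k with k | k <;> simp [sgn]

theorem prod_ofFn_get {α H : Type} [Group H] (l : List α) (f : α → H) :
    (List.ofFn fun i : Fin l.length => f (l.get i)).prod = (l.map f).prod := by
  rw [show (fun i : Fin l.length => f (l.get i)) = f ∘ l.get from rfl, ← List.map_ofFn, List.ofFn_get]

open Classical in
theorem alg_final {Γ : Type} [Group Γ] {ι : T → T} (hι : ∀ t, ι (ι t) = t) {ν : T → ℕ}
    (hν : ∀ t, ι t = t → 0 < ν t) {hs : List (T × T)} {rest : List T} (hg : GoodH ι hs rest)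
    (hfix : ∀ t ∈ rest, ι t = t) (h : GRep Γ T (SolH ι ν hs rest)) :
    ∃ (g r : ℕ) (ν : Fin r → ℕ), (∀ j, 2 ≤ ν j) ∧ Nonempty (Γ ≃* FuchsianGroup g r ν) := by
  set rr : List T := (rest.filter (fun t => ν t ≠ 1)).reverse with hrr
  have hrm : ∀ t, t ∈ rr ↔ t ∈ rest ∧ ν t ≠ 1 := by intro t; simp [hrr]
  have hrn : rr.Nodup := by
    rw [hrr, List.nodup_reverse]; exact hg.1.of_append_right.filter _
  obtain ⟨hn, -, -⟩ := hg
  rw [List.nodup_append, hsl, List.nodup_flatMap] at hn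
  obtain ⟨⟨n1, n2⟩, -, n3⟩ := hn
  have F1 : ∀ i : Fin hs.length, (hs.get i).1 ≠ ι (hs.get i).1 ∧ (hs.get i).1 ≠ (hs.get i).2 ∧
      (hs.get i).1 ≠ ι (hs.get i).2 ∧ (hs.get i).2 ≠ ι (hs.get i).2 := by
    intro i
    have := n1 _ (List.get_mem hs i)
    simp only [List.nodup_cons, List.mem_cons, not_or] at this
    tauto
  have F2 : ∀ i k : Fin hs.length, i ≠ k → ∀ c,
      c ∈ [(hs.get i).1, ι (hs.get i).1, (hs.get i).2, ι (hs.get i).2] →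
      c ∉ [(hs.get k).1, ι (hs.get k).1, (hs.get k).2, ι (hs.get k).2] := by
    intro i k hik c h1 h2
    rw [List.pairwise_iff_get] at n2
    rcases lt_or_gt_of_ne hik with h | h
    · exact n2 i k h h1 h2
    · exact n2 k i h h2 h1
  have F3 : ∀ i : Fin hs.length, ∀ c ∈ [(hs.get i).1, ι (hs.get i).1, (hs.get i).2, ι (hs.get i).2],
      c ∉ rest := by
    intro i c h1 h2
    exact n3 c (List.mem_flatMap.2 ⟨_, List.get_mem hs i, h1⟩) c h2 rfl
  let j : FuchsianGen hs.length rr.length → T := fun k => match k with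
    | Sum.inl (Sum.inl i) => (hs.get i).1
    | Sum.inl (Sum.inr i) => (hs.get i).2
    | Sum.inr i => rr.get i
  have j1 : ∀ i, j (Sum.inl (Sum.inl i)) = (hs.get i).1 := fun _ => rfl
  have j2 : ∀ i, j (Sum.inl (Sum.inr i)) = (hs.get i).2 := fun _ => rfl
  have j3 : ∀ i, j (Sum.inr i) = rr.get i := fun _ => rfl
  have j3' : ∀ i, j (Sum.inr i) ∈ rest := fun i => ((hrm _).1 (List.get_mem rr i)).1
  have jl : ∀ k, ∃ i : Fin hs.length, (j (Sum.inl k) = (hs.get i).1 ∨ j (Sum.inl k) = (hs.get i).2) := by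
    rintro (i | i)
    · exact ⟨i, Or.inl rfl⟩
    · exact ⟨i, Or.inr rfl⟩
  have hinj : Function.Injective j := by
    rintro ((a | a) | a) ((b | b) | b) hab
    · by_cases hh : a = b
      · rw [hh]
      · exact absurd (List.mem_cons.2 (Or.inl hab)) (F2 a b hh (hs.get a).1 (by simp))
    · exfalso
      by_cases hh : a = b
      · subst hh; exact (F1 a).2.1 hab
      · exact absurd (List.mem_cons_of_mem _ (List.mem_cons_of_mem _ (List.mem_cons.2 (Or.inl hab)))) (F2 a b hh (hs.get a).1 (by simp))
    · exact absurd (by rw [← j1, hab]; exact j3' _) (F3 a (hs.get a).1 (by simp))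
    · exfalso
      by_cases hh : a = b
      · subst hh; exact (F1 a).2.1 hab.symm
      · exact absurd (List.mem_cons.2 (Or.inl hab)) (F2 a b hh (hs.get a).2 (by simp))
    · by_cases hh : a = b
      · rw [hh]
      · exact absurd (List.mem_cons_of_mem _ (List.mem_cons_of_mem _ (List.mem_cons.2 (Or.inl hab)))) (F2 a b hh (hs.get a).2 (by simp))
    · exact absurd (by rw [← j2, hab]; exact j3' _) (F3 a (hs.get a).2 (by simp))
    · exact absurd (by rw [← j1, ← hab]; exact j3' _) (F3 b (hs.get b).1 (by simp))
    · exact absurd (by rw [← j2, ← hab]; exact j3' _) (F3 b (hs.get b).2 (by simp))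
    · rw [hrn.injective_get hab]
  have hnr : ∀ k k', ι (j (Sum.inl k)) ≠ j k' := by
    intro k k' he
    obtain ⟨a, ha⟩ := jl k
    have hm : j k' ∈ [(hs.get a).1, ι (hs.get a).1, (hs.get a).2, ι (hs.get a).2] := by
      rw [← he]; rcases ha with h | h <;> rw [h] <;> simp
    rcases k' with k' | k'
    · obtain ⟨b, hb⟩ := jl k'
      have hm' : j (Sum.inl k') ∈ [(hs.get b).1, ι (hs.get b).1, (hs.get b).2, ι (hs.get b).2] := by
        rcases hb with h | h <;> rw [h] <;> simp
      by_cases hh : a = b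
      · subst hh
        obtain ⟨f1, f2, f3, f4⟩ := F1 a
        rcases ha with h | h <;> rcases hb with h' | h' <;> rw [h, h'] at he
        · exact f1 he.symm
        · exact f3 (by rw [← he, hι])
        · exact f3 he.symm
        · exact f4 he.symm
      · exact F2 a b hh _ hm hm'
    · exact F3 a _ hm (j3' _)
  have hfr : ∀ k, ι (j (Sum.inr k)) = j (Sum.inr k) := fun k => hfix _ (j3' k)
  have hcov : ∀ t, t ∈ hsl ι hs ++ rest → t ∈ Set.range j ∨ ι t ∈ Set.range j ∨ (t ∈ rest ∧ ν t = 1) := by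
    intro t ht
    rcases List.mem_append.1 ht with ht | ht
    · obtain ⟨p, hp, ht⟩ := List.mem_flatMap.1 ht
      obtain ⟨i, rfl⟩ := List.get_of_mem hp
      simp only [List.mem_cons, List.not_mem_nil, or_false] at ht
      rcases ht with h | h | h | h
      · exact Or.inl ⟨Sum.inl (Sum.inl i), h.symm⟩
      · exact Or.inr (Or.inl ⟨Sum.inl (Sum.inl i), by rw [h, hι]⟩)
      · exact Or.inl ⟨Sum.inl (Sum.inr i), h.symm⟩
      · exact Or.inr (Or.inl ⟨Sum.inl (Sum.inr i), by rw [h, hι]⟩)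
    · by_cases h1 : ν t = 1
      · exact Or.inr (Or.inr ⟨ht, h1⟩)
      · obtain ⟨i, hi⟩ := List.get_of_mem ((hrm t).2 ⟨ht, h1⟩)
        exact Or.inl ⟨Sum.inr i, hi⟩
  have hcov' : ∀ t, t ∈ Set.range j ∨ ι t ∈ Set.range j → t ∈ hsl ι hs ++ rest := by
    have aux : ∀ k, j k ∈ hsl ι hs ++ rest ∧ ι (j k) ∈ hsl ι hs ++ rest := by
      rintro (k | k)
      · obtain ⟨a, ha⟩ := jl k
        simp only [hsl, List.mem_append, List.mem_flatMap]
        constructor <;> refine Or.inl ⟨_, List.get_mem hs a, ?_⟩ <;>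
          rcases ha with h | h <;> rw [h] <;> simp
      · rw [hfr]; exact ⟨List.mem_append_right _ (j3' k), List.mem_append_right _ (j3' k)⟩
    rintro t (⟨k, rfl⟩ | ⟨k, hk⟩)
    · exact (aux k).1
    · rw [← hι t, ← hk]; exact (aux k).2
  let e : ∀ (H : Type) [Group H], (T → H) → (FuchsianGen hs.length rr.length → H) :=
    fun H _ v k => sgn k (v (j k))
  let d : ∀ (H : Type) [Group H], (FuchsianGen hs.length rr.length → H) → (T → H) :=
    fun H _ u t => if t ∈ Set.range j then Function.extend j (fun k => sgn k (u k)) 1 t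
      else (Function.extend j (fun k => sgn k (u k)) 1 (ι t))⁻¹
  have dj : ∀ (H : Type) [Group H] u k, d H u (j k) = sgn k (u k) := by
    intro H _ u k; simp only [d, Set.mem_range_self, if_true]; rw [hinj.extend_apply]
  have dj' : ∀ (H : Type) [Group H] u t k, t ∉ Set.range j → ι t = j k → d H u t = (sgn k (u k))⁻¹ := by
    intro H _ u t k h1 h2; simp only [d, h1, if_false]; rw [h2, hinj.extend_apply]
  have dj'' : ∀ (H : Type) [Group H] u t, t ∉ Set.range j → ι t ∉ Set.range j → d H u t = 1 := by
    intro H _ u t h1 h2; simp only [d, h1, if_false]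
    rw [Function.extend_apply' _ _ _ (by simpa using h2)]; simp
  have hed : ∀ (H : Type) [Group H] u, e H (d H u) = u := by
    intro H _ u; funext k; simp only [e]; rw [dj, sgn_sgn]
  have hrest : ∀ (H : Type) [Group H] (v : T → H), Pw ι ν H v → (rest.map v).prod =
      ((List.ofFn fun k : Fin rr.length => e H v (Sum.inr k)).prod)⁻¹ := by
    intro H _ v hv
    have := prod_ofFn_get rr (fun t => (v t)⁻¹)
    simp only [e, sgn]
    change _ = (List.ofFn fun k : Fin rr.length => (v (rr.get k))⁻¹).prod⁻¹
    rw [this, List.prod_inv_reverse, List.map_map, hrr, List.map_reverse, List.reverse_reverse]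
    have : ((fun x => x⁻¹) ∘ fun t => (v t)⁻¹) = v := by funext t; simp
    rw [this]
    have aux : ∀ l : List T, (∀ t ∈ l, ι t = t) → (l.map v).prod = ((l.filter (fun t => ν t ≠ 1)).map v).prod := by
      intro l
      induction l with
      | nil => simp
      | cons a l ih =>
        intro hl
        have ih := ih (fun t ht => hl t (by simp [ht]))
        by_cases ha : ν a = 1
        · have : v a = 1 := by have := hv.2 a (hl a (by simp)); rwa [ha, pow_one] at this
          simpa [List.filter_cons, ha, this] using ih
        · simpa [List.filter_cons, ha] using ih
    exact aux rest hfix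
  have hhs : ∀ (H : Type) [Group H] (v : T → H), (hs.map (fun p => ⁅v p.1, v p.2⁆)).prod =
      (List.ofFn fun i : Fin hs.length => ⁅e H v (Sum.inl (Sum.inl i)), e H v (Sum.inl (Sum.inr i))⁆).prod := by
    intro H _ v
    rw [← prod_ofFn_get]; rfl
  refine ⟨hs.length, rr.length, fun k => ν (rr.get k), ?_, ?_⟩
  · intro k
    have h1 := (hrm _).1 (List.get_mem rr k)
    have h2 := hν _ (hfix _ h1.1)
    change 2 ≤ ν (rr.get k)
    omega
  have hR : ∀ (H : Type) [Group H] (u : FuchsianGen hs.length rr.length → H),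
      (∀ r ∈ fuchsianRels hs.length rr.length (fun k => ν (rr.get k)), FreeGroup.lift u r = 1) ↔
      ((List.ofFn fun i : Fin hs.length => ⁅u (Sum.inl (Sum.inl i)), u (Sum.inl (Sum.inr i))⁆).prod *
       ((List.ofFn fun k : Fin rr.length => u (Sum.inr k)).prod)⁻¹ = 1 ∧
       ∀ k, u (Sum.inr k) ^ ν (rr.get k) = 1) := by
    intro H _ u
    have hc : ⇑(FreeGroup.lift u) ∘ (fun i : Fin hs.length => ⁅(FreeGroup.of (Sum.inl (Sum.inl i)) : FreeGroup (FuchsianGen hs.length rr.length)), FreeGroup.of (Sum.inl (Sum.inr i))⁆) = fun i => ⁅u (Sum.inl (Sum.inl i)), u (Sum.inl (Sum.inr i))⁆ := by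
      funext i; simp [map_commutatorElement]
    have hc' : ⇑(FreeGroup.lift u) ∘ (fun k : Fin rr.length => (FreeGroup.of (Sum.inr k) : FreeGroup (FuchsianGen hs.length rr.length))) = fun k => u (Sum.inr k) := by
      funext i; simp
    simp only [fuchsianRels, Set.forall_mem_insert, Set.forall_mem_range, map_mul, map_inv, map_list_prod, List.map_ofFn, hc, hc', map_pow, FreeGroup.lift_apply_of]
  refine GRep.equiv (h.transfer (R' := fun H _ u => ∀ r ∈ fuchsianRels hs.length rr.length (fun k => ν (rr.get k)), FreeGroup.lift u r = 1) e d ?_ ?_ ?_ ?_ ?_ ?_) (rep_presented _)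
  · intro H K _ _ F v t; simp only [e, sgn_nat]
  · intro H K _ _ F u t
    by_cases h1 : t ∈ Set.range j
    · obtain ⟨k, rfl⟩ := h1; rw [dj, dj, sgn_nat]
    by_cases h2 : ι t ∈ Set.range j
    · obtain ⟨k, hk⟩ := h2
      rw [dj' _ _ _ _ h1 hk.symm, dj' _ _ _ _ h1 hk.symm, sgn_nat, map_inv]
    · rw [dj'' _ _ _ h1 h2, dj'' _ _ _ h1 h2, map_one]
  · rintro H _ v ⟨h1, h2, h3⟩
    rw [hR]
    refine ⟨?_, ?_⟩
    · rw [← hhs, ← hrest _ _ h1]; exact h2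
    · intro k
      have := h1.2 _ (hfr k)
      simp only [e, sgn, inv_pow, inv_eq_one]; exact this
  · intro H _ u hu
    rw [hR] at hu
    have hpw : Pw ι ν H (d H u) := by
      constructor
      · intro t ht
        by_cases h1 : t ∈ Set.range j
        · obtain ⟨k | k, rfl⟩ := h1
          · rw [dj, dj' _ _ _ (Sum.inl k)]
            · rintro ⟨k', hk'⟩; exact hnr k k' hk'.symm
            · rw [hι]
          · exact absurd (hfr k) ht
        by_cases h2 : ι t ∈ Set.range j
        · obtain ⟨k, hk⟩ := h2
          rw [dj' _ _ _ _ h1 hk.symm, ← hk, dj, inv_inv]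
        · rw [dj'' _ _ _ h1 h2, dj'' _ _ _ h2 (by rwa [hι]), inv_one]
      · intro t ht
        by_cases h1 : t ∈ Set.range j
        · obtain ⟨k | k, rfl⟩ := h1
          · exact absurd ht (hnr k _)
          · have e1 := dj H u (Sum.inr k)
            rw [e1]; simp only [sgn, inv_pow, inv_eq_one]; exact hu.2 k
        · rw [dj'' _ _ _ h1 (by rwa [ht]), one_pow]
    refine ⟨hpw, ?_, ?_⟩
    · rw [hhs, hrest _ _ hpw, hed]; exact hu.1
    · intro t ht
      apply dj''
      · exact fun h => ht (hcov' t (Or.inl h))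
      · exact fun h => ht (hcov' t (Or.inr h))
  · rintro H _ v ⟨h1, h2, h3⟩
    funext t
    by_cases m1 : t ∈ Set.range j
    · obtain ⟨k, rfl⟩ := m1
      rw [dj]; simp only [e]; rw [sgn_sgn]
    by_cases m2 : ι t ∈ Set.range j
    · obtain ⟨k, hk⟩ := m2
      rw [dj' _ _ _ _ m1 hk.symm]; simp only [e]; rw [sgn_sgn, hk, h1.1, inv_inv]
      intro h; exact m1 ⟨k, hk.trans h⟩
    · rw [dj'' _ _ _ m1 m2]
      by_cases m3 : t ∈ hsl ι hs ++ rest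
      · rcases hcov t m3 with h | h | ⟨h, h'⟩
        · exact absurd h m1
        · exact absurd h m2
        · have := h1.2 t (hfix t h); rw [h', pow_one] at this; exact this.symm
      · exact (h3 t m3).symm
  · intro H _ u _; exact hed H u

theorem alg_main {Γ : Type} [Group Γ] {ι : T → T} (hι : ∀ t, ι (ι t) = t) {ν : T → ℕ}
    (hν : ∀ t, ι t = t → 0 < ν t) {ws : List (List T)} (hg : Good ι ws)
    (hf : ∀ w ∈ ws, ∃ t ∈ w, ι t = t) (h : GRep Γ T (SolM ι ν ws)) :
    ∃ (g r : ℕ) (ν : Fin r → ℕ), (∀ j, 2 ≤ ν j) ∧ Nonempty (Γ ≃* FuchsianGroup g r ν) := by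
  have h1 : ∃ w, Good ι [w] ∧ GRep Γ T (SolM ι ν [w]) := by
    rcases ws with _ | ⟨w, ws⟩
    · refine ⟨[], ⟨by simp, by simp, fun P _ t t' ht => by simp at ht⟩, h.iff ?_⟩
      intro H _ v; simp [SolM]
    · exact merge_ind hι ws.length (w :: ws) rfl hg hf h
  obtain ⟨w, hw, hr⟩ := h1
  have hr' : GRep Γ T (SolH ι ν [] w) := by
    refine hr.iff ?_
    intro H _ v; simp [SolM, SolH, hsl]
  obtain ⟨hs, rest, a, b, c⟩ := handle_ind hι w.length [] w le_rfl
    ⟨by simpa [hsl] using hw.1, by simpa using hw.2.1, hw.2.2⟩ hr'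
  exact alg_final hι hν a b c
end final

section bridge

def pv {S H : Type} [Group H] (φ : S → S) (f : S → H) (s : S) (k : ℕ) : H :=
  ((List.range k).map (fun i => f (φ^[i] s))).prod

theorem pv_succ {S H : Type} [Group H] (φ : S → S) (f : S → H) (s : S) (k : ℕ) :
    pv φ f s (k + 1) = pv φ f s k * f (φ^[k] s) := by
  simp [pv, List.range_succ]

theorem pv_add {S H : Type} [Group H] (φ : S → S) (f : S → H) (s : S) (j k : ℕ) :
    pv φ f s (j + k) = pv φ f s j * pv φ f (φ^[j] s) k := by
  induction k with
  | zero => simp [pv]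
  | succ k ih =>
    rw [← add_assoc, pv_succ, pv_succ, ih, mul_assoc, ← Function.iterate_add_apply, add_comm k j]

theorem pv_conj {S H : Type} [Group H] (φ : S → S) (f : S → H) (r : S) (j k : ℕ)
    (hk : φ^[k] r = r) : pv φ f r j * pv φ f (φ^[j] r) k = pv φ f r k * pv φ f r j := by
  have h1 := pv_add φ f r k j
  rw [hk] at h1
  rw [← h1, ← pv_add, add_comm]

theorem pv_mul {S H : Type} [Group H] (φ : S → S) (f : S → H) (r : S) (n m : ℕ)
    (hk : φ^[n] r = r) : pv φ f r (n * m) = pv φ f r n ^ m := by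
  induction m with
  | zero => simp [pv]
  | succ m ih =>
    rw [mul_add, mul_one, pv_add, ih, pow_succ, Function.iterate_mul,
      Function.iterate_fixed hk]

theorem Nx_get {T : Type} {w : List T} {i : ℕ} {a b : T} (h1 : w[i]? = some a)
    (h2 : w[(i + 1) % w.length]? = some b) : Nx w a b := by
  obtain ⟨hi, h1⟩ := List.getElem?_eq_some_iff.1 h1
  refine ⟨w.drop (i + 1) ++ w.take i, ⟨i, ?_⟩, ?_⟩
  · rw [List.rotate_eq_drop_append_take hi.le, List.drop_eq_getElem_cons hi, h1]; rfl
  · by_cases h : i + 1 < w.length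
    · rw [Nat.mod_eq_of_lt h] at h2
      rw [List.drop_eq_getElem_cons h]
      rw [List.getElem?_eq_getElem h] at h2
      exact h2
    · have h3 : i + 1 = w.length := by omega
      rw [h3, Nat.mod_self] at h2
      rw [h3, List.drop_length, List.nil_append, ← h1, List.take_append_getElem hi, h3, List.take_length]
      rw [List.head?_eq_getElem?]; exact h2

open Classical in
theorem bridge {Γ S : Type} [Group Γ] [Finite S] (inc : S → Γ) (inv : S → S)
    (hinv : ∀ s, inv (inv s) = s) (hinc : ∀ s, inc (inv s) = (inc s)⁻¹) (φ : Equiv.Perm S)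
    (conn : ∀ P : S → Prop, (∀ t, P t → P (φ (inv t))) → (∃ t, P t) → ∀ t, P t)
    (hfin : ∀ s, ∃ k > 0, φ^[k] s = s ∧ pv φ inc s k = 1)
    (hext : ∀ (H : Type) [Group H] (v : S → H), (∀ s, v (inv s) = (v s)⁻¹) →
      (∀ s k, φ^[k] s = s → pv φ inc s k = 1 → pv φ v s k = 1) → ∃ F : Γ →* H, ∀ s, F (inc s) = v s)
    (hgen : ∀ (H : Type) [Group H] (F F' : Γ →* H), (∀ s, F (inc s) = F' (inc s)) → F = F') :
    ∃ (g r : ℕ) (ν : Fin r → ℕ), (∀ j, 2 ≤ ν j) ∧ Nonempty (Γ ≃* FuchsianGroup g r ν) := by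
  haveI := Fintype.ofFinite S
  let n : S → ℕ := fun s => Function.minimalPeriod φ s
  have hnp : ∀ s, φ^[n s] s = s := fun s => Function.iterate_minimalPeriod
  have hn0 : ∀ s, 0 < n s := by
    intro s
    obtain ⟨k, hk, hk2, -⟩ := hfin s
    exact Function.IsPeriodicPt.minimalPeriod_pos hk hk2
  let W : S → List S := fun s => (List.range (n s)).map (fun i => φ^[i] s)
  have hWn : ∀ s, (W s).Nodup := by
    intro s
    have := Function.nodup_periodicOrbit (f := φ) (x := s)
    rwa [Function.periodicOrbit_def, Cycle.nodup_coe_iff] at this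
  let rep : S → S := fun s => (Quotient.mk (Equiv.Perm.SameCycle.setoid φ) s).out
  have hrep1 : ∀ s, φ.SameCycle (rep s) s := fun s => Quotient.mk_out (s := Equiv.Perm.SameCycle.setoid φ) s
  have hrep2 : ∀ s s', φ.SameCycle s s' → rep s = rep s' := by
    intro s s' h
    have : Quotient.mk (Equiv.Perm.SameCycle.setoid φ) s = Quotient.mk (Equiv.Perm.SameCycle.setoid φ) s' := Quotient.sound h
    simp only [rep, this]
  have hrep3 : ∀ s, rep (rep s) = rep s := fun s => hrep2 _ _ (hrep1 s)
  have hsc : ∀ r s, φ.SameCycle r s → ∃ i < n r, φ^[i] r = s := by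
    intro r s h
    obtain ⟨i, hi⟩ := h.exists_nat_pow_eq
    refine ⟨i % n r, Nat.mod_lt _ (hn0 r), ?_⟩
    rw [Function.iterate_mod_minimalPeriod_eq, ← hi, Equiv.Perm.coe_pow]
  have hsc' : ∀ r i, φ.SameCycle r (φ^[i] r) := by
    intro r i; rw [← Equiv.Perm.coe_pow]; exact ⟨i, by simp⟩
  let word : S → List (S ⊕ S) := fun s => (W s).map Sum.inl ++ [Sum.inr s]
  have hwl : ∀ s, (word s).length = n s + 1 := by intro s; simp [word, W]
  have hw1 : ∀ s i, i < n s → (word s)[i]? = some (Sum.inl (φ^[i] s)) := by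
    intro s i hi
    simp only [word]
    rw [List.getElem?_append_left (by simpa [W] using hi)]; simp [W, hi]
  have hw2 : ∀ s, (word s)[n s]? = some (Sum.inr s) := by
    intro s
    simp only [word]
    rw [List.getElem?_append_right (by simp [W])]; simp [W]
  let reps : List S := (Finset.univ.filter (fun s => rep s = s)).toList
  have hreps : ∀ s, s ∈ reps ↔ rep s = s := by intro s; simp [reps]
  let ws := reps.map word
  have hwin : ∀ r s, Sum.inl s ∈ word r → φ.SameCycle r s := by
    intro r s h
    simp only [word, W, List.mem_append, List.mem_map, List.mem_range, List.mem_singleton] at h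
    rcases h with ⟨a, ⟨i, hi, rfl⟩, h⟩ | h
    · rw [← Sum.inl_injective h]; exact hsc' r i
    · simp at h
  have hwin2 : ∀ r s, Sum.inr s ∈ word r ↔ s = r := by
    intro r s; simp [word]
  have hfl1 : ∀ s, Sum.inl s ∈ ws.flatten := by
    intro s
    refine List.mem_flatten.2 ⟨word (rep s), List.mem_map.2 ⟨rep s, (hreps _).2 (hrep3 s), rfl⟩, ?_⟩
    obtain ⟨i, hi, hi2⟩ := hsc _ _ (hrep1 s)
    have := hw1 (rep s) i hi
    rw [hi2] at this
    exact List.mem_of_getElem? this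
  have hfl2 : ∀ s, Sum.inr s ∈ ws.flatten ↔ rep s = s := by
    intro s
    rw [List.mem_flatten]
    constructor
    · rintro ⟨w, hw, hs⟩
      obtain ⟨r, hr, rfl⟩ := List.mem_map.1 hw
      rw [hwin2] at hs; rw [hs]; exact (hreps r).1 hr
    · intro h
      exact ⟨word s, List.mem_map.2 ⟨s, (hreps _).2 h, rfl⟩, (hwin2 s s).2 rfl⟩
  let ι : S ⊕ S → S ⊕ S := Sum.map inv id
  let ν : S ⊕ S → ℕ := Sum.elim (fun _ => 2) (fun s => orderOf (pv φ inc s (n s)))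
  have hord : ∀ s, 0 < orderOf (pv φ inc s (n s)) := by
    intro s
    obtain ⟨k, hk, hk2, hk3⟩ := hfin s
    obtain ⟨m, rfl⟩ : n s ∣ k := Function.IsPeriodicPt.minimalPeriod_dvd hk2
    rw [pv_mul _ _ _ _ _ (hnp s)] at hk3
    exact orderOf_pos_iff.2 (isOfFinOrder_iff_pow_eq_one.2 ⟨m, Nat.pos_of_mul_pos_left hk, hk3⟩)
  have hι : ∀ t, ι (ι t) = t := by rintro (s | s) <;> simp [ι, hinv]
  have hwprod : ∀ (H : Type) [Group H] (v : S ⊕ S → H) (s : S), ((word s).map v).prod = pv φ (fun s => v (Sum.inl s)) s (n s) * v (Sum.inr s) := by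
    intro H _ v s
    simp only [word, W, List.map_append, List.map_map, List.prod_append, pv]
    simp [Function.comp_def]
  refine alg_main (T := S ⊕ S) (ι := ι) hι (ν := ν) ?_ (ws := ws) ?_ ?_ ?_
  · rintro (s | s) _
    · simp [ν]
    · exact hord s
  · refine ⟨?_, ?_, ?_⟩
    · rw [List.nodup_flatten]
      constructor
      · intro w hw
        obtain ⟨r, -, rfl⟩ := List.mem_map.1 hw
        rw [List.nodup_append]
        refine ⟨(hWn r).map Sum.inl_injective, by simp, ?_⟩
        intro a ha b hb
        simp at ha hb
        obtain ⟨c, -, rfl⟩ := ha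
        rw [hb]; simp
      · rw [List.pairwise_map]
        refine (Finset.nodup_toList _ : reps.Nodup).pairwise_of_forall_ne ?_
        intro a ha b hb hab
        rw [hreps] at ha hb
        rintro (t | t) h1 h2
        · have := hrep2 _ _ ((hwin a t h1).trans (hwin b t h2).symm)
          rw [ha, hb] at this; exact hab this
        · rw [hwin2] at h1 h2; exact hab (h1.symm.trans h2)
    · rintro (s | s) hs
      · exact hfl1 _
      · exact hs
    · intro P hP t t' ht ht' hPt
      have key : ∀ r, rep r = r → ∀ i < n r, P (ι (Sum.inl (φ^[i] r))) → P (Sum.inl (φ^[i + 1] r)) := by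
        intro r hr i hi hPi
        have hmem : word r ∈ ws := List.mem_map.2 ⟨r, (hreps _).2 hr, rfl⟩
        by_cases h : i + 1 < n r
        · refine hP _ _ hPi ⟨word r, hmem, ?_⟩
          rw [hι]
          apply Nx_get (hw1 r i hi)
          rw [hwl, Nat.mod_eq_of_lt (by omega)]
          exact hw1 r _ h
        · have h' : i + 1 = n r := by omega
          have h1 : P (Sum.inr r) := by
            refine hP _ _ hPi ⟨word r, hmem, ?_⟩
            rw [hι]
            apply Nx_get (hw1 r i hi)
            rw [hwl, Nat.mod_eq_of_lt (by omega), h']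
            exact hw2 r
          refine hP _ _ h1 ⟨word r, hmem, ?_⟩
          rw [h', hnp]
          apply Nx_get (hw2 r)
          rw [hwl, Nat.mod_self]
          exact hw1 r 0 (hn0 r)
      have key2 : ∀ r, rep r = r → P (Sum.inr r) → P (Sum.inl r) := by
        intro r hr h1
        refine hP _ _ h1 ⟨word r, List.mem_map.2 ⟨r, (hreps _).2 hr, rfl⟩, ?_⟩
        apply Nx_get (hw2 r)
        rw [hwl, Nat.mod_self]
        exact hw1 r 0 (hn0 r)
      have key3 : ∀ r, rep r = r → P (ι (Sum.inl (φ^[n r - 1] r))) → P (Sum.inr r) := by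
        intro r hr h1
        have := hn0 r
        refine hP _ _ h1 ⟨word r, List.mem_map.2 ⟨r, (hreps _).2 hr, rfl⟩, ?_⟩
        rw [hι]
        apply Nx_get (hw1 r _ (by omega))
        rw [hwl, Nat.mod_eq_of_lt (by omega), Nat.sub_add_cancel this]
        exact hw2 r
      have hS : ∀ s, P (Sum.inl s) := by
        apply conn (fun s => P (Sum.inl s))
        · intro s hs
          obtain ⟨i, hi, hi2⟩ := hsc _ _ (hrep1 (inv s))
          have := key (rep (inv s)) (hrep3 _) i hi (by rw [hi2]; simpa [ι, hinv] using hs)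
          rwa [Function.iterate_succ_apply', hi2] at this
        · rcases t with s | s
          · exact ⟨s, hPt⟩
          · exact ⟨s, key2 s ((hfl2 s).1 ht) hPt⟩
      rcases t' with s | s
      · exact hS s
      · exact key3 s ((hfl2 s).1 ht') (hS _)
  · intro w hw
    obtain ⟨r, -, rfl⟩ := List.mem_map.1 hw
    exact ⟨Sum.inr r, by simp [word], rfl⟩
  · refine ⟨Sum.elim inc (fun s => if rep s = s then (pv φ inc s (n s))⁻¹ else 1), ⟨⟨?_, ?_⟩, ?_, ?_⟩, ?_, ?_⟩
    · rintro (s | s) hs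
      · simpa [ι] using hinc s
      · exact absurd rfl hs
    · rintro (s | s) hs
      · have h1 : inv s = s := by simpa [ι] using hs
        have h2 := hinc s
        rw [h1] at h2
        simp only [Sum.elim_inl, ν, pow_two]
        nth_rw 1 [h2]; simp
      · simp only [Sum.elim_inr, ν]
        split_ifs
        · rw [inv_pow, pow_orderOf_eq_one, inv_one]
        · simp
    · intro w hw
      obtain ⟨r, hr, rfl⟩ := List.mem_map.1 hw
      rw [hwprod]
      simp [(hreps r).1 hr]
    · rintro (s | s) hs
      · exact absurd (hfl1 s) hs
      · rw [hfl2] at hs; simp [hs]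
    · rintro H _ v ⟨hv1, hv2, hv3⟩
      have hrel : ∀ r, rep r = r → v (Sum.inr r) = (pv φ (fun s => v (Sum.inl s)) r (n r))⁻¹ := by
        intro r hr
        have := hv2 (word r) (List.mem_map.2 ⟨r, (hreps _).2 hr, rfl⟩)
        rw [hwprod] at this
        exact eq_inv_of_mul_eq_one_right this
      obtain ⟨F, hF⟩ : ∃ F : Γ →* H, ∀ s, F (inc s) = v (Sum.inl s) := by
        refine hext H (fun s => v (Sum.inl s)) ?_ ?_
        · intro s
          by_cases h : inv s = s
          · have h1 := hv1.2 (Sum.inl s) (by simp [ι, h])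
            simp only [ν, Sum.elim_inl, pow_two] at h1
            rw [h]; exact eq_inv_of_mul_eq_one_left h1
          · exact hv1.1 (Sum.inl s) (by simpa [ι] using h)
        · intro s k hk hk1
          obtain ⟨i, hi, hi2⟩ := hsc _ _ (hrep1 s)
          set r := rep s with hr
          have hkr : φ^[k] r = r := by
            apply (φ.injective.iterate i)
            rw [← Function.iterate_add_apply, add_comm, Function.iterate_add_apply, hi2, hk]
          have a1 := pv_conj φ inc r i k hkr
          have a2 := pv_conj φ (fun s => v (Sum.inl s)) r i k hkr
          rw [hi2] at a1 a2
          rw [hk1, mul_one] at a1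
          obtain ⟨m, rfl⟩ : n r ∣ k := Function.IsPeriodicPt.minimalPeriod_dvd hkr
          rw [pv_mul _ _ _ _ _ (hnp r)] at a1 a2
          have a3 := orderOf_dvd_of_pow_eq_one (right_eq_mul.1 a1)
          obtain ⟨q, hq⟩ := a3
          have a4 := hv1.2 (Sum.inr r) rfl
          rw [hrel r (hrep3 s), inv_pow, inv_eq_one] at a4
          have a5 : pv φ (fun s => v (Sum.inl s)) r (n r) ^ m = 1 := by
            rw [hq, pow_mul]; simp only [ν, Sum.elim_inr] at a4; rw [a4, one_pow]
          rw [a5, one_mul] at a2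
          exact mul_eq_left.1 a2
      refine ⟨F, ?_⟩
      rintro (s | s)
      · exact hF s
      · simp only [Sum.elim_inr]
        split_ifs with h
        · rw [hrel s h, map_inv]
          simp only [pv, map_list_prod, List.map_map, Function.comp_def, hF]
        · rw [map_one, hv3]; rwa [hfl2]
    · intro H _ F F' h
      exact hgen H F F' (fun s => h (Sum.inl s))
end bridge

open Topology

theorem glue {X : Type} [TopologicalSpace X] [SimplyConnectedSpace X] [LocallyPathConnectedSpace X]
    {A H : Type} [Group H] (N : X → Set A) (hne : ∀ z, (N z).Nonempty)
    (usc : ∀ z, ∀ᶠ w in 𝓝 z, N w ⊆ N z) (f : X → A → H)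
    (hf : ∀ z w, N w ⊆ N z → ∃ h, ∀ γ ∈ N w, f z γ = h * f w γ)
    (hconn : ∀ γ, IsPreconnected {y | γ ∈ N y}) :
    ∃ F : A → H, ∀ z, ∃ h, ∀ γ ∈ N z, F γ = h * f z γ := by
  classical
  let _ : TopologicalSpace H := ⊥
  have : DiscreteTopology H := ⟨rfl⟩
  choose n hn using hne
  have key : ∀ i j w, N w ⊆ N i → N w ⊆ N j → ∀ γ ∈ N w, ∀ γ' ∈ N w,
      f i γ * (f j γ)⁻¹ = f i γ' * (f j γ')⁻¹ := by
    intro i j w hi hj γ hγ γ' hγ'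
    obtain ⟨a, ha⟩ := hf i w hi
    obtain ⟨b, hb⟩ := hf j w hj
    rw [ha γ hγ, hb γ hγ, ha γ' hγ', hb γ' hγ']; group
  let Z : FiberBundleCore X X H :=
    { baseSet := fun z => {w | N w ⊆ N z}
      isOpen_baseSet := fun z => isOpen_iff_mem_nhds.2 fun w hw =>
        (usc w).mono fun y hy => hy.trans hw
      indexAt := id
      mem_baseSet_at := fun x => show N x ⊆ N x from subset_rfl
      coordChange := fun i j w h => h * (f i (n w) * (f j (n w))⁻¹)
      coordChange_self := by intros; simp
      continuousOn_coordChange := by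
        intro i j
        rintro ⟨w, h⟩ ⟨⟨hi, hj⟩, -⟩
        have h1 : ∀ᶠ p : X × H in 𝓝 (w, h),
            p.2 * (f i (n p.1) * (f j (n p.1))⁻¹) = h * (f i (n w) * (f j (n w))⁻¹) := by
          have e1 : ∀ᶠ p : X × H in 𝓝 (w, h), N p.1 ⊆ N w := (continuous_fst.tendsto (w, h)).eventually (usc w)
          have e2 : ∀ᶠ p : X × H in 𝓝 (w, h), p.2 = h :=
            (continuous_snd.tendsto (w, h)).eventually (by simp : ∀ᶠ x in 𝓝 h, x = h)
          filter_upwards [e1, e2] with p hp hp2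
          rw [hp2, key i j w hi hj _ (hp (hn p.1)) _ (hn w)]
        refine ContinuousAt.continuousWithinAt ?_
        exact (continuousAt_const (y := h * (f i (n w) * (f j (n w))⁻¹))).congr
          (h1.mono fun p hp => hp.symm)
      coordChange_comp := by intros; group }
  have cov : IsCoveringMap (Bundle.TotalSpace.proj : Z.TotalSpace → X) :=
    FiberBundle.isCoveringMap (F := H) (E := Z.Fiber)
  obtain ⟨x0⟩ : Nonempty X := inferInstance
  obtain ⟨s, ⟨-, hs⟩, -⟩ := cov.existsUnique_continuousMap_lifts (ContinuousMap.id X) x0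
    (⟨x0, (1 : H)⟩ : Z.TotalSpace) rfl
  have hs' : ∀ w, (s w).proj = w := fun w => congrFun hs w
  let a : X → H := fun w => (s w).2
  have loc : ∀ z, ∀ᶠ w in 𝓝 z, ∀ γ ∈ N w, a w * f w γ = a z * f z γ := by
    intro z
    have hc : ContinuousAt (fun w => (Z.localTriv z (s w)).2) z := by
      have h1 : ContinuousAt (Z.localTriv z) (s z) := by
        apply (Z.localTriv z).continuousAt
        rw [FiberBundleCore.mem_localTriv_source]
        change (s z).proj ∈ {w | N w ⊆ N z}
        rw [hs']; exact Set.Subset.refl _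
      exact continuousAt_snd.comp (h1.comp (f := s) s.continuous.continuousAt)
    have hev : ∀ᶠ w in 𝓝 z, (Z.localTriv z (s w)).2 = (Z.localTriv z (s z)).2 :=
      hc.eventually (by simp : ∀ᶠ x in 𝓝 _, x = _)
    have hval : ∀ w, (Z.localTriv z (s w)).2 = a w * (f w (n w) * (f z (n w))⁻¹) := by
      intro w
      change a w * (f (s w).proj (n (s w).proj) * (f z (n (s w).proj))⁻¹) = _
      rw [hs']
    filter_upwards [hev, usc z] with w hw hwz γ hγ
    rw [hval, hval, key w z w subset_rfl hwz _ (hn w) γ hγ] at hw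
    have : a w * f w γ = (a w * (f w γ * (f z γ)⁻¹)) * f z γ := by group
    rw [this, hw]; group
  have const : ∀ γ y y', γ ∈ N y → γ ∈ N y' → a y * f y γ = a y' * f y' γ := by
    intro γ y y' hy hy'
    refine (hconn γ).constant (f := fun y => a y * f y γ) ?_ hy hy'
    intro z hz
    have : ∀ᶠ w in 𝓝[{y | γ ∈ N y}] z, a w * f w γ = a z * f z γ := by
      filter_upwards [nhdsWithin_le_nhds (loc z), self_mem_nhdsWithin] with w hw hw2
      exact hw γ hw2
    exact (continuousWithinAt_const (b := a z * f z γ)).congr_of_eventuallyEq this rfl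
  refine ⟨fun γ => if h : ∃ y, γ ∈ N y then a h.choose * f h.choose γ else 1, fun z => ⟨a z, ?_⟩⟩
  intro γ hγ
  have h : ∃ y, γ ∈ N y := ⟨z, hγ⟩
  simp only [dif_pos h]
  exact const γ _ _ h.choose_spec hγ

section geo
abbrev V3 := ℝ × ℝ × ℝ

noncomputable def BB (x y : V3) : ℝ := (x.1 * y.2.2 + x.2.2 * y.1) / 2 - x.2.1 * y.2.1

def dt (a b c : V3) : ℝ :=
  a.1 * (b.2.1 * c.2.2 - b.2.2 * c.2.1) - a.2.1 * (b.1 * c.2.2 - b.2.2 * c.1) +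
    a.2.2 * (b.1 * c.2.1 - b.2.1 * c.1)

def crs (a b : V3) : V3 :=
  (2 * (a.1 * b.2.1 - a.2.1 * b.1), a.1 * b.2.2 - a.2.2 * b.1, 2 * (a.2.1 * b.2.2 - a.2.2 * b.2.1))

def CC : Set V3 := {x | 0 < x.1 ∧ 0 < BB x x}

theorem BB_comm (x y : V3) : BB x y = BB y x := by unfold BB; ring
theorem BB_add (x y z : V3) : BB (x + y) z = BB x z + BB y z := by simp [BB]; ring
theorem BB_smul (t : ℝ) (y z : V3) : BB (t • y) z = t * BB y z := by simp [BB]; ring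
theorem BB_add' (x y z : V3) : BB x (y + z) = BB x y + BB x z := by simp [BB]; ring
theorem BB_smul' (t : ℝ) (y z : V3) : BB y (t • z) = t * BB y z := by simp [BB]; ring
theorem BB_crs (a b c : V3) : BB (crs a b) c = dt a b c := by simp [BB, crs, dt]; ring
theorem dt_rot (a b c : V3) : dt b c a = dt a b c := by simp [dt]; ring
theorem dt_swap (a b c : V3) : dt a c b = - dt a b c := by simp [dt]; ring
theorem dt_swap' (a b c : V3) : dt b a c = - dt a b c := by simp [dt]; ring
theorem dt_aab (a b : V3) : dt a a b = 0 := by simp [dt]; ring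
theorem dt_aba (a b : V3) : dt a b a = 0 := by simp [dt]; ring
theorem dt_abb (a b : V3) : dt a b b = 0 := by simp [dt]; ring
theorem id4 (p a b c d : V3) : BB p a * dt b c d - BB p b * dt a c d + BB p c * dt a b d
    - BB p d * dt a b c = 0 := by simp [BB, dt]; ring

theorem BB_cont {X : Type} [TopologicalSpace X] {f g : X → V3} (hf : Continuous f)
    (hg : Continuous g) : Continuous fun x => BB (f x) (g x) := by
  unfold BB; fun_prop

theorem CC_open : IsOpen CC := by
  have h1 : IsOpen {x : V3 | 0 < x.1} := isOpen_lt continuous_const continuous_fst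
  have h2 : IsOpen {x : V3 | 0 < BB x x} :=
    isOpen_lt continuous_const (BB_cont continuous_id continuous_id)
  exact h1.inter h2

theorem BB_pos {x y : V3} (hx : x ∈ CC) (hy : y ∈ CC) : 0 < BB x y := by
  obtain ⟨x1, x2, x3⟩ := x
  obtain ⟨y1, y2, y3⟩ := y
  simp only [CC, BB, Set.mem_ofPred_eq] at *
  obtain ⟨a, b⟩ := hx
  obtain ⟨c, d⟩ := hy
  have h1 : 0 < x1 * y1 := mul_pos a c
  have h2 : 0 < x1 * y1 * ((x1 * y3 + x3 * y1) / 2 - x2 * y2) := by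
    have e1 : 0 < x1 ^ 2 * (y1 * y3 - y2 ^ 2) := mul_pos (by positivity) (by nlinarith)
    have e2 : 0 < y1 ^ 2 * (x1 * x3 - x2 ^ 2) := mul_pos (by positivity) (by nlinarith)
    nlinarith [sq_nonneg (x1 * y2 - y1 * x2)]
  exact pos_of_mul_pos_right h2 h1.le

theorem CC_add {x y : V3} (hx : x ∈ CC) (hy : y ∈ CC) : x + y ∈ CC := by
  refine ⟨add_pos hx.1 hy.1, ?_⟩
  rw [BB_add, BB_add', BB_add']
  have h1 := BB_pos hx hy
  have h2 := BB_pos hy hx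
  have h3 := hx.2
  have h4 := hy.2
  linarith

theorem CC_smul {x : V3} (hx : x ∈ CC) {t : ℝ} (ht : 0 < t) : t • x ∈ CC := by
  refine ⟨mul_pos ht hx.1, ?_⟩
  rw [BB_smul, BB_smul']
  have := hx.2
  positivity

theorem CC_convex : Convex ℝ CC := by
  rw [convex_iff_forall_pos]
  intro x hx y hy a b ha hb _
  exact CC_add (CC_smul hx ha) (CC_smul hy hb)

theorem rc (x u : V3) : x.1 ^ 2 * (BB x u ^ 2 - BB x x * BB u u) =
    (x.1 * (x.1 * u.2.2 - x.2.2 * u.1) / 2 - x.2.1 * (x.1 * u.2.1 - x.2.1 * u.1)) ^ 2 +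
      BB x x * (x.1 * u.2.1 - x.2.1 * u.1) ^ 2 := by
  simp only [BB]; ring

theorem rc_nonneg {x : V3} (hx : x ∈ CC) (u : V3) : 0 ≤ BB x u ^ 2 - BB x x * BB u u := by
  have h := rc x u
  have h1 := hx.2
  have h2 : 0 < x.1 ^ 2 := pow_pos hx.1 2
  refine nonneg_of_mul_nonneg_right ?_ h2
  rw [h]; positivity

theorem rc_eq {x : V3} (hx : x ∈ CC) (u : V3) (h0 : BB x u ^ 2 - BB x x * BB u u = 0) :
    x.1 • u = u.1 • x := by
  have h := rc x u
  rw [h0, mul_zero] at h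
  have h1 := hx.2
  have hx1 := hx.1
  have h2 : x.1 * u.2.1 - x.2.1 * u.1 = 0 := by
    have : BB x x * (x.1 * u.2.1 - x.2.1 * u.1) ^ 2 = 0 := by
      have e1 : 0 ≤ BB x x * (x.1 * u.2.1 - x.2.1 * u.1) ^ 2 := by positivity
      nlinarith [sq_nonneg (x.1 * (x.1 * u.2.2 - x.2.2 * u.1) / 2 - x.2.1 * (x.1 * u.2.1 - x.2.1 * u.1))]
    simpa [h1.ne'] using this
  rw [h2] at h
  have h3 : x.1 * u.2.2 - x.2.2 * u.1 = 0 := by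
    have : x.1 * (x.1 * u.2.2 - x.2.2 * u.1) = 0 := by nlinarith
    simpa [hx1.ne'] using this
  ext <;> simp <;> linarith

theorem neg_of_perp {x u : V3} (hx : x ∈ CC) (h : BB u x = 0) (hu : u ≠ 0) : BB u u < 0 := by
  rw [BB_comm] at h
  have h1 := rc_nonneg hx u
  have h3 := hx.2
  rw [h] at h1
  by_contra hcon
  push Not at hcon
  have h2 : BB x u ^ 2 - BB x x * BB u u = 0 := by rw [h]; nlinarith [mul_nonneg h3.le hcon]
  have h4 := rc_eq hx u h2
  have h5 : BB x (x.1 • u) = BB x (u.1 • x) := by rw [h4]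
  rw [BB_smul', BB_smul', h, mul_zero] at h5
  have h6 : u.1 = 0 := by
    rcases mul_eq_zero.1 h5.symm with h | h
    · exact h
    · exact absurd h h3.ne'
  rw [h6, zero_smul] at h4
  exact hu ((smul_eq_zero.1 h4).resolve_left hx.1.ne')

theorem BB_ge_one {x y : V3} (hx : x ∈ CC) (hy : y ∈ CC) (h1 : BB x x = 1) (h2 : BB y y = 1)
    (hne : x ≠ y) : 1 < BB x y := by
  have h3 := rc_nonneg hx y
  have h4 := BB_pos hx hy
  rw [h1, h2] at h3
  have h5 : 1 ≤ BB x y := by nlinarith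
  refine lt_of_le_of_ne h5 ?_
  intro h6
  have h7 := rc_eq hx y (by rw [h1, h2, ← h6]; ring)
  have h8 : BB x (x.1 • y) = BB x (y.1 • x) := by rw [h7]
  rw [BB_smul', BB_smul', ← h6, h1, mul_one, mul_one] at h8
  rw [← h8] at h7
  exact hne ((smul_right_injective _ hx.1.ne') h7).symm

theorem CC_of {x y : V3} (hx : x ∈ CC) (h1 : 0 < BB x y) (h2 : 0 < BB y y) : y ∈ CC := by
  refine ⟨?_, h2⟩
  by_contra hcon
  push Not at hcon
  rcases hcon.lt_or_eq with h | h
  · have : (-1 : ℝ) • y ∈ CC := by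
      refine ⟨by simpa using h, ?_⟩
      rw [BB_smul, BB_smul']; linarith
    have := BB_pos hx this
    rw [BB_smul'] at this; linarith
  · simp only [BB, h] at h2
    nlinarith [sq_nonneg y.2.1]

theorem BB_tri {x y w : V3} (hx : x ∈ CC) (hy : y ∈ CC) (hw : w ∈ CC) :
    BB w w * BB x y ≤ 2 * BB x w * BB w y := by
  have h1 : (2 * BB w y) • w + (- BB w w) • y ∈ CC := by
    have e1 := hw.2
    have e2 := hy.2
    have e3 := BB_pos hw hy
    apply CC_of hw
    · rw [BB_add', BB_smul', BB_smul']; nlinarith [mul_pos e1 e3]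
    · simp only [BB_add', BB_smul', BB_add, BB_smul, BB_comm y w]; nlinarith [mul_pos (mul_pos e1 e1) e2]
  have := BB_pos hx h1
  rw [BB_add', BB_smul', BB_smul'] at this
  linarith

theorem crs_ne {x y : V3} (hx : x ∈ CC) (hy : y ∈ CC) (h1 : BB x x = 1) (h2 : BB y y = 1)
    (hne : x ≠ y) : crs x y ≠ 0 := by
  intro h
  have h3 := BB_ge_one hx hy h1 h2 hne
  simp only [crs, Prod.mk_eq_zero] at h
  have h4 := rc x y
  have e1 : x.1 * y.2.1 - x.2.1 * y.1 = 0 := by linarith [h.1]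
  rw [e1, h.2.1, h1, h2] at h4
  have : x.1 ^ 2 * (BB x y ^ 2 - 1) = 0 := by linarith
  have h5 := hx.1
  have h6 : 0 < x.1 ^ 2 * (BB x y ^ 2 - 1) := mul_pos (by positivity) (by nlinarith)
  linarith

/-- three distinct points of a conic section are independent -/
theorem dt_ne {z a b c : V3} {h : ℝ} (hh : h ≠ 0) (hb : b ∈ CC) (hc : c ∈ CC)
    (b1 : BB b b = 1) (c1 : BB c c = 1) (a1 : BB a a = 1)
    (za : BB z a = h) (zb : BB z b = h) (zc : BB z c = h)
    (ab : 1 < BB a b) (ac : 1 < BB a c) (bc : 1 < BB b c) (hne : b ≠ c) : dt a b c ≠ 0 := by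
  intro h0
  have key : ∀ y, dt y b c = 0 := by
    intro y
    have k1 := id4 z a b c y
    have k2 := id4 a a b c y
    have k3 := id4 b a b c y
    have k4 := id4 c a b c y
    rw [za, zb, zc, h0] at k1
    rw [a1, h0] at k2
    rw [b1, h0, BB_comm b a] at k3
    rw [c1, h0, BB_comm c a, BB_comm c b] at k4
    have e0 : dt y b c = dt b c y := (dt_rot y b c).symm
    rw [e0]
    generalize dt b c y = α at *
    generalize dt a c y = β at *
    generalize dt a b y = γ at *
    have s1 : α - β + γ = 0 := by
      have : h * (α - β + γ) = 0 := by linarith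
      exact (mul_eq_zero.1 this).resolve_left hh
    have s2 : γ * (BB a c - 1) = β * (BB a b - 1) := by linarith
    have s3 : α * (BB a b - 1) = - γ * (BB b c - 1) := by linarith
    have s4 : α * (BB a c - 1) = β * (BB b c - 1) := by linarith
    by_contra hα
    rcases lt_or_gt_of_ne hα with hlt | hgt
    · have : β < 0 := by
        by_contra hcon; push Not at hcon
        nlinarith [mul_nonneg hcon (by linarith : 0 ≤ BB b c - 1), mul_pos_of_neg_of_neg hlt (by linarith : 1 - BB a c < 0)]
      have : γ < 0 := by
        by_contra hcon; push Not at hcon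
        nlinarith [mul_nonneg hcon (by linarith : 0 ≤ BB a c - 1), mul_pos_of_neg_of_neg this (by linarith : 1 - BB a b < 0)]
      nlinarith [mul_pos_of_neg_of_neg this (by linarith : 1 - BB b c < 0), mul_pos_of_neg_of_neg hlt (by linarith : 1 - BB a b < 0)]
    · have : 0 < β := by
        by_contra hcon; push Not at hcon
        nlinarith [mul_nonneg_of_nonpos_of_nonpos hcon (by linarith : 1 - BB b c ≤ 0), mul_pos hgt (by linarith : 0 < BB a c - 1)]
      have : 0 < γ := by
        by_contra hcon; push Not at hcon
        nlinarith [mul_nonneg_of_nonpos_of_nonpos hcon (by linarith : 1 - BB a c ≤ 0), mul_pos this (by linarith : 0 < BB a b - 1)]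
      nlinarith [mul_pos this (by linarith : 0 < BB b c - 1), mul_pos hgt (by linarith : 0 < BB a b - 1)]
  apply crs_ne hb hc b1 c1 hne
  have k1 := key (1, 0, 0)
  have k2 := key (0, 1, 0)
  have k3 := key (0, 0, 1)
  simp [dt] at k1 k2 k3
  simp only [crs, Prod.mk_eq_zero]
  refine ⟨?_, ?_, ?_⟩ <;> linarith

end geo

section geo2
open Topology

structure Geo (Γ : Type) [Group Γ] where
  x : Γ → V3
  L : Γ → V3 → V3
  xC : ∀ γ, x γ ∈ CC
  xQ : ∀ γ, BB (x γ) (x γ) = 1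
  xi : Function.Injective x
  hB : ∀ γ z δ, BB (L γ z) (x (γ * δ)) = BB z (x δ)
  hC : ∀ γ z, z ∈ CC → L γ z ∈ CC
  hdt : ∀ γ a b c, dt (x (γ * a)) (x (γ * b)) (x (γ * c)) = dt (x a) (x b) (x c)
  proper : ∀ R, {γ | BB (x 1) (x γ) ≤ R}.Finite
  cocpt : ∃ R, ∀ y ∈ CC, ∃ γ, BB y (x γ) ≤ R * √(BB y y)

namespace Geo
variable {Γ : Type} [Group Γ] (G : Geo Γ)

def N (z : V3) : Set Γ := {γ | ∀ δ, BB z (G.x γ) ≤ BB z (G.x δ)}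

theorem g0 {z : V3} (hz : z ∈ CC) (R : ℝ) : {γ | BB z (G.x γ) ≤ R}.Finite := by
  refine (G.proper (2 * BB (G.x 1) z * R / BB z z)).subset ?_
  intro γ hγ
  have h1 := BB_tri (G.xC 1) (G.xC γ) hz
  have h2 := BB_pos (G.xC 1) hz
  show BB (G.x 1) (G.x γ) ≤ _
  rw [le_div_iff₀ hz.2]
  have h3 : BB z (G.x γ) ≤ R := hγ
  nlinarith [mul_le_mul_of_nonneg_left h3 h2.le]

theorem exmin {z : V3} (hz : z ∈ CC) : (G.N z).Nonempty := by
  obtain ⟨a, ha, h⟩ := Set.exists_min_image _ (fun γ => BB z (G.x γ))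
    (G.g0 hz (BB z (G.x 1))) ⟨1, by simp⟩
  refine ⟨a, fun δ => ?_⟩
  by_cases hδ : BB z (G.x δ) ≤ BB z (G.x 1)
  · exact h δ hδ
  · have : BB z (G.x a) ≤ BB z (G.x 1) := ha
    linarith

theorem Nfin {z : V3} (hz : z ∈ CC) : (G.N z).Finite :=
  (G.g0 hz (BB z (G.x 1))).subset fun _ h => h 1

variable {G}
theorem Neq {z : V3} {a b : Γ} (ha : a ∈ G.N z) (hb : b ∈ G.N z) :
    BB z (G.x a) = BB z (G.x b) := le_antisymm (ha b) (hb a)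

theorem Nlt {z : V3} {a b : Γ} (ha : a ∈ G.N z) (hb : b ∉ G.N z) :
    BB z (G.x a) < BB z (G.x b) := by
  refine lt_of_le_of_ne (ha b) fun h => hb fun δ => ?_
  rw [← h]; exact ha δ

variable (G)
theorem usc {z : V3} (hz : z ∈ CC) : ∀ᶠ w in 𝓝 z, G.N w ⊆ G.N z := by
  obtain ⟨a, ha⟩ := G.exmin hz
  set m := BB z (G.x a) with hm
  have e1 : ∀ᶠ w in 𝓝 z, w + (-(1/2) : ℝ) • z ∈ CC := by
    have hc : Continuous fun w : V3 => w + (-(1/2) : ℝ) • z := by fun_prop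
    refine hc.continuousAt.eventually_mem (CC_open.mem_nhds ?_)
    have : z + (-(1/2) : ℝ) • z = (1/2 : ℝ) • z := by module
    rw [this]
    exact CC_smul hz (by norm_num)
  have e2 : ∀ᶠ w in 𝓝 z, BB w (G.x a) < m + 1 :=
    (BB_cont continuous_id continuous_const).continuousAt.eventually_lt
      continuousAt_const (by simp [hm])
  have e3 : ∀ᶠ w in 𝓝 z, ∀ δ ∈ {γ | BB z (G.x γ) ≤ 2 * (m + 1)}, δ ∉ G.N z →
      BB w (G.x a) < BB w (G.x δ) := by
    rw [Set.Finite.eventually_all (G.g0 hz _)]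
    intro δ _
    by_cases hδ : δ ∈ G.N z
    · exact Filter.Eventually.of_forall fun w h => absurd hδ h
    · have := (BB_cont (g := fun _ : V3 => G.x a) continuous_id continuous_const).continuousAt.eventually_lt
        (BB_cont (g := fun _ : V3 => G.x δ) continuous_id continuous_const).continuousAt (Nlt ha hδ)
      exact this.mono fun w h _ => h
  filter_upwards [e1, e2, e3] with w h1 h2 h3 δ hδ
  by_contra hn
  have h4 := hδ a
  have h5 := BB_pos h1 (G.xC δ)
  rw [BB_add, BB_smul] at h5
  have := h3 δ (show _ ≤ _ by linarith) hn
  linarith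

variable {G}
theorem dtne {z : V3} (hz : z ∈ CC) {a b c : Γ} (ha : a ∈ G.N z) (hb : b ∈ G.N z)
    (hc : c ∈ G.N z) (ab : a ≠ b) (ac : a ≠ c) (bc : b ≠ c) :
    dt (G.x a) (G.x b) (G.x c) ≠ 0 := by
  have gt : ∀ {u v : Γ}, u ≠ v → 1 < BB (G.x u) (G.x v) := fun h =>
    BB_ge_one (G.xC _) (G.xC _) (G.xQ _) (G.xQ _) (G.xi.ne h)
  exact dt_ne (BB_pos hz (G.xC a)).ne' (G.xC b) (G.xC c) (G.xQ b) (G.xQ c) (G.xQ a) rfl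
    (Neq hb ha) (Neq hc ha) (gt ab) (gt ac) (gt bc) (G.xi.ne bc)

theorem dttr {z : V3} (hz : z ∈ CC) {a b c d : Γ} (ha : a ∈ G.N z) (hb : b ∈ G.N z)
    (hc : c ∈ G.N z) (hd : d ∈ G.N z) (ab : a ≠ b) (ac : a ≠ c) (ad : a ≠ d)
    (h1 : 0 < dt (G.x a) (G.x b) (G.x c)) (h2 : 0 < dt (G.x a) (G.x c) (G.x d)) :
    0 < dt (G.x a) (G.x b) (G.x d) := by
  have gt : ∀ {u v : Γ}, u ≠ v → 1 < BB (G.x u) (G.x v) := fun h =>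
    BB_ge_one (G.xC _) (G.xC _) (G.xQ _) (G.xQ _) (G.xi.ne h)
  have k1 := id4 z (G.x a) (G.x b) (G.x c) (G.x d)
  have k2 := id4 (G.x a) (G.x a) (G.x b) (G.x c) (G.x d)
  rw [G.xQ a] at k2
  rw [Neq hb ha, Neq hc ha, Neq hd ha] at k1
  have h := BB_pos hz (G.xC a)
  have k3 : BB z (G.x a) * (dt (G.x b) (G.x c) (G.x d) - dt (G.x a) (G.x c) (G.x d) +
    dt (G.x a) (G.x b) (G.x d) - dt (G.x a) (G.x b) (G.x c)) = 0 := by linarith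
  have k4 := (mul_eq_zero.1 k3).resolve_left h.ne'
  have g1 := gt ab
  have g2 := gt ac
  have g3 := gt ad
  have k5 : (BB (G.x a) (G.x c) - 1) * dt (G.x a) (G.x b) (G.x d) =
    (BB (G.x a) (G.x b) - 1) * dt (G.x a) (G.x c) (G.x d) +
    (BB (G.x a) (G.x d) - 1) * dt (G.x a) (G.x b) (G.x c) := by linear_combination k2 - k4
  have k6 : 0 < (BB (G.x a) (G.x c) - 1) * dt (G.x a) (G.x b) (G.x d) := by
    rw [k5]
    exact add_pos (mul_pos (by linarith) h2) (mul_pos (by linarith) h1)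
  exact pos_of_mul_pos_right k6 (by linarith)

theorem minel {z : V3} (hz : z ∈ CC) {b : Γ} (hb : b ∈ G.N z) {A : Set Γ} (hA : A ⊆ G.N z)
    (hbA : b ∉ A) (hne : A.Nonempty) : ∃ a ∈ A, ∀ c ∈ A, ¬ 0 < dt (G.x b) (G.x c) (G.x a) := by
  have : Finite A := ((G.Nfin hz).subset hA).to_subtype
  let r : A → A → Prop := fun u v => 0 < dt (G.x b) (G.x u) (G.x v)
  have n : ∀ u : A, b ≠ u := fun u h => hbA (h ▸ u.2)
  have : IsTrans A r := ⟨fun u v w h1 h2 =>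
    dttr hz hb (hA u.2) (hA v.2) (hA w.2) (n u) (n v) (n w) h1 h2⟩
  have : Std.Irrefl r := ⟨fun u h => by simp only [r, dt_abb] at h; exact lt_irrefl _ h⟩
  obtain ⟨a, ha⟩ := hne
  obtain ⟨m, _, hm⟩ := (Finite.wellFounded_of_trans_of_irrefl r).has_min Set.univ ⟨⟨a, ha⟩, trivial⟩
  exact ⟨m, m.2, fun c hc h => hm ⟨c, hc⟩ trivial h⟩

theorem maxel {z : V3} (hz : z ∈ CC) {b : Γ} (hb : b ∈ G.N z) {A : Set Γ} (hA : A ⊆ G.N z)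
    (hbA : b ∉ A) (hne : A.Nonempty) : ∃ a ∈ A, ∀ c ∈ A, ¬ 0 < dt (G.x b) (G.x a) (G.x c) := by
  have : Finite A := ((G.Nfin hz).subset hA).to_subtype
  let r : A → A → Prop := fun v u => 0 < dt (G.x b) (G.x u) (G.x v)
  have n : ∀ u : A, b ≠ u := fun u h => hbA (h ▸ u.2)
  have : IsTrans A r := ⟨fun u v w h1 h2 =>
    dttr hz hb (hA w.2) (hA v.2) (hA u.2) (n w) (n v) (n u) h2 h1⟩
  have : Std.Irrefl r := ⟨fun u h => by simp only [r, dt_abb] at h; exact lt_irrefl _ h⟩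
  obtain ⟨a, ha⟩ := hne
  obtain ⟨m, _, hm⟩ := (Finite.wellFounded_of_trans_of_irrefl r).has_min Set.univ ⟨⟨a, ha⟩, trivial⟩
  exact ⟨m, m.2, fun c hc h => hm ⟨c, hc⟩ trivial h⟩

variable (G)
def Sc (z : V3) (γ δ : Γ) : Prop := γ ∈ G.N z ∧ δ ∈ G.N z ∧ γ ≠ δ ∧
  ∀ ε ∈ G.N z, ε ≠ γ → ε ≠ δ → 0 < dt (G.x γ) (G.x δ) (G.x ε)

def Adj (γ δ : Γ) : Prop := γ ≠ δ ∧ ∃ w ∈ CC, G.N w = {γ, δ}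

variable {G}
theorem Sc_ex {z : V3} (hz : z ∈ CC) {γ b : Γ} (hγ : γ ∈ G.N z) (hb : b ∈ G.N z) (h : b ≠ γ) :
    ∃ δ, G.Sc z γ δ := by
  obtain ⟨a, ha, hm⟩ := minel (A := G.N z \ {γ}) hz hγ (fun _ h => h.1) (fun h => h.2 rfl) ⟨b, hb, h⟩
  have hne : γ ≠ a := fun h => ha.2 h.symm
  refine ⟨a, hγ, ha.1, hne, fun ε hε h1 h2 => ?_⟩
  have h3 := hm ε ⟨hε, h1⟩
  have h4 := dtne hz hγ hε ha.1 (Ne.symm h1) hne h2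
  rw [dt_swap]
  have : dt (G.x γ) (G.x ε) (G.x a) < 0 := lt_of_le_of_ne (not_lt.1 h3) h4
  linarith

theorem Sc_uniq {z : V3} {γ δ δ' : Γ} (h : G.Sc z γ δ) (h' : G.Sc z γ δ') : δ = δ' := by
  by_contra hne
  have h1 := h.2.2.2 δ' h'.2.1 (Ne.symm h'.2.2.1) (Ne.symm hne)
  have h2 := h'.2.2.2 δ h.2.1 (Ne.symm h.2.2.1) hne
  rw [dt_swap] at h2
  linarith

theorem Pr_uniq {z : V3} {γ δ δ' : Γ} (h : G.Sc z δ γ) (h' : G.Sc z δ' γ) : δ = δ' := by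
  by_contra hne
  have h1 := h.2.2.2 δ' h'.1 (Ne.symm hne) h'.2.2.1
  have h2 := h'.2.2.2 δ h.1 hne h.2.2.1
  rw [dt_rot, dt_swap] at h2
  linarith

theorem Sc_all {z : V3} (hz : z ∈ CC) {A : Set Γ} (hA : A ⊆ G.N z) (hne : A.Nonempty)
    (hcl : ∀ a ∈ A, ∀ b, G.Sc z a b → b ∈ A) : A = G.N z := by
  refine hA.antisymm fun b hb => ?_
  by_contra hbA
  obtain ⟨a, ha, hm⟩ := maxel hz hb hA hbA hne
  have hab : b ≠ a := fun h => hbA (h ▸ ha)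
  obtain ⟨s, hs⟩ := Sc_ex hz (hA ha) hb hab
  have hsA := hcl a ha s hs
  have hbs : b ≠ s := fun h => hbA (h ▸ hsA)
  have h1 := hs.2.2.2 b hb hab hbs
  have h2 := hm s hsA
  rw [dt_rot] at h1
  exact h2 h1

theorem Sc_adj {z : V3} (hz : z ∈ CC) {γ δ : Γ} (h : G.Sc z γ δ) : G.Adj γ δ := by
  refine ⟨h.2.2.1, ?_⟩
  have hc : Continuous fun t : ℝ => z + t • crs (G.x γ) (G.x δ) := by fun_prop
  have h0 : z + (0 : ℝ) • crs (G.x γ) (G.x δ) = z := by simp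
  have e1 : ∀ᶠ t in 𝓝 (0 : ℝ), z + t • crs (G.x γ) (G.x δ) ∈ CC :=
    hc.continuousAt.eventually_mem (CC_open.mem_nhds (by rwa [h0]))
  have e2 : ∀ᶠ t in 𝓝 (0 : ℝ), G.N (z + t • crs (G.x γ) (G.x δ)) ⊆ G.N z := by
    have := hc.tendsto 0
    rw [h0] at this
    exact this.eventually (G.usc hz)
  have e3 : ∀ᶠ t in 𝓝[>] (0 : ℝ), 0 < t := eventually_mem_nhdsWithin
  obtain ⟨t, h1, h2, h3⟩ := ((e1.filter_mono nhdsWithin_le_nhds).and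
    ((e2.filter_mono nhdsWithin_le_nhds).and e3)).exists
  have hb : ∀ ε, BB (z + t • crs (G.x γ) (G.x δ)) (G.x ε) =
    BB z (G.x ε) + t * dt (G.x γ) (G.x δ) (G.x ε) := fun ε => by rw [BB_add, BB_smul, BB_crs]
  have key : ∀ ε ∈ G.N (z + t • crs (G.x γ) (G.x δ)), ε = γ ∨ ε = δ := by
    intro ε hε
    by_contra hcon
    push Not at hcon
    have k1 := h.2.2.2 ε (h2 hε) hcon.1 hcon.2
    have k2 := hε γ
    rw [hb, hb, dt_aba, Neq (h2 hε) h.1] at k2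
    have := mul_pos h3 k1
    linarith
  have eq : BB (z + t • crs (G.x γ) (G.x δ)) (G.x γ) = BB (z + t • crs (G.x γ) (G.x δ)) (G.x δ) := by
    rw [hb, hb, dt_aba, dt_abb, Neq h.1 h.2.1]
  refine ⟨_, h1, ?_⟩
  obtain ⟨ε, hε⟩ := G.exmin h1
  ext β
  constructor
  · exact key β
  · rintro (rfl | rfl) <;> rcases key ε hε with rfl | rfl
    · exact hε
    · intro d; rw [eq]; exact hε d
    · intro d; rw [← eq]; exact hε d
    · exact hε

theorem Adj_Sc {z : V3} (hz : z ∈ CC) {γ δ : Γ} (h : G.Adj γ δ) (hγ : γ ∈ G.N z)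
    (hδ : δ ∈ G.N z) : G.Sc z γ δ ∨ G.Sc z δ γ := by
  obtain ⟨hne, w, hw, hN⟩ := h
  have wγ : γ ∈ G.N w := by simp [hN]
  have wδ : δ ∈ G.N w := by simp [hN]
  have key : ∀ a b, a ∈ G.N z → b ∈ G.N z → a ∉ G.N w → b ∉ G.N w →
      0 < dt (G.x γ) (G.x δ) (G.x a) → dt (G.x γ) (G.x δ) (G.x b) < 0 → False := by
    intro a b ha hb haw hbw h1 h2
    have k1 := id4 z (G.x γ) (G.x δ) (G.x a) (G.x b)
    have k2 := id4 w (G.x γ) (G.x δ) (G.x a) (G.x b)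
    rw [Neq hδ hγ, Neq ha hγ, Neq hb hγ] at k1
    rw [Neq wδ wγ] at k2
    have h := BB_pos hz (G.xC γ)
    have k3 : BB z (G.x γ) * (dt (G.x δ) (G.x a) (G.x b) - dt (G.x γ) (G.x a) (G.x b) +
      dt (G.x γ) (G.x δ) (G.x b) - dt (G.x γ) (G.x δ) (G.x a)) = 0 := by linarith
    have k4 := (mul_eq_zero.1 k3).resolve_left h.ne'
    have l1 := Nlt wγ haw
    have l2 := Nlt wγ hbw
    have k5 : (BB w (G.x a) - BB w (G.x γ)) * dt (G.x γ) (G.x δ) (G.x b) =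
      (BB w (G.x b) - BB w (G.x γ)) * dt (G.x γ) (G.x δ) (G.x a) := by
      linear_combination k2 - BB w (G.x γ) * k4
    have k6 := mul_pos (sub_pos.2 l2) h1
    have k7 := mul_pos (sub_pos.2 l1) (neg_pos.2 h2)
    linarith
  have nw : ∀ ε, ε ≠ γ → ε ≠ δ → ε ∉ G.N w := by
    intro ε h1 h2; simp [hN, h1, h2]
  by_cases hex : ∃ a ∈ G.N z, a ≠ γ ∧ a ≠ δ ∧ 0 < dt (G.x γ) (G.x δ) (G.x a)
  · obtain ⟨a, ha, a1, a2, a3⟩ := hex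
    refine Or.inl ⟨hγ, hδ, hne, fun ε hε h1 h2 => ?_⟩
    by_contra hcon
    refine key a ε ha hε (nw a a1 a2) (nw ε h1 h2) a3 (lt_of_le_of_ne (not_lt.1 hcon) ?_)
    exact dtne hz hγ hδ hε hne (Ne.symm h1) (Ne.symm h2)
  · push Not at hex
    refine Or.inr ⟨hδ, hγ, hne.symm, fun ε hε h1 h2 => ?_⟩
    have := lt_of_le_of_ne (hex ε hε h2 h1) (dtne hz hγ hδ hε hne (Ne.symm h2) (Ne.symm h1))
    rw [dt_swap']; linarith

theorem Adj_symm {γ δ : Γ} (h : G.Adj γ δ) : G.Adj δ γ := by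
  obtain ⟨h1, w, hw, h2⟩ := h
  exact ⟨h1.symm, w, hw, by rw [h2, Set.pair_comm]⟩

end Geo
end geo2

section geo3
open Topology
namespace Geo
variable {Γ : Type} [Group Γ] {G : Geo Γ}

theorem N_L {z : V3} {a : Γ} (γ : Γ) : γ * a ∈ G.N (G.L γ z) ↔ a ∈ G.N z := by
  constructor
  · intro h δ
    have := h (γ * δ)
    rwa [G.hB, G.hB] at this
  · intro h δ
    have := h (γ⁻¹ * δ)
    rwa [← G.hB γ z a, ← G.hB γ z (γ⁻¹ * δ), mul_inv_cancel_left] at this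

theorem Sc_L {z : V3} {a b : Γ} (γ : Γ) (h : G.Sc z a b) : G.Sc (G.L γ z) (γ * a) (γ * b) := by
  refine ⟨(N_L γ).2 h.1, (N_L γ).2 h.2.1, fun e => h.2.2.1 (mul_left_cancel e), fun ε hε h1 h2 => ?_⟩
  have e : ε = γ * (γ⁻¹ * ε) := by simp
  rw [e] at hε h1 h2 ⊢
  rw [G.hdt]
  exact h.2.2.2 _ ((N_L γ).1 hε) (fun h => h1 (by rw [h])) (fun h => h2 (by rw [h]))

theorem Adj_L {a b : Γ} (γ : Γ) (h : G.Adj a b) : G.Adj (γ * a) (γ * b) := by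
  obtain ⟨h1, w, hw, h2⟩ := h
  refine ⟨fun e => h1 (mul_left_cancel e), G.L γ w, G.hC _ _ hw, ?_⟩
  ext β
  have e : β = γ * (γ⁻¹ * β) := by simp
  rw [e, N_L, h2]
  simp only [Set.mem_insert_iff, Set.mem_singleton_iff, mul_right_inj]

variable (G)
theorem exit {w d : V3} (hw : w ∈ CC) {γ : Γ} (hγ : γ ∈ G.N w) (hd : d ≠ 0)
    (hdγ : BB d (G.x γ) = 0) : ∃ t : ℝ, 0 ≤ t ∧ w + t • d ∈ CC ∧ γ ∈ G.N (w + t • d) ∧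
    ∃ ε ∈ G.N (w + t • d), BB d (G.x ε) < 0 := by
  obtain ⟨R, hR⟩ := G.cocpt
  have hk : 0 < BB w (G.x γ) := BB_pos hw (G.xC γ)
  set k := BB w (G.x γ) with hkd
  have hc : BB d d < 0 := neg_of_perp (G.xC γ) hdγ hd
  have hq := hw.2
  set q := BB w w with hqd
  have yb : ∀ (t : ℝ) ε, BB (w + t • d) (G.x ε) = BB w (G.x ε) + t * BB d (G.x ε) := fun t ε => by
    rw [BB_add, BB_smul]
  have yγ : ∀ t : ℝ, BB (w + t • d) (G.x γ) = k := fun t => by rw [yb, hdγ, mul_zero, add_zero]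
  have yq : ∀ t : ℝ, BB (w + t • d) (w + t • d) = q + 2 * BB w d * t + BB d d * t ^ 2 := fun t => by
    rw [BB_add, BB_add', BB_add', BB_smul, BB_smul, BB_smul', BB_smul', BB_comm d w]; ring
  have hRp : 0 < |R| + 1 := by positivity
  obtain ⟨η, η0, η1, η2⟩ : ∃ η : ℝ, 0 < η ∧ η ≤ q ∧ R * √η < k := by
    refine ⟨min q ((k / (|R| + 1)) ^ 2), by positivity, min_le_left _ _, ?_⟩
    have h1 : √(min q ((k / (|R| + 1)) ^ 2)) ≤ k / (|R| + 1) := by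
      rw [Real.sqrt_le_left (by positivity)]; exact min_le_right _ _
    have h2 : R * √(min q ((k / (|R| + 1)) ^ 2)) ≤ |R| * (k / (|R| + 1)) :=
      mul_le_mul (le_abs_self R) h1 (Real.sqrt_nonneg _) (abs_nonneg R)
    have h3 : |R| * (k / (|R| + 1)) < k := by
      rw [mul_div_assoc', div_lt_iff₀ hRp]; nlinarith
    linarith
  obtain ⟨T, T0, hT⟩ : ∃ T : ℝ, 0 ≤ T ∧ BB (w + T • d) (w + T • d) = η := by
    set c := - BB d d with hcd
    have c0 : 0 < c := by linarith
    set M := (2 * |BB w d| + q) / c + 1 with hM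
    have M1 : 1 ≤ M := by rw [hM]; have : 0 ≤ (2 * |BB w d| + q) / c := by positivity
                          linarith
    have hcont : ContinuousOn (fun t : ℝ => BB (w + t • d) (w + t • d)) (Set.Icc 0 M) :=
      (BB_cont (by fun_prop) (by fun_prop)).continuousOn
    have := intermediate_value_Icc' (by linarith : (0 : ℝ) ≤ M) hcont
    have g1 : BB (w + M • d) (w + M • d) ≤ η := by
      simp only [yq]
      have e : c * M = 2 * |BB w d| + q + c := by rw [hM]; field_simp
      have e2 : BB d d = -c := by rw [hcd]; ring
      have e3 := le_abs_self (BB w d)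
      rw [e2]
      have : q + 2 * BB w d * M + -c * M ^ 2 = q - q * M + M * (2 * (BB w d - |BB w d|)) - c * M := by
        linear_combination (-M) * e
      rw [this]
      nlinarith [mul_nonneg (by linarith : 0 ≤ M) (by linarith : 0 ≤ |BB w d| - BB w d),
        mul_nonneg hq.le (by linarith : 0 ≤ M - 1), mul_pos c0 (by linarith : 0 < M)]
    have g2 : η ≤ BB (w + (0 : ℝ) • d) (w + (0 : ℝ) • d) := by
      simpa only [yq, mul_zero, add_zero, ne_eq, OfNat.ofNat_ne_zero, not_false_eq_true, zero_pow] using η1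
    obtain ⟨T, hT, h⟩ := this ⟨g1, g2⟩
    exact ⟨T, hT.1, h⟩
  have hyT : w + T • d ∈ CC := CC_of (G.xC γ) (by rw [BB_comm, yγ]; exact hk) (by rw [hT]; exact η0)
  obtain ⟨γ', hγ'⟩ := hR _ hyT
  rw [hT] at hγ'
  have hTp : 0 < T := by
    rcases T0.lt_or_eq with h | h
    · exact h
    · exfalso
      rw [← h] at hγ'
      have := hγ γ'
      simp only [zero_smul, add_zero] at hγ'
      linarith
  obtain ⟨ε, hε, hmin⟩ := Set.exists_min_image {ε | BB (w + T • d) (G.x ε) < k}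
    (fun ε => (BB w (G.x ε) - k) / (- BB d (G.x ε)))
    ((G.g0 hyT k).subset (by intro ε h; simp only [Set.mem_ofPred_eq] at h ⊢; exact h.le)) ⟨γ', lt_of_le_of_lt hγ' η2⟩
  have neg : ∀ δ, BB (w + T • d) (G.x δ) < k → 0 < - BB d (G.x δ) := by
    intro δ h
    rw [yb] at h
    have h2 : k ≤ BB w (G.x δ) := hγ δ
    by_contra hcon
    nlinarith [mul_nonneg T0 (by linarith : 0 ≤ BB d (G.x δ))]
  have hε' : BB (w + T • d) (G.x ε) < k := hε
  have n1 := neg ε hε'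
  set t := (BB w (G.x ε) - k) / (- BB d (G.x ε)) with ht
  have te : t * (- BB d (G.x ε)) = BB w (G.x ε) - k := div_mul_cancel₀ _ n1.ne'
  have kε : k ≤ BB w (G.x ε) := hγ ε
  have t0 : 0 ≤ t := div_nonneg (by linarith) n1.le
  have tT : t ≤ T := by
    rw [yb] at hε'
    by_contra hcon
    nlinarith [mul_pos n1 (by linarith : 0 < t - T)]
  have key : ∀ δ, k ≤ BB (w + t • d) (G.x δ) := by
    intro δ
    have h1 : k ≤ BB w (G.x δ) := hγ δ
    by_cases hδ : BB (w + T • d) (G.x δ) < k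
    · have n2 := neg δ hδ
      have h2 := hmin δ hδ
      rw [le_div_iff₀ n2] at h2
      rw [yb]; linarith
    · rw [yb] at hδ ⊢
      by_cases hs : 0 ≤ BB d (G.x δ)
      · nlinarith [mul_nonneg t0 hs]
      · nlinarith [mul_nonneg (by linarith : 0 ≤ T - t) (by linarith : 0 ≤ - BB d (G.x δ))]
  have εk : BB (w + t • d) (G.x ε) = k := by rw [yb]; linarith
  refine ⟨t, t0, ?_, fun δ => by rw [yγ]; exact key δ, ε, fun δ => by rw [εk]; exact key δ, by linarith⟩
  have : w + t • d = (1 - t / T) • w + (t / T) • (w + T • d) := by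
    rw [smul_add, smul_smul, div_mul_cancel₀ _ hTp.ne']; module
  rw [this]
  have h1 : t / T ≤ 1 := by rw [div_le_one hTp]; exact tT
  exact CC_convex hw hyT (by linarith) (by positivity) (by ring)

def Big (z : V3) : Prop := ∀ a b, ∃ ε ∈ G.N z, ε ≠ a ∧ ε ≠ b

variable {G}
theorem Big_of {z : V3} {a b c : Γ} (ha : a ∈ G.N z) (hb : b ∈ G.N z) (hc : c ∈ G.N z)
    (ab : a ≠ b) (ac : a ≠ c) (bc : b ≠ c) : G.Big z := by
  intro p q
  by_cases h1 : a ≠ p ∧ a ≠ q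
  · exact ⟨a, ha, h1⟩
  by_cases h2 : b ≠ p ∧ b ≠ q
  · exact ⟨b, hb, h2⟩
  refine ⟨c, hc, ?_⟩
  grind

theorem Adj_ex {γ δ : Γ} (h : G.Adj γ δ) : ∃ z ∈ CC, G.Big z ∧ G.Sc z γ δ := by
  have hadj := h
  obtain ⟨hne, w, hw, hN⟩ := h
  have wγ : γ ∈ G.N w := by simp [hN]
  have wδ : δ ∈ G.N w := by simp [hN]
  have hcr := crs_ne (G.xC γ) (G.xC δ) (G.xQ γ) (G.xQ δ) (G.xi.ne hne)
  have hb : ∀ ε, BB ((-1 : ℝ) • crs (G.x γ) (G.x δ)) (G.x ε) = - dt (G.x γ) (G.x δ) (G.x ε) := by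
    intro ε; rw [BB_smul, BB_crs]; ring
  obtain ⟨t, t0, h1, h2, ε, h3, h4⟩ := G.exit hw wγ (d := (-1 : ℝ) • crs (G.x γ) (G.x δ))
    (smul_ne_zero (by norm_num) hcr) (by rw [hb, dt_aba, neg_zero])
  set y := w + t • ((-1 : ℝ) • crs (G.x γ) (G.x δ)) with hy
  have yδ : δ ∈ G.N y := by
    have e : BB y (G.x δ) = BB y (G.x γ) := by
      rw [hy, BB_add, BB_add, BB_smul t, BB_smul t, hb, hb, dt_aba, dt_abb, Neq wγ wδ]
    intro β; rw [e]; exact h2 β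
  rw [hb] at h4
  have n1 : ε ≠ γ := by rintro rfl; rw [dt_aba] at h4; simp at h4
  have n2 : ε ≠ δ := by rintro rfl; rw [dt_abb] at h4; simp at h4
  refine ⟨y, h1, Big_of h2 yδ h3 hne n1.symm n2.symm, ?_⟩
  rcases Adj_Sc h1 hadj h2 yδ with h | h
  · exact h
  · have := h.2.2.2 ε h3 n2 n1
    rw [dt_swap'] at this
    linarith

theorem N_eq {z z' : V3} (hz : z ∈ CC) (hz' : z' ∈ CC) (b : G.Big z) (b' : G.Big z') {γ δ : Γ}
    (h : G.Sc z γ δ) (h' : G.Sc z' γ δ) : G.N z = G.N z' := by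
  have key : ∀ {a b}, a ∈ G.N z → a ≠ γ → a ≠ δ → b ∈ G.N z' → b ≠ γ → b ≠ δ →
      a ∈ G.N z' ∧ b ∈ G.N z := by
    intro a b ha a1 a2 hb b1 b2
    have k1 := id4 z (G.x γ) (G.x δ) (G.x a) (G.x b)
    have k2 := id4 z' (G.x γ) (G.x δ) (G.x a) (G.x b)
    rw [Neq h.2.1 h.1, Neq ha h.1] at k1
    rw [Neq h'.2.1 h'.1, Neq hb h'.1] at k2
    have d1 := h.2.2.2 a ha a1 a2
    have d2 := h'.2.2.2 b hb b1 b2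
    have p1 := BB_pos hz (G.xC γ)
    have p2 := BB_pos hz' (G.xC γ)
    constructor
    · by_contra hcon
      have l1 := Nlt h'.1 hcon
      have l2 := h.1 b
      have m1 := mul_pos (mul_pos p1 d2) (sub_pos.2 l1)
      have m2 := mul_nonneg (mul_pos p2 d1).le (sub_nonneg.2 l2)
      nlinarith
    · by_contra hcon
      have l1 := Nlt h.1 hcon
      have l2 := h'.1 a
      have m1 := mul_pos (mul_pos p2 d1) (sub_pos.2 l1)
      have m2 := mul_nonneg (mul_pos p1 d2).le (sub_nonneg.2 l2)
      nlinarith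
  obtain ⟨e, he, e1, e2⟩ := b γ δ
  obtain ⟨e', he', e1', e2'⟩ := b' γ δ
  ext β
  by_cases hb1 : β = γ
  · subst hb1; exact ⟨fun _ => h'.1, fun _ => h.1⟩
  by_cases hb2 : β = δ
  · subst hb2; exact ⟨fun _ => h'.2.1, fun _ => h.2.1⟩
  exact ⟨fun hb => (key hb hb1 hb2 he' e1' e2').1, fun hb => (key he e1 e2 hb hb1 hb2).2⟩

variable (G)
theorem Sfin : {s | G.Adj 1 s}.Finite := by
  obtain ⟨R, hR⟩ := G.cocpt
  refine (G.proper (2 * R ^ 2)).subset ?_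
  rintro s ⟨_, w, hw, hN⟩
  show BB (G.x 1) (G.x s) ≤ 2 * R ^ 2
  have w1 : 1 ∈ G.N w := by simp [hN]
  have ws : s ∈ G.N w := by simp [hN]
  obtain ⟨γ, hγ⟩ := hR w hw
  have h1 := (w1 γ).trans hγ
  have h2 := (ws γ).trans hγ
  have p1 := BB_pos hw (G.xC 1)
  have p2 := BB_pos hw (G.xC s)
  have h3 := BB_tri (G.xC 1) (G.xC s) hw
  have h4 := mul_le_mul h1 h2 p2.le (p1.le.trans h1)
  have h5 := Real.mul_self_sqrt hw.2.le
  have h6 : BB w w * BB (G.x 1) (G.x s) ≤ BB w w * (2 * R ^ 2) := by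
    rw [BB_comm (G.x 1) w] at h3
    nlinarith
  exact le_of_mul_le_mul_left h6 hw.2

theorem N_x (γ : Γ) : G.N (G.x γ) = {γ} := by
  have h : ∀ δ, δ ≠ γ → 1 < BB (G.x γ) (G.x δ) := fun δ h =>
    BB_ge_one (G.xC _) (G.xC _) (G.xQ _) (G.xQ _) (G.xi.ne h.symm)
  ext β
  constructor
  · intro hb
    by_contra hne
    have := hb γ
    rw [G.xQ] at this
    linarith [h β hne]
  · rintro rfl δ
    by_cases hd : δ = β
    · rw [hd]
    · rw [G.xQ]; exact (h δ hd).le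

theorem Adj_all {A : Set Γ} (hne : A.Nonempty) (hA : ∀ a ∈ A, ∀ b, G.Adj a b → b ∈ A) (γ : Γ) :
    γ ∈ A := by
  have hop : ∀ B : Set Γ, IsOpen {z | z ∈ CC ∧ G.N z ⊆ B} := by
    intro B
    rw [isOpen_iff_mem_nhds]
    rintro z ⟨hz, hB⟩
    filter_upwards [CC_open.mem_nhds hz, G.usc hz] with w h1 h2
    exact ⟨h1, h2.trans hB⟩
  have hx : ∀ (B : Set Γ) (b : Γ), b ∈ B → G.x b ∈ {z | z ∈ CC ∧ G.N z ⊆ B} := by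
    intro B b hb
    exact ⟨G.xC b, by rw [N_x]; simpa using hb⟩
  by_contra hγ
  obtain ⟨a, ha⟩ := hne
  have hcov : CC ⊆ {z | z ∈ CC ∧ G.N z ⊆ A} ∪ {z | z ∈ CC ∧ G.N z ⊆ Aᶜ} := by
    intro z hz
    by_cases hm : (G.N z ∩ A).Nonempty
    · left
      have := Sc_all hz Set.inter_subset_left hm (fun b hb c hc => ⟨hc.2.1, hA b hb.2 c (Sc_adj hz hc)⟩)
      exact ⟨hz, Set.inter_eq_left.1 this⟩
    · right
      exact ⟨hz, fun b hb hbA => hm ⟨b, hb, hbA⟩⟩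
  obtain ⟨z, hz, h1, h2⟩ := CC_convex.isPreconnected _ _ (hop A) (hop Aᶜ) hcov
    ⟨_, G.xC a, hx A a ha⟩ ⟨_, G.xC γ, hx Aᶜ γ hγ⟩
  obtain ⟨b, hb⟩ := G.exmin hz
  exact h2.2 hb (h1.2 hb)

end Geo
end geo3

section geo4
open Topology
namespace Geo
variable {Γ : Type} [Group Γ] {G : Geo Γ}

variable (G) in
abbrev S : Type := {s : Γ // G.Adj 1 s}

theorem S_of {a b : Γ} (h : G.Adj a b) : G.Adj 1 (a⁻¹ * b) := by
  have := Adj_L a⁻¹ h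
  rwa [inv_mul_cancel] at this

variable (G) in
def sinv (s : G.S) : G.S := ⟨s.1⁻¹, by simpa using S_of (Adj_symm s.2)⟩

theorem Big_L {z : V3} (γ : Γ) (h : G.Big z) : G.Big (G.L γ z) := by
  intro a b
  obtain ⟨e, he, h1, h2⟩ := h (γ⁻¹ * a) (γ⁻¹ * b)
  refine ⟨γ * e, (N_L γ).2 he, fun h => h1 (by rw [← h]; simp), fun h => h2 (by rw [← h]; simp)⟩

theorem Sc_congr {z z' : V3} (h : G.N z = G.N z') {a b : Γ} (hs : G.Sc z a b) : G.Sc z' a b := by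
  unfold Sc at *; rwa [← h]

variable (G) in
theorem ph_ex (s : G.S) : ∃ t : G.S, ∃ z ∈ CC, G.Big z ∧ G.Sc z 1 s.1 ∧ G.Sc z s.1 (s.1 * t.1) := by
  obtain ⟨z, hz, hb, hs⟩ := Adj_ex s.2
  obtain ⟨a, ha⟩ := Sc_ex hz hs.2.1 hs.1 hs.2.2.1
  exact ⟨⟨s.1⁻¹ * a, S_of (Sc_adj hz ha)⟩, z, hz, hb, hs, by simpa using ha⟩

variable (G) in
noncomputable def ph (s : G.S) : G.S := (G.ph_ex s).choose

theorem ph_spec (s : G.S) : ∃ z ∈ CC, G.Big z ∧ G.Sc z 1 s.1 ∧ G.Sc z s.1 (s.1 * (G.ph s).1) :=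
  (G.ph_ex s).choose_spec

theorem ph_key {z : V3} (hz : z ∈ CC) (hb : G.Big z) {γ a : Γ} {s : G.S} (h1 : G.Sc z γ (γ * s.1))
    (h2 : G.Sc z (γ * s.1) a) : a = γ * s.1 * (G.ph s).1 := by
  obtain ⟨w, hw, hbw, k1, k2⟩ := ph_spec s
  have e1 := Sc_L γ k1
  have e2 := Sc_L γ k2
  rw [mul_one] at e1
  have := N_eq (G.hC γ w hw) hz (Big_L γ hbw) hb e1 h1
  have e3 := Sc_uniq (Sc_congr this e2) h2
  rw [← e3, mul_assoc]

theorem ph_inj : Function.Injective G.ph := by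
  intro s s' h
  obtain ⟨w, hw, hbw, k1, k2⟩ := ph_spec s
  obtain ⟨w', hw', hbw', k1', k2'⟩ := ph_spec s'
  have e1 := Sc_L s.1⁻¹ k1
  have e2 := Sc_L s.1⁻¹ k2
  have e1' := Sc_L s'.1⁻¹ k1'
  have e2' := Sc_L s'.1⁻¹ k2'
  rw [← h] at e2'
  simp only [mul_one, inv_mul_cancel, inv_mul_cancel_left] at e1 e2 e1' e2'
  have := N_eq (G.hC _ w hw) (G.hC _ w' hw') (Big_L _ hbw) (Big_L _ hbw') e2 e2'
  have e3 := Pr_uniq (Sc_congr this e1) e1'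
  exact Subtype.ext (inv_injective e3)

instance : Finite G.S := (G.Sfin).to_subtype

variable (G) in
noncomputable def phi : Equiv.Perm G.S :=
  Equiv.ofBijective G.ph (Finite.injective_iff_bijective.1 ph_inj)

theorem phi_apply (s : G.S) : G.phi s = G.ph s := rfl

variable (G) in
def inc (s : G.S) : Γ := s.1

theorem walk {z : V3} (hz : z ∈ CC) (hb : G.Big z) {γ : Γ} {s : G.S} (h : G.Sc z γ (γ * s.1)) (k : ℕ) :
    G.Sc z (γ * pv G.phi G.inc s k) (γ * pv G.phi G.inc s (k + 1)) := by
  induction k with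
  | zero => simpa [pv, inc] using h
  | succ k ih =>
    obtain ⟨a, ha⟩ := Sc_ex hz ih.2.1 ih.1 ih.2.2.1
    have ih' := ih
    have ha' := ha
    rw [pv_succ, ← mul_assoc] at ih' ha'
    have := ph_key hz hb (s := G.phi^[k] s) ih' ha'
    change a = γ * pv G.phi G.inc s k * G.inc (G.phi^[k] s) * G.inc (G.ph (G.phi^[k] s)) at this
    have e : γ * pv G.phi G.inc s (k + 1 + 1) = a := by
      rw [this, pv_succ, pv_succ, Function.iterate_succ_apply', phi_apply]; simp only [mul_assoc]
    rw [e]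
    exact ha

theorem walk_N {z : V3} (hz : z ∈ CC) (hb : G.Big z) {γ : Γ} {s : G.S} (h : G.Sc z γ (γ * s.1)) :
    Set.range (fun k => γ * pv G.phi G.inc s k) = G.N z := by
  refine Sc_all hz ?_ ⟨_, 0, rfl⟩ ?_
  · rintro _ ⟨k, rfl⟩
    exact (walk hz hb h k).1
  · rintro _ ⟨k, rfl⟩ b hsc
    exact ⟨k + 1, Sc_uniq (walk hz hb h k) hsc⟩

theorem ret {s : G.S} {i k : ℕ} (h : pv G.phi G.inc s i = pv G.phi G.inc s (k + i)) :
    G.phi^[k] s = s ∧ pv G.phi G.inc s k = 1 := by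
  obtain ⟨z, hz, hb, hs⟩ := Adj_ex s.2
  have hw := walk hz hb (γ := 1) (s := s) (by simpa using hs)
  have h1 := hw i
  have h2 := hw (k + i)
  rw [← h] at h2
  have h3 := mul_left_cancel (Sc_uniq h1 h2)
  rw [pv_succ, pv_succ, ← h] at h3
  have h4 : G.phi^[i] s = G.phi^[k + i] s := Subtype.ext (mul_left_cancel h3)
  have h5 : G.phi^[k] s = s := by
    rw [add_comm, Function.iterate_add_apply] at h4
    exact ((G.phi.injective.iterate i) h4).symm
  refine ⟨h5, ?_⟩
  rw [pv_add, h5] at h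
  exact mul_eq_right.1 h.symm

theorem hfin (s : G.S) : ∃ k > 0, G.phi^[k] s = s ∧ pv G.phi G.inc s k = 1 := by
  obtain ⟨z, hz, hb, hs⟩ := Adj_ex s.2
  have hw := walk_N hz hb (γ := 1) (s := s) (by simpa using hs)
  have : (Set.range (fun k => 1 * pv G.phi G.inc s k)).Finite := by rw [hw]; exact G.Nfin hz
  have hni : ¬ Function.Injective (fun k => 1 * pv G.phi G.inc s k) := fun hi =>
    Set.infinite_range_of_injective hi this
  rw [Function.Injective] at hni
  push Not at hni
  obtain ⟨i, j, he, hne⟩ := hni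
  have he' : pv G.phi G.inc s i = pv G.phi G.inc s j := mul_left_cancel he
  rcases lt_or_gt_of_ne hne with h | h
  · obtain ⟨k, rfl⟩ := Nat.exists_eq_add_of_le' h.le
    exact ⟨k, by omega, ret he'⟩
  · obtain ⟨k, rfl⟩ := Nat.exists_eq_add_of_le' h.le
    exact ⟨k, by omega, ret he'.symm⟩

theorem hgen (H : Type) [Group H] (F F' : Γ →* H) (h : ∀ s : G.S, F (G.inc s) = F' (G.inc s)) :
    F = F' := by
  ext γ
  refine G.Adj_all (A := {γ | F γ = F' γ}) ⟨1, by simp⟩ ?_ γ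
  intro a ha b hab
  have h1 := h ⟨_, S_of hab⟩
  simp only [inc, map_mul, map_inv] at h1
  have ha' : F a = F' a := ha
  rw [ha'] at h1
  exact mul_left_cancel h1

theorem pv_v {H : Type} [Group H] {v : G.S → H}
    (hv : ∀ s k, G.phi^[k] s = s → pv G.phi G.inc s k = 1 → pv G.phi v s k = 1) {s : G.S} {i j : ℕ}
    (h : pv G.phi G.inc s i = pv G.phi G.inc s j) : pv G.phi v s i = pv G.phi v s j := by
  have key : ∀ i k, pv G.phi G.inc s i = pv G.phi G.inc s (k + i) →
      pv G.phi v s i = pv G.phi v s (k + i) := by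
    intro i k h
    obtain ⟨h1, h2⟩ := ret h
    rw [pv_add, h1, hv s k h1 h2, one_mul]
  rcases le_total i j with h' | h'
  · obtain ⟨k, rfl⟩ := Nat.exists_eq_add_of_le' h'
    exact key i k h
  · obtain ⟨k, rfl⟩ := Nat.exists_eq_add_of_le' h'
    exact (key j k h.symm).symm

end Geo
end geo4

section geo5
open Topology
namespace Geo
variable {Γ : Type} [Group Γ] {G : Geo Γ}

theorem pot {H : Type} [Group H] {v : G.S → H} (hi : ∀ s, v (G.sinv s) = (v s)⁻¹)
    (hv : ∀ s k, G.phi^[k] s = s → pv G.phi G.inc s k = 1 → pv G.phi v s k = 1)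
    {z : V3} (hz : z ∈ CC) : ∃ f : Γ → H, ∀ γ ∈ G.N z, ∀ δ ∈ G.N z, ∀ h : G.Adj γ δ,
      f δ = f γ * v ⟨γ⁻¹ * δ, S_of h⟩ := by
  classical
  suffices hS : ∃ f : Γ → H, ∀ γ ∈ G.N z, ∀ δ ∈ G.N z, ∀ h : G.Adj γ δ, G.Sc z γ δ →
      f δ = f γ * v ⟨γ⁻¹ * δ, S_of h⟩ by
    obtain ⟨f, hf⟩ := hS
    refine ⟨f, fun γ hγ δ hδ h => ?_⟩
    rcases Adj_Sc hz h hγ hδ with h1 | h1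
    · exact hf γ hγ δ hδ h h1
    · have h2 := hf δ hδ γ hγ (Adj_symm h) h1
      have h3 := hi ⟨γ⁻¹ * δ, S_of h⟩
      have h4 : G.sinv ⟨γ⁻¹ * δ, S_of h⟩ = ⟨δ⁻¹ * γ, S_of (Adj_symm h)⟩ :=
        Subtype.ext (by simp [sinv])
      rw [h4] at h3
      rw [h2, h3]; group
  obtain ⟨a, ha⟩ := G.exmin hz
  by_cases hb : G.Big z
  · obtain ⟨e, he, hne, _⟩ := hb a a
    obtain ⟨b, hab⟩ := Sc_ex hz ha he hne
    set s : G.S := ⟨a⁻¹ * b, S_of (Sc_adj hz hab)⟩ with hs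
    have hsc : G.Sc z a (a * s.1) := by simpa [hs] using hab
    have hN := walk_N hz hb hsc
    have hw := walk hz hb hsc
    let f : Γ → H := fun γ => if h : ∃ k, a * pv G.phi G.inc s k = γ then pv G.phi v s h.choose else 1
    have hf : ∀ k, f (a * pv G.phi G.inc s k) = pv G.phi v s k := by
      intro k
      have h : ∃ k', a * pv G.phi G.inc s k' = a * pv G.phi G.inc s k := ⟨k, rfl⟩
      simp only [f, h, dif_pos]
      exact pv_v hv (mul_left_cancel h.choose_spec)
    refine ⟨f, fun γ hγ δ hδ hadj hsc' => ?_⟩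
    rw [← hN] at hγ
    obtain ⟨k, rfl⟩ := hγ
    have e := Sc_uniq hsc' (hw k)
    subst e
    have e2 : (⟨_, S_of hadj⟩ : G.S) = G.phi^[k] s := by
      apply Subtype.ext
      show (a * pv G.phi G.inc s k)⁻¹ * (a * pv G.phi G.inc s (k + 1)) = G.inc (G.phi^[k] s)
      rw [pv_succ]; group
    rw [e2]
    show f _ = f (a * pv G.phi G.inc s k) * _
    rw [hf, hf, pv_succ]
  · unfold Big at hb
    push Not at hb
    obtain ⟨p, q, hpq⟩ := hb
    let f : Γ → H := fun γ => if γ = p then 1 else if h : G.Adj p q then v ⟨p⁻¹ * q, S_of h⟩ else 1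
    refine ⟨f, fun γ hγ δ hδ hadj _ => ?_⟩
    have h1 : γ = p ∨ γ = q := by
      by_contra hcon; push Not at hcon; exact hcon.2 (hpq γ hγ hcon.1)
    have h2 : δ = p ∨ δ = q := by
      by_contra hcon; push Not at hcon; exact hcon.2 (hpq δ hδ hcon.1)
    rcases h1 with rfl | rfl <;> rcases h2 with rfl | rfl
    · exact absurd rfl hadj.1
    · simp [f, hadj.1.symm, hadj]
    · have hadj' := Adj_symm hadj
      have h3 := hi ⟨δ⁻¹ * γ, S_of hadj'⟩
      have h4 : G.sinv ⟨δ⁻¹ * γ, S_of hadj'⟩ = ⟨γ⁻¹ * δ, S_of hadj⟩ :=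
        Subtype.ext (by simp [sinv])
      rw [h4] at h3
      simp [f, hadj.1, hadj', h3]
    · exact absurd rfl hadj.1

theorem hext (H : Type) [Group H] (v : G.S → H) (hi : ∀ s, v (G.sinv s) = (v s)⁻¹)
    (hv : ∀ s k, G.phi^[k] s = s → pv G.phi G.inc s k = 1 → pv G.phi v s k = 1) :
    ∃ F : Γ →* H, ∀ s, F (G.inc s) = v s := by
  have hp : ∀ z : CC, ∃ f : Γ → H, ∀ γ ∈ G.N z.1, ∀ δ ∈ G.N z.1, ∀ h : G.Adj γ δ,
      f δ = f γ * v ⟨γ⁻¹ * δ, S_of h⟩ := fun z => pot hi hv z.2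
  choose f hf using hp
  have : ContractibleSpace CC := CC_convex.contractibleSpace ⟨G.x 1, G.xC 1⟩
  have : LocallyPathConnectedSpace CC := CC_open.locallyPathConnectedSpace
  have hh1 : ∀ z w : CC, G.N w.1 ⊆ G.N z.1 → ∃ h, ∀ γ ∈ G.N w.1, f z γ = h * f w γ := by
    intro z w hsub
    obtain ⟨a, ha⟩ := G.exmin w.2
    refine ⟨f z a * (f w a)⁻¹, ?_⟩
    suffices this : {γ | γ ∈ G.N w.1 ∧ f z γ = f z a * (f w a)⁻¹ * f w γ} = G.N w.1 by
      intro γ hγ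
      rw [← this] at hγ
      exact hγ.2
    refine Sc_all w.2 (fun γ h => h.1) ⟨a, ha, by group⟩ ?_
    · rintro γ ⟨h1, h2⟩ δ hδ
      refine ⟨hδ.2.1, ?_⟩
      have hadj := Sc_adj w.2 hδ
      rw [hf z γ (hsub h1) δ (hsub hδ.2.1) hadj, hf w γ h1 δ hδ.2.1 hadj, h2]
      group
  have hh2 : ∀ γ, IsPreconnected {y : CC | γ ∈ G.N y.1} := by
    intro γ
    rw [← Topology.IsInducing.subtypeVal.isPreconnected_image]
    have : Subtype.val '' {y : CC | γ ∈ G.N y.1} = {z | z ∈ CC ∧ γ ∈ G.N z} := by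
      ext z; constructor
      · rintro ⟨y, hy, rfl⟩; exact ⟨y.2, hy⟩
      · rintro ⟨h1, h2⟩; exact ⟨⟨z, h1⟩, h2, rfl⟩
    rw [this]
    apply Convex.isPreconnected
    intro p hp q hq a b ha hb hab
    refine ⟨CC_convex hp.1 hq.1 ha hb hab, fun δ => ?_⟩
    simp only [BB_add, BB_smul]
    have h1 := hp.2 δ
    have h2 := hq.2 δ
    exact add_le_add (mul_le_mul_of_nonneg_left h1 ha) (mul_le_mul_of_nonneg_left h2 hb)
  obtain ⟨F, hF⟩ := glue (X := CC) (fun z => G.N z.1) (fun z => G.exmin z.2)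
    (fun z => continuous_subtype_val.continuousAt.eventually (G.usc z.2)) f hh1 hh2
  have key : ∀ γ (s : G.S), F (γ * s.1) = F γ * v s := by
    intro γ s
    have hadj : G.Adj γ (γ * s.1) := by simpa using Adj_L γ s.2
    have hadj' := hadj
    obtain ⟨_, w, hw, hN⟩ := hadj'
    obtain ⟨h, hh⟩ := hF ⟨w, hw⟩
    have h1 : γ ∈ G.N w := by simp [hN]
    have h2 : γ * s.1 ∈ G.N w := by simp [hN]
    rw [hh _ h1, hh _ h2, hf ⟨w, hw⟩ γ h1 _ h2 hadj]
    have : (⟨γ⁻¹ * (γ * s.1), S_of hadj⟩ : G.S) = s := Subtype.ext (by simp)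
    rw [this, mul_assoc]
  have hmul : ∀ γ δ, F (γ * δ) = F γ * (F 1)⁻¹ * F δ := by
    intro γ δ
    refine G.Adj_all (A := {δ | F (γ * δ) = F γ * (F 1)⁻¹ * F δ}) ⟨1, by simp⟩ ?_ δ
    intro a ha b hab
    have ha' : F (γ * a) = F γ * (F 1)⁻¹ * F a := ha
    have h1 := key a ⟨_, S_of hab⟩
    have h2 := key (γ * a) ⟨_, S_of hab⟩
    rw [ha', mul_assoc _ (F a), ← h1] at h2
    simpa [mul_assoc] using h2
  refine ⟨MonoidHom.mk' (fun γ => (F 1)⁻¹ * F γ) fun a b => ?_, fun s => ?_⟩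
  · rw [hmul]; group
  · have := key 1 s
    simp only [one_mul] at this
    simp [inc, this]

end Geo
end geo5

section geo6
open Topology
namespace Geo
variable {Γ : Type} [Group Γ] {G : Geo Γ}

theorem sinv_sinv (s : G.S) : G.sinv (G.sinv s) = s := Subtype.ext (by simp [sinv])

theorem tau_back (P : G.S → Prop) (hP : ∀ t, P t → P (G.phi (G.sinv t))) (t : G.S)
    (h : P (G.phi (G.sinv t))) : P t := by
  let si : Equiv.Perm G.S := ⟨G.sinv, G.sinv, sinv_sinv, sinv_sinv⟩
  let τ : Equiv.Perm G.S := G.phi * si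
  have h1 : ∀ (k : ℕ) t, P t → P ((τ ^ k) t) := by
    intro k
    induction k with
    | zero => intro t h; exact h
    | succ k ih => intro t h; rw [pow_succ]; exact ih _ (hP t h)
  have h2 : 0 < orderOf τ := orderOf_pos τ
  have h3 := h1 (orderOf τ - 1) _ h
  have h4 : (τ ^ (orderOf τ - 1)) (G.phi (G.sinv t)) = t := by
    change (τ ^ (orderOf τ - 1) * τ) t = t
    rw [← pow_succ, Nat.sub_add_cancel h2, pow_orderOf_eq_one]; rfl
  rwa [h4] at h3

variable (G) in
noncomputable def uu (p : ℝ × ℝ) : V3 :=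
  (p.1 * (G.x 1).1, p.2 * (G.x 1).1, - p.1 * (G.x 1).2.2 + 2 * p.2 * (G.x 1).2.1)

theorem uu_perp (p : ℝ × ℝ) : BB (G.uu p) (G.x 1) = 0 := by simp only [uu, BB]; ring

theorem uu_ne {p : ℝ × ℝ} (hp : p ≠ 0) : G.uu p ≠ 0 := by
  intro h
  have hx := (G.xC 1).1.ne'
  simp only [uu, Prod.mk_eq_zero, mul_eq_zero, hx, or_false] at h
  exact hp (Prod.ext h.1 h.2.1)

theorem uu_surj {u : V3} (hu : u ≠ 0) (h : BB u (G.x 1) = 0) : ∃ p ∈ ({0}ᶜ : Set (ℝ × ℝ)), G.uu p = u := by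
  have hx := (G.xC 1).1.ne'
  have e : G.uu (u.1 / (G.x 1).1, u.2.1 / (G.x 1).1) = u := by
    simp only [BB] at h
    refine Prod.ext (div_mul_cancel₀ _ hx) (Prod.ext (div_mul_cancel₀ _ hx) ?_)
    simp only [uu]
    field_simp
    linarith
  refine ⟨_, ?_, e⟩
  intro h0
  rw [h0] at e
  exact hu (by rw [← e]; simp [uu])

variable (G) in
noncomputable def ff (s : G.S) (p : ℝ × ℝ) : ℝ :=
  - BB (G.uu p) (G.x s.1) / (BB (G.x 1) (G.x s.1) - 1)

theorem cpos (s : G.S) : 0 < BB (G.x 1) (G.x s.1) - 1 :=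
  sub_pos.2 (BB_ge_one (G.xC _) (G.xC _) (G.xQ _) (G.xQ _) (G.xi.ne s.2.1))

theorem ff_y (s : G.S) (p : ℝ × ℝ) (t : ℝ) : BB (G.x 1 + t • G.uu p) (G.x s.1) =
    1 + (BB (G.x 1) (G.x s.1) - 1) * (1 - t * G.ff s p) := by
  have := (cpos s).ne'
  rw [BB_add, BB_smul, ff]; field_simp; ring

theorem ff_cont (s : G.S) : Continuous (G.ff s) := by
  unfold ff
  exact (BB_cont (by unfold uu; fun_prop) continuous_const).neg.div_const _

theorem ff_closed (P : G.S → Prop) : IsClosed {p | ∃ s, P s ∧ ∀ d, G.ff d p ≤ G.ff s p} := by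
  have : {p | ∃ s, P s ∧ ∀ d, G.ff d p ≤ G.ff s p} =
      ⋃ s ∈ {s | P s}, ⋂ d, {p | G.ff d p ≤ G.ff s p} := by ext p; simp
  rw [this]
  exact (Set.toFinite _).isClosed_biUnion fun s _ => isClosed_iInter fun d =>
    isClosed_le (ff_cont d) (ff_cont s)

theorem ff_ne (s : G.S) : ∃ p ∈ ({0}ᶜ : Set (ℝ × ℝ)), ∀ d, G.ff d p ≤ G.ff s p := by
  obtain ⟨_, w, hw, hN⟩ := s.2
  have w1 : 1 ∈ G.N w := by simp [hN]
  have ws : s.1 ∈ G.N w := by simp [hN]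
  have h := BB_pos hw (G.xC 1)
  set u : V3 := (1 / BB w (G.x 1)) • w + (-1 : ℝ) • G.x 1 with hu
  have hb : ∀ γ, BB u (G.x γ) = BB w (G.x γ) / BB w (G.x 1) - BB (G.x 1) (G.x γ) := by
    intro γ; rw [hu, BB_add, BB_smul, BB_smul]; ring
  have hp : BB u (G.x 1) = 0 := by rw [hb, G.xQ, div_self h.ne', sub_self]
  have hs : BB u (G.x s.1) = 1 - BB (G.x 1) (G.x s.1) := by
    rw [hb, Neq ws w1, div_self h.ne']
  have hne : u ≠ 0 := by
    intro h0
    rw [h0] at hs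
    have := cpos s
    simp [BB] at hs this
    linarith
  obtain ⟨p, hp0, hpu⟩ := uu_surj hne hp
  refine ⟨p, hp0, fun d => ?_⟩
  have e1 : G.ff s p = 1 := by
    unfold ff; rw [hpu, hs, neg_sub, div_self (cpos s).ne']
  rw [e1]; unfold ff
  rw [hpu, div_le_one (cpos d), hb]
  have : 1 ≤ BB w (G.x d.1) / BB w (G.x 1) := by rw [le_div_iff₀ h, one_mul]; exact w1 d.1
  linarith

theorem conn (P : G.S → Prop) (hP : ∀ t, P t → P (G.phi (G.sinv t))) (hex : ∃ t, P t) : ∀ t, P t := by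
  by_contra hcon
  push Not at hcon
  obtain ⟨s0, h0⟩ := hcon
  obtain ⟨s1, h1⟩ := hex
  have hpre : IsPreconnected ({0}ᶜ : Set (ℝ × ℝ)) :=
    (isConnected_compl_singleton_of_one_lt_rank
      (Module.lt_rank_of_lt_finrank (by simp)) (0 : ℝ × ℝ)).isPreconnected
  rw [isPreconnected_closed_iff] at hpre
  have hcov : ({0}ᶜ : Set (ℝ × ℝ)) ⊆ {p | ∃ s, P s ∧ ∀ d, G.ff d p ≤ G.ff s p} ∪
      {p | ∃ s, ¬ P s ∧ ∀ d, G.ff d p ≤ G.ff s p} := by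
    intro p _
    have : Nonempty G.S := ⟨s0⟩
    obtain ⟨s, hs⟩ := Finite.exists_max (fun d => G.ff d p)
    by_cases h : P s
    · exact Or.inl ⟨s, h, hs⟩
    · exact Or.inr ⟨s, h, hs⟩
  obtain ⟨p1, hp1, hp1'⟩ := ff_ne s1
  obtain ⟨p0, hp0, hp0'⟩ := ff_ne s0
  obtain ⟨p, hp, ⟨s, hs, hsm⟩, ⟨s', hs', hsm'⟩⟩ := hpre _ _ (ff_closed P) (ff_closed fun s => ¬ P s) hcov
    ⟨p1, hp1, s1, h1, hp1'⟩ ⟨p0, hp0, s0, h0, hp0'⟩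
  obtain ⟨t, t0, hy, hy1, ε, hε, hεn⟩ := G.exit (w := G.x 1) (γ := 1) (G.xC 1) (by rw [N_x]; rfl)
    (uu_ne hp) (uu_perp p)
  have hε1 : ε ≠ 1 := by
    rintro rfl
    rw [uu_perp] at hεn
    exact lt_irrefl _ hεn
  obtain ⟨b, hb⟩ := Sc_ex hy hy1 hε hε1
  have bS : G.Adj 1 b := Sc_adj hy hb
  have y1 : BB (G.x 1 + t • G.uu p) (G.x 1) = 1 := by
    rw [BB_add, BB_smul, uu_perp, G.xQ]; ring
  have yb := Neq hy1 hb.2.1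
  rw [y1, ff_y ⟨b, bS⟩] at yb
  have tb : t * G.ff ⟨b, bS⟩ p = 1 := by
    have := (mul_eq_zero.1 (by linarith : (BB (G.x 1) (G.x b) - 1) * (1 - t * G.ff ⟨b, bS⟩ p) = 0)).resolve_left
      (cpos ⟨b, bS⟩).ne'
    linarith
  have mem : ∀ s : G.S, (∀ d, G.ff d p ≤ G.ff s p) → s.1 ∈ G.N (G.x 1 + t • G.uu p) := by
    intro s hs δ
    have e1 : 1 ≤ t * G.ff s p := by
      rw [← tb]; exact mul_le_mul_of_nonneg_left (hs _) t0
    have e2 := hy1 δ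
    rw [y1] at e2
    rw [ff_y s]
    nlinarith [mul_nonneg (cpos s).le (by linarith : 0 ≤ t * G.ff s p - 1)]
  have ms := mem s hsm
  have ms' := mem s' hsm'
  have hne : s.1 ≠ s'.1 := by
    intro h; rw [Subtype.ext h] at hs; exact hs' hs
  have hbig : G.Big (G.x 1 + t • G.uu p) := Big_of hy1 ms ms' s.2.1 s'.2.1 hne
  have key : ∀ s s' : G.S, G.Sc (G.x 1 + t • G.uu p) s.1 1 → G.Sc (G.x 1 + t • G.uu p) 1 s'.1 →
      s' = G.phi (G.sinv s) := by
    intro s s' a1 a2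
    have := ph_key hy hbig (γ := s.1) (s := G.sinv s) (a := s'.1) (by simpa [sinv] using a1)
      (by simpa [sinv] using a2)
    apply Subtype.ext
    rw [this, phi_apply]
    simp [sinv]
  rcases Adj_Sc hy s.2 hy1 ms with a | a <;> rcases Adj_Sc hy s'.2 hy1 ms' with a' | a'
  · exact hne (Sc_uniq a a')
  · have := key _ _ a' a
    exact hs' (tau_back P hP s' (this ▸ hs))
  · have := key _ _ a a'
    exact hs' (this ▸ hP s hs)
  · exact hne (Pr_uniq a a')

theorem main (G : Geo Γ) : ∃ (g r : ℕ) (ν : Fin r → ℕ), (∀ j, 2 ≤ ν j) ∧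
    Nonempty (Γ ≃* FuchsianGroup g r ν) :=
  bridge G.inc G.sinv sinv_sinv (fun _ => rfl) G.phi conn hfin hext hgen

end Geo
end geo6

section psl
open Topology

theorem SL_ind : IsInducing (fun g : SL2R => (g : Matrix (Fin 2) (Fin 2) ℝ)) := ⟨rfl⟩

theorem SL_emb : IsEmbedding (fun g : SL2R => (g : Matrix (Fin 2) (Fin 2) ℝ)) :=
  ⟨SL_ind, Subtype.val_injective⟩

instance : IsTopologicalGroup SL2R where
  continuous_mul := by
    rw [SL_ind.continuous_iff]
    exact (SL_ind.continuous.comp continuous_fst).mul (SL_ind.continuous.comp continuous_snd)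
  continuous_inv := by
    rw [SL_ind.continuous_iff]
    have : Continuous fun g : SL2R => (g : Matrix (Fin 2) (Fin 2) ℝ).adjugate :=
      SL_ind.continuous.matrix_adjugate
    exact this.congr fun g => (Matrix.SpecialLinearGroup.coe_inv g).symm

instance : T2Space SL2R := SL_emb.t2Space

instance : IsClosed (Subgroup.center SL2R : Set SL2R) := by
  have := Set.isClosed_centralizer (Set.univ : Set SL2R)
  rwa [Set.centralizer_univ] at this

instance : T2Space PSL2R := inferInstance
instance : IsTopologicalGroup PSL2R := inferInstance

def act (g : SL2R) (X : V3) : V3 :=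
  (g.1 0 0 ^ 2 * X.1 + 2 * g.1 0 0 * g.1 0 1 * X.2.1 + g.1 0 1 ^ 2 * X.2.2,
   g.1 0 0 * g.1 1 0 * X.1 + (g.1 0 0 * g.1 1 1 + g.1 0 1 * g.1 1 0) * X.2.1 + g.1 0 1 * g.1 1 1 * X.2.2,
   g.1 1 0 ^ 2 * X.1 + 2 * g.1 1 0 * g.1 1 1 * X.2.1 + g.1 1 1 ^ 2 * X.2.2)

theorem dt1 (g : SL2R) : g.1 0 0 * g.1 1 1 - g.1 0 1 * g.1 1 0 = 1 := by
  have := g.2; rwa [Matrix.det_fin_two] at this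

theorem act_mul (g h : SL2R) (X : V3) : act (g * h) X = act g (act h X) := by
  have e : (g * h).1 = g.1 * h.1 := rfl
  simp only [act, e, Matrix.mul_apply, Fin.sum_univ_two, Prod.mk.injEq]
  refine ⟨?_, ?_, ?_⟩ <;> ring

theorem act_one (X : V3) : act 1 X = X := by
  have e : (1 : SL2R).1 = 1 := rfl
  simp [act, e]

theorem act_BB (g : SL2R) (X Y : V3) : BB (act g X) (act g Y) = BB X Y := by
  have h := dt1 g
  simp only [act, BB]
  generalize g.1 0 0 = p at *
  generalize g.1 0 1 = q at *
  generalize g.1 1 0 = r at *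
  generalize g.1 1 1 = s at *
  linear_combination ((X.1 * Y.2.2 + X.2.2 * Y.1) / 2 - X.2.1 * Y.2.1) * (p * s - q * r + 1) * h

theorem act_dt (g : SL2R) (X Y Z : V3) : dt (act g X) (act g Y) (act g Z) = dt X Y Z := by
  have h := dt1 g
  have e : dt (act g X) (act g Y) (act g Z) =
      (g.1 0 0 * g.1 1 1 - g.1 0 1 * g.1 1 0) ^ 3 * dt X Y Z := by
    simp only [act, dt]
    generalize g.1 0 0 = p at *
    generalize g.1 0 1 = q at *
    generalize g.1 1 0 = r at *
    generalize g.1 1 1 = s at *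
    ring
  rw [e, h]; ring

theorem act_CC (g : SL2R) {X : V3} (hX : X ∈ CC) : act g X ∈ CC := by
  refine ⟨?_, by rw [act_BB]; exact hX.2⟩
  have h := dt1 g
  obtain ⟨h1, h2⟩ := hX
  simp only [act, BB] at *
  generalize g.1 0 0 = p at *
  generalize g.1 0 1 = q at *
  have h3 : 0 < X.1 * X.2.2 - X.2.1 ^ 2 := by linarith
  have e : X.1 * (p ^ 2 * X.1 + 2 * p * q * X.2.1 + q ^ 2 * X.2.2) =
    (p * X.1 + q * X.2.1) ^ 2 + q ^ 2 * (X.1 * X.2.2 - X.2.1 ^ 2) := by ring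
  have : 0 < X.1 * (p ^ 2 * X.1 + 2 * p * q * X.2.1 + q ^ 2 * X.2.2) := by
    rw [e]
    by_cases hq : q = 0
    · subst hq
      have hp : p ≠ 0 := by rintro rfl; simp at h
      have : 0 < (p * X.1) ^ 2 := by positivity
      simpa using this
    · have : 0 < q ^ 2 * (X.1 * X.2.2 - X.2.1 ^ 2) := by positivity
      positivity
  exact pos_of_mul_pos_right this h1.le

theorem act_center {g : SL2R} (hg : g ∈ Subgroup.center SL2R) (X : V3) : act g X = X := by
  obtain ⟨r, hr, e⟩ := Matrix.SpecialLinearGroup.mem_center_iff.1 hg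
  have e' : g.1 = Matrix.scalar (Fin 2) r := e.symm
  have hr' : r ^ 2 = 1 := by simpa using hr
  have hr2 : r * r = 1 := by rw [← sq]; exact hr'
  simp [act, e', Matrix.scalar_apply, Matrix.diagonal, hr', hr2]

theorem center_of {g : SL2R} (h1 : g.1 0 1 = 0) (h2 : g.1 1 0 = 0) (h3 : g.1 1 1 = g.1 0 0) :
    g ∈ Subgroup.center SL2R := by
  refine Matrix.SpecialLinearGroup.mem_center_iff.2 ⟨g.1 0 0, ?_, ?_⟩
  · have := dt1 g
    rw [h1, h3] at this
    rw [Fintype.card_fin]; linear_combination this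
  · ext i j
    fin_cases i <;> fin_cases j <;> simp [Matrix.scalar_apply, h1, h2, h3]

def rho : SL2R →* Function.End V3 where
  toFun := act
  map_one' := funext act_one
  map_mul' g h := funext (act_mul g h)

def pact : PSL2R →* Function.End V3 :=
  QuotientGroup.lift _ rho fun g hg => funext (act_center hg)

def pa (g : PSL2R) (X : V3) : V3 := pact g X

theorem pa_mk (g : SL2R) (X : V3) : pa (g : PSL2R) X = act g X := rfl

theorem pa_mul (g h : PSL2R) (X : V3) : pa (g * h) X = pa g (pa h X) := by
  unfold pa; rw [map_mul]; rfl

theorem pa_one (X : V3) : pa 1 X = X := by unfold pa; rw [map_one]; rfl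

theorem pa_BB (g : PSL2R) (X Y : V3) : BB (pa g X) (pa g Y) = BB X Y := by
  obtain ⟨g, rfl⟩ := QuotientGroup.mk_surjective g; exact act_BB g X Y

theorem pa_dt (g : PSL2R) (X Y Z : V3) : dt (pa g X) (pa g Y) (pa g Z) = dt X Y Z := by
  obtain ⟨g, rfl⟩ := QuotientGroup.mk_surjective g; exact act_dt g X Y Z

theorem pa_CC (g : PSL2R) {X : V3} (hX : X ∈ CC) : pa g X ∈ CC := by
  obtain ⟨g, rfl⟩ := QuotientGroup.mk_surjective g; exact act_CC g hX

/-- the base point -/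
def II : V3 := (1, 0, 1)

theorem II_Q : BB II II = 1 := by simp [BB, II]
theorem II_C : II ∈ CC := ⟨by simp [II], by simp [II_Q]⟩

theorem BB_II (g : SL2R) : BB II (act g II) =
    (g.1 0 0 ^ 2 + g.1 0 1 ^ 2 + g.1 1 0 ^ 2 + g.1 1 1 ^ 2) / 2 := by
  simp [BB, II, act]; ring

theorem ent_cont (i j : Fin 2) : Continuous fun g : SL2R => g.1 i j :=
  (continuous_id.matrix_elem i j).comp SL_ind.continuous

theorem BB_II_cont : Continuous fun g : PSL2R => BB II (pa g II) := by
  rw [(QuotientGroup.isQuotientMap_mk _).continuous_iff]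
  have : Continuous fun g : SL2R => (g.1 0 0 ^ 2 + g.1 0 1 ^ 2 + g.1 1 0 ^ 2 + g.1 1 1 ^ 2) / 2 := by
    have h1 := ent_cont 0 0
    have h2 := ent_cont 0 1
    have h3 := ent_cont 1 0
    have h4 := ent_cont 1 1
    fun_prop
  exact this.congr fun g => (BB_II g).symm

theorem K_cpt (R : ℝ) : IsCompact {g : SL2R | BB II (act g II) ≤ R} := by
  rw [SL_ind.isCompact_iff]
  have hB : IsCompact {M : Matrix (Fin 2) (Fin 2) ℝ | ∀ i j, M i j ∈ Set.Icc (-(2 * R + 1)) (2 * R + 1)} := by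
    have : IsCompact (Set.univ.pi fun _ : Fin 2 => Set.univ.pi fun _ : Fin 2 =>
      Set.Icc (-(2 * R + 1)) (2 * R + 1)) :=
      isCompact_univ_pi fun _ => isCompact_univ_pi fun _ => isCompact_Icc
    have e : {M : Matrix (Fin 2) (Fin 2) ℝ | ∀ i j, M i j ∈ Set.Icc (-(2 * R + 1)) (2 * R + 1)} =
      (Set.univ.pi fun _ : Fin 2 => Set.univ.pi fun _ : Fin 2 =>
      Set.Icc (-(2 * R + 1)) (2 * R + 1)) :=
      Set.ext fun M => ⟨fun h i _ j _ => h i j, fun h i j => h i trivial j trivial⟩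
    rw [e]; exact this
  refine hB.of_isClosed_subset ?_ ?_
  · have : (fun g : SL2R => (g : Matrix (Fin 2) (Fin 2) ℝ)) '' {g : SL2R | BB II (act g II) ≤ R} =
        {M | M.det = 1} ∩ {M | (M 0 0 ^ 2 + M 0 1 ^ 2 + M 1 0 ^ 2 + M 1 1 ^ 2) / 2 ≤ R} := by
      ext M
      constructor
      · rintro ⟨g, hg, rfl⟩
        refine ⟨g.2, ?_⟩
        have hg' : BB II (act g II) ≤ R := hg
        rw [BB_II] at hg'
        exact hg'
      · rintro ⟨h1, h2⟩
        have h1' : M.det = 1 := h1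
        exact ⟨⟨M, h1'⟩, (BB_II ⟨M, h1'⟩).trans_le h2, rfl⟩
    rw [this]
    refine IsClosed.inter (isClosed_eq (continuous_id.matrix_det) continuous_const)
      (isClosed_le ?_ continuous_const)
    have h : ∀ i j : Fin 2, Continuous fun M : Matrix (Fin 2) (Fin 2) ℝ => M i j :=
      fun i j => continuous_id.matrix_elem i j
    have h1 := h 0 0
    have h2 := h 0 1
    have h3 := h 1 0
    have h4 := h 1 1
    fun_prop
  · rintro _ ⟨g, hg, rfl⟩
    have hg' : BB II (act g II) ≤ R := hg
    rw [BB_II] at hg'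
    have key : ∀ a : ℝ, a ^ 2 ≤ 2 * R → a ∈ Set.Icc (-(2 * R + 1)) (2 * R + 1) := by
      intro a ha
      constructor <;> nlinarith [sq_nonneg (a - 1), sq_nonneg (a + 1)]
    have s1 := sq_nonneg (g.1 0 0)
    have s2 := sq_nonneg (g.1 0 1)
    have s3 := sq_nonneg (g.1 1 0)
    have s4 := sq_nonneg (g.1 1 1)
    intro i j
    apply key
    fin_cases i <;> fin_cases j <;> simp <;> linarith

variable (Γ : Subgroup PSL2R)

theorem prop0 (hd : DiscreteTopology Γ) (R : ℝ) : {γ : Γ | BB II (pa γ.1 II) ≤ R}.Finite := by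
  have hK : IsCompact ((fun g : SL2R => (g : PSL2R)) '' {g : SL2R | BB II (act g II) ≤ R}) :=
    (K_cpt R).image QuotientGroup.continuous_mk
  have hcl : IsClosed (Γ : Set PSL2R) := Subgroup.isClosed_of_discrete
  have h1 : IsCompact (Subtype.val ⁻¹' ((fun g : SL2R => (g : PSL2R)) '' {g : SL2R | BB II (act g II) ≤ R}) : Set Γ) :=
    hcl.isClosedEmbedding_subtypeVal.isCompact_preimage hK
  refine h1.finite_of_discrete.subset ?_
  rintro ⟨γ, hγ⟩ h
  obtain ⟨g, rfl⟩ := QuotientGroup.mk_surjective γ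
  exact ⟨g, h, rfl⟩

theorem ctbl (hd : DiscreteTopology Γ) : Countable Γ := by
  rw [← Set.countable_univ_iff]
  have : (Set.univ : Set Γ) = ⋃ n : ℕ, {γ : Γ | BB II (pa γ.1 II) ≤ n} := by
    ext γ
    simpa using exists_nat_ge _
  rw [this]
  exact Set.countable_iUnion fun n => (prop0 Γ hd n).countable

noncomputable def Xt (t : ℝ) : V3 := (1, t, 1 + t ^ 2)

theorem Xt_Q (t : ℝ) : BB (Xt t) (Xt t) = 1 := by simp only [BB, Xt]; ring
theorem Xt_C (t : ℝ) : Xt t ∈ CC := ⟨by simp [Xt], by simp [Xt_Q]⟩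

theorem stab {g : PSL2R} (hg : g ≠ 1) : {t | pa g (Xt t) = Xt t}.Subsingleton := by
  obtain ⟨g, rfl⟩ := QuotientGroup.mk_surjective g
  have key : ∀ t, pa (g : PSL2R) (Xt t) = Xt t → g.1 1 1 - g.1 0 0 = 2 * g.1 0 1 * t ∧
      g.1 1 0 = - g.1 0 1 * (1 + t ^ 2) := by
    intro t h
    have hdet := dt1 g
    rw [pa_mk] at h
    simp only [act, Xt, Prod.mk.injEq] at h
    obtain ⟨e1, e2, e3⟩ := h
    generalize g.1 0 0 = p at *
    generalize g.1 0 1 = q at *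
    generalize g.1 1 0 = r at *
    generalize g.1 1 1 = s at *
    constructor
    · linear_combination q * e2 - s * e1 + (p + q * t) * hdet
    · linear_combination s * e2 - q * e3 - (r + s * t) * hdet
  intro t ht t' ht'
  obtain ⟨k1, k2⟩ := key t ht
  obtain ⟨k1', _⟩ := key t' ht'
  have hq : g.1 0 1 ≠ 0 := by
    intro h0
    apply hg
    rw [QuotientGroup.eq_one_iff]
    rw [h0] at k1 k2
    exact center_of h0 (by simpa using k2) (by linarith)
  have : 2 * g.1 0 1 * (t - t') = 0 := by linarith
  have := (mul_eq_zero.1 this).resolve_left (by simpa using hq)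
  linarith

theorem gen_t (hd : DiscreteTopology Γ) : ∃ t, ∀ γ : Γ, pa γ.1 (Xt t) = Xt t → γ = 1 := by
  have := ctbl Γ hd
  have hc : (⋃ γ : {γ : Γ // γ ≠ 1}, {t | pa γ.1.1 (Xt t) = Xt t}).Countable :=
    Set.countable_iUnion fun γ => (stab (fun h => γ.2 (Subtype.ext h))).finite.countable
  obtain ⟨t, ht⟩ := (hc.dense_compl ℝ).nonempty
  refine ⟨t, fun γ hγ => ?_⟩
  by_contra hne
  exact ht (Set.mem_iUnion.2 ⟨⟨γ, hne⟩, hγ⟩)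

theorem cov (hc : CompactSpace (PSL2R ⧸ Γ)) : ∃ n : ℕ, ∀ g : PSL2R, ∃ γ : Γ, BB II (pa (g * γ.1) II) < n := by
  let U : ℕ → Set PSL2R := fun n => {g | BB II (pa g II) < n}
  have hU : ∀ n, IsOpen (U n) := fun n => isOpen_lt BB_II_cont continuous_const
  let V : ℕ → Set (PSL2R ⧸ Γ) := fun n => (fun g : PSL2R => (g : PSL2R ⧸ Γ)) '' U n
  have hV : ∀ n, IsOpen (V n) := fun n => QuotientGroup.isOpenMap_coe _ (hU n)
  have hmono : Monotone V := by
    intro m n hmn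
    refine Set.image_mono fun g hg => ?_
    have h : BB II (pa g II) < m := hg
    have : (m : ℝ) ≤ n := by exact_mod_cast hmn
    exact lt_of_lt_of_le h this
  have hcov : (Set.univ : Set (PSL2R ⧸ Γ)) ⊆ ⋃ n, V n := by
    intro q _
    obtain ⟨g, rfl⟩ := QuotientGroup.mk_surjective q
    obtain ⟨n, hn⟩ := exists_nat_gt (BB II (pa g II))
    exact Set.mem_iUnion.2 ⟨n, g, hn, rfl⟩
  obtain ⟨n, hn⟩ := isCompact_univ.elim_directed_cover V hV hcov hmono.directed_le
  refine ⟨n, fun g => ?_⟩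
  obtain ⟨g', hg', e⟩ := hn (Set.mem_univ (g : PSL2R ⧸ Γ))
  have e' : g⁻¹ * g' ∈ Γ := QuotientGroup.eq.1 e.symm
  refine ⟨⟨_, e'⟩, ?_⟩
  have h : BB II (pa g' II) < n := hg'
  simpa using h

theorem chol {y : V3} (hy : y ∈ CC) : ∃ h : SL2R, y = √(BB y y) • act h II := by
  obtain ⟨ha, hQ⟩ := hy
  have hD : 0 < √(BB y y) := Real.sqrt_pos.2 hQ
  have hD2 : √(BB y y) * √(BB y y) = y.1 * y.2.2 - y.2.1 ^ 2 := by
    rw [Real.mul_self_sqrt hQ.le]; simp only [BB]; ring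
  set D := √(BB y y)
  have hp0 : 0 < √(y.1 / D) := Real.sqrt_pos.2 (by positivity)
  have hp2 : √(y.1 / D) ^ 2 = y.1 / D := Real.sq_sqrt (by positivity)
  set p := √(y.1 / D)
  have hp3 : p ^ 2 * D = y.1 := by rw [hp2]; field_simp
  refine ⟨⟨!![p, 0; y.2.1 / D / p, 1 / p], by rw [Matrix.det_fin_two]; simp [hp0.ne']⟩, ?_⟩
  refine Prod.ext ?_ (Prod.ext ?_ ?_)
  · simp [act, II]; linarith
  · simp [act, II]; field_simp
  · simp [act, II]
    field_simp
    nlinarith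

noncomputable def mkGeo (hc : CompactSpace (PSL2R ⧸ Γ)) (hd : DiscreteTopology Γ) (t : ℝ)
    (ht : ∀ γ : Γ, pa γ.1 (Xt t) = Xt t → γ = 1) : Geo Γ where
  x γ := pa γ.1 (Xt t)
  L γ := pa γ.1
  xC γ := pa_CC _ (Xt_C t)
  xQ γ := by rw [pa_BB, Xt_Q]
  xi := by
    intro γ δ h
    have h' : pa γ.1 (Xt t) = pa δ.1 (Xt t) := h
    have := ht (δ⁻¹ * γ) (by
      show pa (δ.1⁻¹ * γ.1) (Xt t) = Xt t
      rw [pa_mul, h', ← pa_mul, inv_mul_cancel, pa_one])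
    exact (inv_mul_eq_one.1 this).symm
  hB γ z δ := by
    show BB (pa γ.1 z) (pa (γ.1 * δ.1) (Xt t)) = _
    rw [pa_mul, pa_BB]
  hC γ z hz := pa_CC _ hz
  hdt γ a b c := by
    show dt (pa (γ.1 * a.1) (Xt t)) (pa (γ.1 * b.1) (Xt t)) (pa (γ.1 * c.1) (Xt t)) = _
    rw [pa_mul, pa_mul, pa_mul, pa_dt]
  proper R := by
    refine (prop0 Γ hd (4 * BB II (Xt t) ^ 2 * R)).subset ?_
    intro γ hγ
    have h0 : BB (pa 1 (Xt t)) (pa γ.1 (Xt t)) ≤ R := hγ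
    rw [pa_one] at h0
    show BB II (pa γ.1 II) ≤ 4 * BB II (Xt t) ^ 2 * R
    have h1 := BB_tri II_C (pa_CC γ.1 II_C) (Xt_C t)
    have h2 := BB_tri (Xt_C t) (pa_CC γ.1 II_C) (pa_CC γ.1 (Xt_C t))
    rw [Xt_Q, one_mul] at h1
    rw [pa_BB, pa_BB, Xt_Q, one_mul, BB_comm (Xt t) II] at h2
    have p := BB_pos II_C (Xt_C t)
    calc _ ≤ _ := h1
      _ ≤ 2 * BB II (Xt t) * (2 * BB (Xt t) (pa γ.1 (Xt t)) * BB II (Xt t)) :=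
        mul_le_mul_of_nonneg_left h2 (by positivity)
      _ = 4 * BB II (Xt t) ^ 2 * BB (Xt t) (pa γ.1 (Xt t)) := by ring
      _ ≤ _ := mul_le_mul_of_nonneg_left h0 (by positivity)
  cocpt := by
    obtain ⟨n, hn⟩ := cov Γ hc
    refine ⟨2 * n * BB II (Xt t), fun y hy => ?_⟩
    obtain ⟨h, e⟩ := chol hy
    obtain ⟨γ, hγ⟩ := hn (h : PSL2R)⁻¹
    refine ⟨γ, ?_⟩
    have h1 := BB_tri hy (pa_CC γ.1 (Xt_C t)) (pa_CC γ.1 II_C)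
    rw [pa_BB, pa_BB, II_Q, one_mul] at h1
    have h2 : BB y (pa γ.1 II) ≤ √(BB y y) * n := by
      have e2 : BB y (pa γ.1 II) = √(BB y y) * BB (act h II) (pa γ.1 II) := by
        conv_lhs => rw [e]
        rw [BB_smul]
      rw [e2]
      refine mul_le_mul_of_nonneg_left ?_ (Real.sqrt_nonneg _)
      rw [← pa_mk, ← pa_BB (h : PSL2R)⁻¹, ← pa_mul, ← pa_mul, inv_mul_cancel, pa_one]
      exact hγ.le
    have p := BB_pos II_C (Xt_C t)
    nlinarith [mul_le_mul_of_nonneg_right h2 p.le]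

end psl

theorem cocompact_fuchsian_has_poincare_presentation
    (Γ : Subgroup PSL2R) (hd : DiscreteTopology Γ) (hc : CompactSpace (PSL2R ⧸ Γ)) :
    ∃ (g r : ℕ) (ν : Fin r → ℕ), (∀ j, 2 ≤ ν j) ∧
      Nonempty (Γ ≃* FuchsianGroup g r ν) := by
  obtain ⟨t, ht⟩ := gen_t Γ hd
  exact (mkGeo Γ hc hd t ht).main
end

section
/- Let Γ be a discrete subgroup of SL(2,ℝ). Then the orbit space ℍ/Γ of the Möbius action of Γ on the upper half-plane is compact if and only if the coset space SL(2,ℝ)/Γ is compact. -/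
open UpperHalfPlane Matrix

theorem aux_compact_iff {G X : Type*} [Group G] [TopologicalSpace G] [IsTopologicalGroup G]
    [TopologicalSpace X] [WeaklyLocallyCompactSpace X] [MulAction G X] [ContinuousSMul G X]
    [MulAction.IsPretransitive G X] (x₀ : X) (hp : IsProperMap fun g : G => g • x₀)
    (Γ : Subgroup G) :
    CompactSpace (Quotient (MulAction.orbitRel Γ X)) ↔ CompactSpace (G ⧸ Γ) := by
  constructor
  · intro hc
    obtain ⟨K, hK, hcov⟩ : ∃ K : Set X, IsCompact K ∧ ∀ x : X, ∃ γ : Γ, γ • x ∈ K := by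
      choose C hC hCx using fun x : X => exists_compact_mem_nhds x
      have hopen : IsOpenMap (Quotient.mk (MulAction.orbitRel Γ X)) :=
        isOpenMap_quotient_mk'_mul
      obtain ⟨t, ht⟩ := isCompact_univ.elim_finite_subcover
        (fun x : X => Quotient.mk (MulAction.orbitRel Γ X) '' interior (C x))
        (fun x => hopen _ isOpen_interior)
        (by
          intro q _
          induction q using Quotient.inductionOn with
          | h x => exact Set.mem_iUnion.2 ⟨x, x, mem_interior_iff_mem_nhds.2 (hCx x), rfl⟩)
      refine ⟨⋃ x ∈ t, C x, t.isCompact_biUnion fun x _ => hC x, fun x => ?_⟩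
      have hx := ht (Set.mem_univ (Quotient.mk (MulAction.orbitRel Γ X) x))
      simp only [Set.mem_iUnion] at hx
      obtain ⟨y, hy, z, hz, hzx⟩ := hx
      obtain ⟨γ, hγ⟩ := MulAction.orbitRel_apply.1 (Quotient.exact hzx)
      refine ⟨γ, ?_⟩
      simp only at hγ
      rw [hγ]
      exact Set.mem_biUnion hy (interior_subset hz)
    have hL := ((hp.isCompact_preimage hK).image continuous_inv).image
      (QuotientGroup.continuous_mk (N := Γ))
    refine ⟨?_⟩
    convert hL
    symm
    rw [Set.eq_univ_iff_forall]
    intro q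
    induction q using QuotientGroup.induction_on with
    | H g =>
      obtain ⟨γ, hγ⟩ := hcov (g⁻¹ • x₀)
      refine ⟨((γ : G) * g⁻¹)⁻¹, ⟨(γ : G) * g⁻¹, ?_, rfl⟩, ?_⟩
      · simpa [mul_smul, Subgroup.smul_def] using hγ
      · refine QuotientGroup.eq.2 ?_
        simp
  · intro hc
    let f : G ⧸ Γ → Quotient (MulAction.orbitRel Γ X) :=
      Quotient.lift (fun g : G => Quotient.mk (MulAction.orbitRel Γ X) (g⁻¹ • x₀)) (by
        intro a b hab
        have hab := QuotientGroup.leftRel_apply.1 hab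
        refine Quotient.sound (MulAction.orbitRel_apply.2 ⟨⟨_, hab⟩, ?_⟩)
        simp [Subgroup.smul_def, smul_smul])
    have hf : Continuous f := by
      refine Continuous.quotient_lift ?_ _
      exact continuous_quotient_mk'.comp (continuous_inv.smul continuous_const)
    have hs : Function.Surjective f := by
      intro q
      induction q using Quotient.inductionOn with
      | h x =>
        obtain ⟨g, rfl⟩ := MulAction.exists_smul_eq G x₀ x
        exact ⟨QuotientGroup.mk g⁻¹, by
          change Quotient.mk _ ((g⁻¹)⁻¹ • x₀) = _
          rw [inv_inv]⟩
    exact hs.compactSpace hf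

/-- For a discrete subgroup `Γ ≤ SL(2,ℝ)`, the orbit space `ℍ/Γ` of the Möbius
action is compact iff the coset space `SL(2,ℝ)/Γ` is compact. -/
theorem orbit_space_compact_iff_coset_space_compact
    (Γ : Subgroup SL2R) (hd : DiscreteTopology Γ) :
    CompactSpace (Quotient (MulAction.orbitRel Γ ℍ)) ↔ CompactSpace (SL2R ⧸ Γ) := by
  exact @aux_compact_iff SL2R ℍ _ Matrix.SpecialLinearGroup.instTopologicalSpace
    Matrix.SpecialLinearGroup.topologicalGroup _ _ _ UpperHalfPlane.instContinuousSMulSL2R _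
    UpperHalfPlane.I UpperHalfPlane.isProperMap_smul_I Γ
end
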